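/- For every 1 < p < ∞ there exists a constant C > 0 such that for every u ∈ C_c^∞(ℝ^N; ℝ): ‖ (1+|x|^{α}) D²u ‖_{L^p(ℝ^N)} ≤ C ( ‖Au‖_{L^p(ℝ^N)} + ‖u‖_{L^p(ℝ^N)} ), where (1+|x|^{α}) D²u denotes the function x ↦ (1+|x|^{α}) |D²u(x)| and |D²u(x)| = (Σ_{i,j=1}^N |D_{ij}u(x)|²)^{1/2} is the Hilbert–Schmidt norm of the Hessian. -/

import Mathlib

open Real MeasureTheory Metric
open scoped ENNReal NNReal

/-- The `i`-th partial derivative of `u` at `x`. -/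
noncomputable def pd {N : ℕ} {F : Type*} [NormedAddCommGroup F] [NormedSpace ℝ F]
    (u : EuclideanSpace ℝ (Fin N) → F) (i : Fin N) (x : EuclideanSpace ℝ (Fin N)) : F :=
  fderiv ℝ u x (EuclideanSpace.single i 1)

/-- The Laplacian of `u` at `x`. -/
noncomputable def lap {N : ℕ} {F : Type*} [NormedAddCommGroup F] [NormedSpace ℝ F]
    (u : EuclideanSpace ℝ (Fin N) → F) (x : EuclideanSpace ℝ (Fin N)) : F :=
  ∑ i, pd (pd u i) i x

/-- The elliptic operator `Au = (1+|x|^α)Δu + b|x|^{α-2} x·∇u - c|x|^β u`. -/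
noncomputable def opA {N : ℕ} (α β b c : ℝ) (u : EuclideanSpace ℝ (Fin N) → ℝ)
    (x : EuclideanSpace ℝ (Fin N)) : ℝ :=
  (1 + ‖x‖ ^ α) * lap u x + b * ‖x‖ ^ (α - 2) * (∑ i, x i * pd u i x)
    - c * ‖x‖ ^ β * u x

open Real MeasureTheory Metric
open scoped ENNReal NNReal

lemma bell_a1 {r ρ s P Q R : ℝ} (hr : 1 ≤ r) (hρ : 1/2 < ρ) (hρ1 : ρ ≤ 1) (hs : s = 1 - 1/r)
    (hrρ : 1/r + 1/ρ = 2) (hP : 0 < P) (hQ : 0 < Q) (hR : R = P^r + Q^ρ) :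
    0 < R ∧ P ^ (1/2:ℝ) * Q ^ (ρ - 1/2) * R ^ (s-1) ≤ 1 ∧ P ^ (r+1) * R ^ (s-2) ≤ 1 ∧
      P * Q ^ ρ * R ^ (s-2) ≤ 1 ∧ 1 ≤ Q ^ (ρ-1) * R ^ s := by
  have hr0 : 0 < r := by linarith
  have hρ0 : 0 < ρ := by linarith
  have hPr : 0 < P ^ r := rpow_pos_of_pos hP _
  have hQr : 0 < Q ^ ρ := rpow_pos_of_pos hQ _
  have hR0 : 0 < R := by rw [hR]; positivity
  have hP1 : P ^ r ≤ R := by rw [hR]; linarith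
  have hQ1 : Q ^ ρ ≤ R := by rw [hR]; linarith
  have hPe : ∀ x : ℝ, 0 ≤ x → P ^ x ≤ R ^ (x / r) := by
    intro x hx
    have : P ^ x = (P ^ r) ^ (x / r) := by
      rw [← rpow_mul hP.le]; congr 1; field_simp
    rw [this]
    exact rpow_le_rpow hPr.le hP1 (by positivity)
  have hQe : ∀ x : ℝ, 0 ≤ x → Q ^ x ≤ R ^ (x / ρ) := by
    intro x hx
    have : Q ^ x = (Q ^ ρ) ^ (x / ρ) := by
      rw [← rpow_mul hQ.le]; congr 1; field_simp
    rw [this]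
    exact rpow_le_rpow hQr.le hQ1 (by positivity)
  have hR1 : ∀ x : ℝ, 0 ≤ R ^ x := fun x => (rpow_pos_of_pos hR0 x).le
  refine ⟨hR0, ?_, ?_, ?_, ?_⟩
  · calc P ^ (1/2:ℝ) * Q ^ (ρ - 1/2) * R ^ (s-1)
        ≤ R ^ ((1/2:ℝ)/r) * R ^ ((ρ-1/2)/ρ) * R ^ (s-1) := by
          gcongr
          · exact hPe _ (by norm_num)
          · exact hQe _ (by linarith)
      _ = 1 := by
          rw [← rpow_add hR0, ← rpow_add hR0]
          have : (1/2:ℝ)/r + (ρ-1/2)/ρ + (s-1) = 0 := by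
            have e1 : (1/2:ℝ)/r = (1/2) * (1/r) := by ring
            have e2 : (ρ-1/2)/ρ = 1 - (1/2) * (1/ρ) := by field_simp
            rw [e1, e2, hs]; linarith
          rw [this, rpow_zero]
  · calc P ^ (r+1) * R ^ (s-2) ≤ R ^ ((r+1)/r) * R ^ (s-2) := by
          gcongr
          exact hPe _ (by linarith)
      _ = 1 := by
          rw [← rpow_add hR0]
          have : (r+1)/r + (s-2) = 0 := by rw [hs]; field_simp; ring
          rw [this, rpow_zero]
  · calc P * Q ^ ρ * R ^ (s-2) ≤ R ^ (1/r) * R ^ (1:ℝ) * R ^ (s-2) := by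
          gcongr
          · simpa using hPe 1 (by norm_num)
          · simpa using hQ1
      _ = 1 := by
          rw [← rpow_add hR0, ← rpow_add hR0]
          have : 1/r + 1 + (s-2) = 0 := by rw [hs]; ring
          rw [this, rpow_zero]
  · have h1 : Q ^ (1 - ρ) ≤ R ^ s := by
      have := hQe (1-ρ) (by linarith)
      have h2 : (1-ρ)/ρ = s := by
        have e2 : (1-ρ)/ρ = (1/ρ) - 1 := by field_simp
        rw [e2, hs]; linarith
      rwa [h2] at this
    calc (1:ℝ) = Q ^ (ρ-1) * Q ^ (1-ρ) := by
          rw [← rpow_add hQ]; simp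
      _ ≤ _ := by gcongr

lemma bell_amgm {X Y W : ℝ} (hX : 0 ≤ X) (hY : 0 ≤ Y) (h : W^2 ≤ X * Y) :
    12 * W ≤ 18 * X + 2 * Y := by
  apply le_of_sq_le_sq _ (by positivity)
  nlinarith [sq_nonneg (9*X - Y)]

set_option maxHeartbeats 1000000 in
lemma bell_hess {r ρ s A P Q R u v d e : ℝ} (hr : 1 ≤ r) (hρ : 1/2 < ρ) (hρ1 : ρ ≤ 1)
    (hs : s = 1 - 1/r) (hrρ : 1/r + 1/ρ = 2) (hP : 0 < P) (hQ : 0 < Q) (hR : R = P^r + Q^ρ)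
    (hu : u^2 ≤ P) (hv : v^2 ≤ Q) (hA1 : 4 * r ≤ A) (hA2 : 26 ≤ A * (2*ρ*(2*ρ-1)))
    {P1 P2 Q1 Q2 R1 R2 : ℝ} (hP1 : P1 = 2*u*d) (hP2 : P2 = 2*d^2) (hQ1 : Q1 = 2*v*e)
    (hQ2 : Q2 = 2*e^2) (hR1 : R1 = r * P^(r-1) * P1 + ρ * Q^(ρ-1) * Q1)
    (hR2 : R2 = r*(r-1)*P^(r-2)*P1^2 + r*P^(r-1)*P2 + ρ*(ρ-1)*Q^(ρ-2)*Q1^2 + ρ*Q^(ρ-1)*Q2) :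
    4 * |d| * |e| ≤ A * R2 + P2 * R^s + 2 * P1 * (s*R^(s-1)*R1)
      + P * (s*R^(s-1)*R2 + s*(s-1)*R^(s-2)*R1^2) := by
  obtain ⟨hR0, h1, h2, h3, h4⟩ := bell_a1 hr hρ hρ1 hs hrρ hP hQ hR
  have hs0 : 0 ≤ s := by
    rw [hs]; have : 1/r ≤ 1 := by rw [div_le_one (by linarith)]; exact hr
    linarith
  have hs1 : s ≤ 1 := by rw [hs]; have : 0 < 1/r := by positivity
                         linarith
  have pP : ∀ x : ℝ, 0 < P^x := fun x => rpow_pos_of_pos hP x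
  have pQ : ∀ x : ℝ, 0 < Q^x := fun x => rpow_pos_of_pos hQ x
  have pR : ∀ x : ℝ, 0 < R^x := fun x => rpow_pos_of_pos hR0 x
  -- lower bound for R2
  have hG : 2*ρ*(2*ρ-1)*Q^(ρ-1)*e^2 ≤ ρ*(ρ-1)*Q^(ρ-2)*Q1^2 + ρ*Q^(ρ-1)*Q2 := by
    have : Q^(ρ-1) = Q^(ρ-2) * Q := by
      conv_rhs => rw [← rpow_one Q]
      rw [← rpow_mul hQ.le, ← rpow_add hQ]; congr 1; ring
    rw [this, hQ1, hQ2]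
    have hq : 0 ≤ Q^(ρ-2)*e^2*ρ*(1-ρ) * (Q - v^2) := by
      have := (pQ (ρ-2)).le
      have h1 : 0 ≤ 1 - ρ := by linarith
      have h2 : 0 ≤ Q - v^2 := by linarith
      positivity
    nlinarith
  have hF : 2*r*P^(r-1)*d^2 ≤ r*(r-1)*P^(r-2)*P1^2 + r*P^(r-1)*P2 := by
    rw [hP2]
    have : 0 ≤ r*(r-1)*P^(r-2)*P1^2 := by
      have := (pP (r-2)).le
      have : 0 ≤ r - 1 := by linarith
      positivity
    nlinarith
  have hR2' : 2*r*P^(r-1)*d^2 + 2*ρ*(2*ρ-1)*Q^(ρ-1)*e^2 ≤ R2 := by rw [hR2]; linarith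
  have hR20 : 0 ≤ R2 := by
    refine le_trans ?_ hR2'
    have := (pP (r-1)).le
    have := (pQ (ρ-1)).le
    have : 0 ≤ 2*ρ-1 := by linarith
    positivity
  -- cross term
  have hc : -(8 * |d| * |e|) ≤ 2 * P1 * (s*R^(s-1)*R1) := by
    have hb : |u| * |v| * Q^(ρ-1) * R^(s-1) ≤ 1 := by
      refine le_trans ?_ h1
      have hu' : |u| ≤ P^(1/2:ℝ) := by
        rw [← Real.sqrt_eq_rpow]; exact abs_le_sqrt hu
      have hv' : |v| * Q^(ρ-1) ≤ Q^(ρ-1/2) := by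
        have : Q^(ρ-1/2) = Q^(1/2:ℝ) * Q^(ρ-1) := by
          rw [← rpow_add hQ]; congr 1; ring
        rw [this]
        have hv'' : |v| ≤ Q^(1/2:ℝ) := by
          rw [← Real.sqrt_eq_rpow]; exact abs_le_sqrt hv
        gcongr
      rw [mul_assoc |u|]
      have := (pR (s-1)).le
      gcongr
    have hcr : -(|d| * |e|) ≤ u * v * (d * e) * Q^(ρ-1) * R^(s-1) := by
      have : |u * v * (d * e) * Q^(ρ-1) * R^(s-1)| ≤ |d| * |e| := by
        rw [abs_mul, abs_mul, abs_mul, abs_mul, abs_mul d e, abs_of_pos (pQ _), abs_of_pos (pR _)]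
        have : 0 ≤ |d| * |e| := by positivity
        nlinarith
      linarith [neg_le_of_abs_le this]
    have hpos : 0 ≤ P1 * (r * P^(r-1) * P1) * R^(s-1) := by
      have := (pP (r-1)).le
      have := (pR (s-1)).le
      have : P1 * (r * P^(r-1) * P1) = r * P^(r-1) * P1^2 := by ring
      rw [this]; positivity
    have e1 : 2 * P1 * (s*R^(s-1)*R1) = 2*s*(P1 * (r * P^(r-1) * P1) * R^(s-1))
        + 8 * (s*ρ) * (u * v * (d * e) * Q^(ρ-1) * R^(s-1)) := by
      rw [hR1, hP1, hQ1]; ring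
    rw [e1]
    have h5 : 0 ≤ s * ρ := by have : 0 ≤ ρ := by linarith
                              positivity
    have h6 : s * ρ ≤ 1 := by
      have : 0 ≤ ρ := by linarith
      nlinarith
    have h7 : 0 ≤ |d| * |e| := by positivity
    have h8 : 0 ≤ 2*s*(P1 * (r * P^(r-1) * P1) * R^(s-1)) := by
      exact mul_nonneg (by positivity) hpos
    have h9 : -(|d| * |e|) ≤ (s*ρ) * (u * v * (d * e) * Q^(ρ-1) * R^(s-1)) := by
      generalize u * v * (d * e) * Q^(ρ-1) * R^(s-1) = Z at hcr
      generalize |d| * |e| = W at hcr h7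
      generalize s * ρ = k at h5 h6
      have : k * -W ≤ k * Z := mul_le_mul_of_nonneg_left hcr h5
      nlinarith
    linarith
  -- quadratic term
  have hq : -(8 * r^2 * P^(r-1) * d^2 + 8 * Q^(ρ-1) * e^2)
      ≤ P * (s*(s-1)*R^(s-2)*R1^2) := by
    have hsq : R1^2 ≤ 2 * (r * P^(r-1) * P1)^2 + 2 * (ρ * Q^(ρ-1) * Q1)^2 := by
      rw [hR1]; nlinarith [sq_nonneg (r * P^(r-1) * P1 - ρ * Q^(ρ-1) * Q1)]
    have t1 : P * R^(s-2) * (r * P^(r-1) * P1)^2 ≤ 4 * r^2 * P^(r-1) * d^2 := by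
      have e1 : P^(r+1) = P^(r-1) * P * P := by
        have : P * P = P^(2:ℝ) := by norm_num [sq]
        rw [mul_assoc, this, ← rpow_add hP]; congr 1; ring
      rw [e1] at h2
      have e2 : P * R^(s-2) * (r * P^(r-1) * P1)^2
        = 4 * r^2 * P^(r-1) * d^2 * (P^(r-1) * P * u^2 * R^(s-2)) := by rw [hP1]; ring
      rw [e2]
      have h9 : P^(r-1) * P * u^2 * R^(s-2) ≤ 1 := by
        refine le_trans ?_ h2
        have := (pP (r-1)).le
        have := (pR (s-2)).le
        gcongr
      have := (pP (r-1)).le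
      have : 0 ≤ 4 * r^2 * P^(r-1) * d^2 := by positivity
      nlinarith
    have t2 : P * R^(s-2) * (ρ * Q^(ρ-1) * Q1)^2 ≤ 4 * Q^(ρ-1) * e^2 := by
      have e1 : Q^ρ = Q^(ρ-1) * Q := by
        conv_rhs => enter [2]; rw [← rpow_one Q]
        rw [← rpow_add hQ]; congr 1; ring
      rw [e1] at h3
      have e2 : P * R^(s-2) * (ρ * Q^(ρ-1) * Q1)^2
        = 4 * ρ^2 * Q^(ρ-1) * e^2 * (P * (Q^(ρ-1) * v^2) * R^(s-2)) := by rw [hQ1]; ring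
      rw [e2]
      have h9 : P * (Q^(ρ-1) * v^2) * R^(s-2) ≤ 1 := by
        refine le_trans ?_ h3
        have := (pQ (ρ-1)).le
        have := (pR (s-2)).le
        gcongr
      have := (pQ (ρ-1)).le
      have h10 : 0 ≤ 4 * Q^(ρ-1) * e^2 := by positivity
      have h11 : ρ^2 ≤ 1 := by nlinarith
      have h12 : 0 ≤ P * (Q^(ρ-1) * v^2) * R^(s-2) := by
        have := (pR (s-2)).le
        positivity
      calc 4 * ρ^2 * Q^(ρ-1) * e^2 * (P * (Q^(ρ-1) * v^2) * R^(s-2))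
          = (4 * Q^(ρ-1) * e^2) * (ρ^2 * (P * (Q^(ρ-1) * v^2) * R^(s-2))) := by ring
        _ ≤ (4 * Q^(ρ-1) * e^2) * (1 * 1) := by gcongr
        _ = _ := by ring
    have h13 : P * R^(s-2) * R1^2 ≤ 8 * r^2 * P^(r-1) * d^2 + 8 * Q^(ρ-1) * e^2 := by
      have : 0 ≤ P * R^(s-2) := by have := (pR (s-2)).le
                                   positivity
      calc P * R^(s-2) * R1^2 ≤ P * R^(s-2) *
            (2 * (r * P^(r-1) * P1)^2 + 2 * (ρ * Q^(ρ-1) * Q1)^2) := by gcongr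
        _ = 2 * (P * R^(s-2) * (r * P^(r-1) * P1)^2)
            + 2 * (P * R^(s-2) * (ρ * Q^(ρ-1) * Q1)^2) := by ring
        _ ≤ _ := by linarith
    have h14 : 0 ≤ P * R^(s-2) * R1^2 := by have := (pR (s-2)).le
                                            positivity
    have e3 : P * (s*(s-1)*R^(s-2)*R1^2) = -((s*(1-s)) * (P * R^(s-2) * R1^2)) := by ring
    rw [e3]
    have h15 : s*(1-s) ≤ 1 := by nlinarith
    have h16 : (s*(1-s)) * (P * R^(s-2) * R1^2) ≤ 1 * (P * R^(s-2) * R1^2) :=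
      mul_le_mul_of_nonneg_right h15 h14
    linarith
  have hdrop : 0 ≤ P * (s*R^(s-1)*R2) := by have := (pR (s-1)).le
                                            positivity
  have hAR : 8 * r^2 * P^(r-1) * d^2 + 26 * Q^(ρ-1) * e^2 ≤ A * R2 := by
    have hA0 : 0 ≤ A := by linarith
    calc _ ≤ A * (2*r*P^(r-1)*d^2 + 2*ρ*(2*ρ-1)*Q^(ρ-1)*e^2) := by
          have a1 : 0 ≤ r * P^(r-1)*d^2 := by have := (pP (r-1)).le
                                              positivity
          have a2 : 0 ≤ Q^(ρ-1)*e^2 := by have := (pQ (ρ-1)).le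
                                          positivity
          have b1 := mul_le_mul_of_nonneg_right hA1 a1
          have b2 := mul_le_mul_of_nonneg_right hA2 a2
          linarith
      _ ≤ _ := by gcongr
  have hfin : 12 * |d| * |e| ≤ 18 * Q^(ρ-1) * e^2 + P2 * R^s := by
    rw [hP2]
    have := (pQ (ρ-1)).le
    have := (pR s).le
    have g1 : 0 ≤ 2 * R^s * (|d| * 1)^2 := by positivity
    -- AM-GM
    have g2 : (|d| * |e|)^2 ≤ (Q^(ρ-1) * e^2) * (R^s * d^2) := by
      have : (|d| * |e|)^2 = d^2 * e^2 := by rw [mul_pow, sq_abs, sq_abs]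
      rw [this]
      have : (Q^(ρ-1) * e^2) * (R^s * d^2) = (Q^(ρ-1) * R^s) * (d^2*e^2) := by ring
      rw [this]
      exact le_mul_of_one_le_left (by positivity) h4
    set X := Q^(ρ-1) * e^2
    set Y := R^s * d^2
    have hX : 0 ≤ X := by positivity
    have hY : 0 ≤ Y := by positivity
    have : 12 * (|d| * |e|) ≤ 18 * X + 2 * Y := by
      exact bell_amgm hX hY g2
    have e5 : 18 * Q^(ρ-1) * e^2 + 2 * d^2 * R^s = 18 * X + 2 * Y := by ring
    rw [e5]; linarith
  have e6 : P * (s*R^(s-1)*R2 + s*(s-1)*R^(s-2)*R1^2)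
    = P * (s*R^(s-1)*R2) + P * (s*(s-1)*R^(s-2)*R1^2) := by ring
  rw [e6]
  linarith

open Real MeasureTheory Metric
open scoped ENNReal NNReal

/-- Regularised Bellman function. -/
noncomputable def bellB (A r ρ s κ u v : ℝ) : ℝ :=
  A * ((κ + u^2)^r + (κ + v^2)^ρ) + (κ + u^2) * ((κ + u^2)^r + (κ + v^2)^ρ)^s

lemma bell_line {r ρ s A κ : ℝ} (hr : 1 ≤ r) (hρ : 1/2 < ρ) (hρ1 : ρ ≤ 1)
    (hs : s = 1 - 1/r) (hrρ : 1/r + 1/ρ = 2) (hκ : 0 < κ)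
    (hA1 : 4 * r ≤ A) (hA2 : 26 ≤ A * (2*ρ*(2*ρ-1))) (u v d e : ℝ) :
    ConvexOn ℝ Set.univ (fun t : ℝ => bellB A r ρ s κ (u + t*d) (v + t*e)
      - 2 * |d| * |e| * t^2) := by
  set P : ℝ → ℝ := fun t => κ + (u + t*d)^2 with hPdef
  set Q : ℝ → ℝ := fun t => κ + (v + t*e)^2 with hQdef
  have hP0 : ∀ t, 0 < P t := fun t => by simp only [hPdef]; positivity
  have hQ0 : ∀ t, 0 < Q t := fun t => by simp only [hQdef]; positivity
  set P1 : ℝ → ℝ := fun t => 2*(u+t*d)*d with hP1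
  set Q1 : ℝ → ℝ := fun t => 2*(v+t*e)*e with hQ1
  have hlin : ∀ a b t : ℝ, HasDerivAt (fun t : ℝ => a + t*b) b t := by
    intro a b t
    simpa using ((hasDerivAt_id t).mul_const b).const_add a
  have dP : ∀ t, HasDerivAt P (P1 t) t := by
    intro t
    have := ((hlin u d t).pow 2).const_add κ
    refine this.congr_deriv ?_
    simp only [hP1]; ring
  have dQ : ∀ t, HasDerivAt Q (Q1 t) t := by
    intro t
    have := ((hlin v e t).pow 2).const_add κ
    refine this.congr_deriv ?_
    simp only [hQ1]; ring
  have dP1 : ∀ t, HasDerivAt P1 (2*d^2) t := by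
    intro t
    have := ((hlin u d t).const_mul 2).mul_const d
    refine this.congr_deriv ?_
    ring
  have dQ1 : ∀ t, HasDerivAt Q1 (2*e^2) t := by
    intro t
    have := ((hlin v e t).const_mul 2).mul_const e
    refine this.congr_deriv ?_
    ring
  set R : ℝ → ℝ := fun t => P t ^ r + Q t ^ ρ with hRdef
  have hR0 : ∀ t, 0 < R t := fun t => add_pos (rpow_pos_of_pos (hP0 t) _) (rpow_pos_of_pos (hQ0 t) _)
  set R1 : ℝ → ℝ := fun t => r * P t ^ (r-1) * P1 t + ρ * Q t ^ (ρ-1) * Q1 t with hR1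
  set R2 : ℝ → ℝ := fun t => r*(r-1)*P t^(r-2)*(P1 t)^2 + r*P t^(r-1)*(2*d^2)
    + ρ*(ρ-1)*Q t^(ρ-2)*(Q1 t)^2 + ρ*Q t^(ρ-1)*(2*e^2) with hR2
  have dR : ∀ t, HasDerivAt R (R1 t) t := by
    intro t
    have := ((dP t).rpow_const (p := r) (Or.inl (hP0 t).ne')).add
      ((dQ t).rpow_const (p := ρ) (Or.inl (hQ0 t).ne'))
    refine this.congr_deriv ?_
    simp only [hR1]; ring
  have dR1 : ∀ t, HasDerivAt R1 (R2 t) t := by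
    intro t
    have a1 := (((dP t).rpow_const (p := r-1) (Or.inl (hP0 t).ne')).const_mul r).mul (dP1 t)
    have a2 := (((dQ t).rpow_const (p := ρ-1) (Or.inl (hQ0 t).ne')).const_mul ρ).mul (dQ1 t)
    refine (a1.add a2).congr_deriv ?_
    simp only [hR2]
    rw [show r - 1 - 1 = r - 2 by ring, show ρ - 1 - 1 = ρ - 2 by ring]
    ring
  set S1 : ℝ → ℝ := fun t => A * R1 t + (P1 t * R t ^ s + P t * (R1 t * s * R t ^ (s-1)))
    - 2 * |d| * |e| * (2*t) with hS1
  have dS : ∀ t, HasDerivAt (fun t : ℝ => bellB A r ρ s κ (u + t*d) (v + t*e)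
      - 2 * |d| * |e| * t^2) (S1 t) t := by
    intro t
    have a1 := ((dR t).const_mul A).add
      ((dP t).mul ((dR t).rpow_const (p := s) (Or.inl (hR0 t).ne')))
    have a2 := ((hasDerivAt_id t).pow 2).const_mul (2 * |d| * |e|)
    refine (a1.sub a2).congr_deriv ?_
    simp [hS1]
  have dS1 : ∀ t, HasDerivAt S1 (A * R2 t + (2*d^2) * R t^s + 2 * P1 t * (s*R t^(s-1)*R1 t)
      + P t * (s*R t^(s-1)*R2 t + s*(s-1)*R t^(s-2)*(R1 t)^2) - 4 * |d| * |e|) t := by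
    intro t
    have b := (dR t).rpow_const (p := s) (Or.inl (hR0 t).ne')
    have b' := (dR t).rpow_const (p := s-1) (Or.inl (hR0 t).ne')
    have a1 := ((dR1 t).const_mul A).add
      (((dP1 t).mul b).add ((dP t).mul (((dR1 t).mul_const s).mul b')))
    have a2 := ((hasDerivAt_id t).const_mul 2).const_mul (2 * |d| * |e|)
    refine (a1.sub a2).congr_deriv ?_
    simp only [Pi.mul_apply]
    rw [show s - 1 - 1 = s - 2 by ring]
    ring
  have e1 : deriv (fun t : ℝ => bellB A r ρ s κ (u + t*d) (v + t*e)
      - 2 * |d| * |e| * t^2) = S1 := funext fun t => (dS t).deriv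
  refine convexOn_univ_of_deriv2_nonneg (fun t => (dS t).differentiableAt) ?_ ?_
  · rw [e1]; exact fun t => (dS1 t).differentiableAt
  · intro t
    simp only [Function.iterate_succ, Function.iterate_zero, Function.comp_apply, id_eq]
    rw [e1, (dS1 t).deriv]
    have := bell_hess (A := A) (P := P t) (Q := Q t) (R := R t) (u := u + t*d) (v := v + t*e)
      (d := d) (e := e) (P1 := P1 t) (Q1 := Q1 t) (R1 := R1 t) (R2 := R2 t) hr hρ hρ1 hs hrρ
      (hP0 t) (hQ0 t) rfl (by simp only [hPdef]; linarith) (by simp only [hQdef]; linarith)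
      hA1 hA2 rfl rfl rfl rfl rfl rfl
    linarith

lemma bell_cont0 {r ρ s A : ℝ} (hr : 0 < r) (hρ : 0 < ρ) (hs : 0 ≤ s) :
    Continuous (fun z : ℝ × ℝ × ℝ => bellB A r ρ s z.1 z.2.1 z.2.2) := by
  unfold bellB
  have h1 : Continuous (fun z : ℝ × ℝ × ℝ => (z.1 + z.2.1^2)^r) :=
    Continuous.rpow_const (by fun_prop) (fun _ => Or.inr hr.le)
  have h2 : Continuous (fun z : ℝ × ℝ × ℝ => (z.1 + z.2.2^2)^ρ) :=
    Continuous.rpow_const (by fun_prop) (fun _ => Or.inr hρ.le)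
  have h3 := (h1.add h2).rpow_const (p := s) (fun _ => Or.inr hs)
  exact ((h1.add h2).const_mul A).add ((by fun_prop : Continuous (fun z : ℝ × ℝ × ℝ => z.1 + z.2.1^2)).mul h3)

lemma bell_lim_le {f g : ℝ → ℝ} (hf : Continuous f) (hg : Continuous g)
    (h : ∀ κ > 0, f κ ≤ g κ) : f 0 ≤ g 0 := by
  have hf' : Filter.Tendsto f (nhdsWithin 0 (Set.Ioi 0)) (nhds (f 0)) :=
    hf.continuousAt.continuousWithinAt
  have hg' : Filter.Tendsto g (nhdsWithin 0 (Set.Ioi 0)) (nhds (g 0)) :=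
    hg.continuousAt.continuousWithinAt
  exact le_of_tendsto_of_tendsto hf' hg' (by
    filter_upwards [self_mem_nhdsWithin] with κ hκ using h κ hκ)

/-- Existence of the Bellman function, `p ≥ 2`. -/
lemma bellman_ge {p q : ℝ} (hpq : p.HolderConjugate q) (hp : 2 ≤ p) :
    ∃ (B : ℝ × ℝ → ℝ) (C : ℝ), Continuous B ∧ 0 < C ∧ (∀ z, 0 ≤ B z) ∧
      (∀ z, B z ≤ C * (|z.1|^p + |z.2|^q)) ∧ ConvexOn ℝ Set.univ B ∧
      (∀ a b : ℝ × ℝ, 2 * B ((1/2:ℝ) • (a + b)) + |a.1 - b.1| * |a.2 - b.2| ≤ B a + B b) := by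
  have hp0 : 0 < p := by linarith
  have hq1 : 1 < q := hpq.symm.lt
  have hq2 : q ≤ 2 := by
    have h := hpq.inv_add_inv_eq_one
    have h1 : p⁻¹ ≤ 2⁻¹ := inv_anti₀ (by norm_num) hp
    have h2 : (2:ℝ)⁻¹ ≤ q⁻¹ := by norm_num at h1 ⊢; linarith
    exact (inv_le_inv₀ (by norm_num) (by linarith)).1 h2
  set r := p/2 with hr_def
  set ρ := q/2 with hρ_def
  have hr : 1 ≤ r := by rw [hr_def]; linarith
  have hρ : 1/2 < ρ := by rw [hρ_def]; linarith
  have hρ1 : ρ ≤ 1 := by rw [hρ_def]; linarith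
  set s := 1 - 1/r with hs
  have hrρ : 1/r + 1/ρ = 2 := by
    have h := hpq.inv_add_inv_eq_one
    have e1 : 1/r = 2 * p⁻¹ := by rw [hr_def]; field_simp
    have e2 : 1/ρ = 2 * q⁻¹ := by rw [hρ_def]; field_simp
    rw [e1, e2]; linarith
  have hs0 : 0 ≤ s := by
    rw [hs]; have : 1/r ≤ 1 := by rw [div_le_one (by linarith)]; exact hr
    linarith
  set A := 4 * r + 26 / (2*ρ*(2*ρ-1)) with hA
  have hk : 0 < 2*ρ*(2*ρ-1) := mul_pos (by linarith) (by linarith)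
  have hA1 : 4 * r ≤ A := by rw [hA]; have : 0 < 26 / (2*ρ*(2*ρ-1)) := by positivity
                             linarith
  have hA2 : 26 ≤ A * (2*ρ*(2*ρ-1)) := by
    rw [hA, add_mul, div_mul_cancel₀ _ hk.ne']
    have : 0 ≤ 4 * r * (2*ρ*(2*ρ-1)) := by positivity
    linarith
  have hA0 : 0 < A := by linarith
  have hc := bell_cont0 (A := A) (r := r) (ρ := ρ) (s := s) (by linarith) (by linarith) hs0
  have key : ∀ (u v d e : ℝ), ConvexOn ℝ Set.univ (fun t : ℝ => bellB A r ρ s 0 (u + t*d) (v + t*e)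
      - 2 * |d| * |e| * t^2) := by
    intro u v d e
    refine ⟨convex_univ, ?_⟩
    intro x _ y _ a b ha hb hab
    refine bell_lim_le (f := fun κ => bellB A r ρ s κ (u + (a • x + b • y)*d) (v + (a • x + b • y)*e)
      - 2 * |d| * |e| * (a • x + b • y)^2)
      (g := fun κ => a • (bellB A r ρ s κ (u + x*d) (v + x*e) - 2 * |d| * |e| * x^2)
        + b • (bellB A r ρ s κ (u + y*d) (v + y*e) - 2 * |d| * |e| * y^2)) ?_ ?_ ?_
    · exact (hc.comp (by fun_prop : Continuous fun κ : ℝ => (κ, (u + (a • x + b • y)*d), (v + (a • x + b • y)*e)))).sub continuous_const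
    · have h1 : ∀ c d : ℝ, Continuous (fun κ => bellB A r ρ s κ c d) := fun c d =>
        hc.comp (by fun_prop : Continuous fun κ : ℝ => (κ, c, d))
      exact (((h1 _ _).sub continuous_const).const_smul a).add (((h1 _ _).sub continuous_const).const_smul b)
    · intro κ hκ
      exact (bell_line hr hρ hρ1 hs hrρ hκ hA1 hA2 u v d e).2 trivial trivial ha hb hab
  have hsq : ∀ (x y : ℝ), (0 + x^2)^(y/2) = |x|^y := by
    intro x y
    rw [zero_add, ← sq_abs, ← rpow_natCast, ← rpow_mul (abs_nonneg x)]; congr 1; push_cast; ring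
  refine ⟨fun z => bellB A r ρ s 0 z.1 z.2, A + 1, ?_, by linarith, ?_, ?_, ?_, ?_⟩
  · exact hc.comp (by fun_prop : Continuous fun z : ℝ × ℝ => ((0:ℝ), z.1, z.2))
  · intro z
    simp only [bellB]
    have h1 : 0 ≤ (0 + z.1^2)^r := rpow_nonneg (by positivity) _
    have h2 : 0 ≤ (0 + z.2^2)^ρ := rpow_nonneg (by positivity) _
    have h3 : 0 ≤ ((0 + z.1^2)^r + (0 + z.2^2)^ρ)^s := rpow_nonneg (by positivity) _
    positivity
  · intro z
    simp only [bellB]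
    rw [hsq, hsq]
    set R := |z.1|^p + |z.2|^q with hR
    have h1 : 0 ≤ |z.1|^p := by positivity
    have h2 : 0 ≤ |z.2|^q := by positivity
    have hR0 : 0 ≤ R := by positivity
    have h3 : 0 + z.1^2 ≤ R^(1/r) := by
      have : 0 + z.1^2 = (|z.1|^p)^(1/r) := by
        rw [← rpow_mul (abs_nonneg _)]
        have : p * (1/r) = 2 := by rw [hr_def]; field_simp
        rw [this]; norm_num
      rw [this]
      apply rpow_le_rpow h1 (by rw [hR]; linarith) (by positivity)
    have h4 : (0 + z.1^2) * R^s ≤ R := by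
      calc (0 + z.1^2) * R^s ≤ R^(1/r) * R^s := by gcongr
        _ = R := by
          rw [← rpow_add' hR0 (by rw [hs]; simp), hs]; simp
    linarith
  · refine ⟨convex_univ, ?_⟩
    intro z _ w _ a b ha hb hab
    have h := (key z.1 z.2 (w.1 - z.1) (w.2 - z.2)).2 (x := 0) (y := 1) trivial trivial ha hb hab
    simp only [smul_eq_mul, mul_zero, mul_one, zero_add, zero_mul, add_zero] at h
    have e1 : z.1 + b * (w.1 - z.1) = (a • z + b • w).1 := by
      simp; rw [show a = 1 - b by linarith]; ring
    have e2 : z.2 + b * (w.2 - z.2) = (a • z + b • w).2 := by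
      simp; rw [show a = 1 - b by linarith]; ring
    rw [e1, e2] at h
    simp only [add_sub_cancel, one_mul] at h
    simp only [smul_eq_mul]
    have : 0 ≤ |w.1 - z.1| * |w.2 - z.2| := by positivity
    have hb1 : b ≤ 1 := by linarith
    have : 2 * (|w.1 - z.1| * |w.2 - z.2|) * b^2 ≤ 2 * (|w.1 - z.1| * |w.2 - z.2|) * b := by
      gcongr; nlinarith
    nlinarith
  · intro z w
    have h := (key ((z.1+w.1)/2) ((z.2+w.2)/2) ((z.1-w.1)/2) ((z.2-w.2)/2)).2 (x := 1) (y := -1) trivial trivial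
      (show (0:ℝ) ≤ 1/2 by norm_num) (show (0:ℝ) ≤ 1/2 by norm_num) (by norm_num)
    have e1 : (z.1+w.1)/2 + 1 * ((z.1-w.1)/2) = z.1 := by ring
    have e2 : (z.1+w.1)/2 + (-1) * ((z.1-w.1)/2) = w.1 := by ring
    have e3 : (z.2+w.2)/2 + 1 * ((z.2-w.2)/2) = z.2 := by ring
    have e4 : (z.2+w.2)/2 + (-1) * ((z.2-w.2)/2) = w.2 := by ring
    have e5 : ((1/2:ℝ) • (1:ℝ) + (1/2:ℝ) • (-1:ℝ)) = 0 := by norm_num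
    have e6 : ((1/2:ℝ) • (z + w)).1 = (z.1+w.1)/2 := by simp; ring
    have e7 : ((1/2:ℝ) • (z + w)).2 = (z.2+w.2)/2 := by simp; ring
    simp only [e1, e2, e3, e4, e5, smul_eq_mul] at h
    simp only [e6, e7]
    have a1 : |(z.1-w.1)/2| = |z.1-w.1|/2 := by rw [abs_div]; norm_num
    have a2 : |(z.2-w.2)/2| = |z.2-w.2|/2 := by rw [abs_div]; norm_num
    rw [a1, a2] at h
    norm_num at h ⊢
    linarith

/-- Existence of the Bellman function, general `p`. -/
lemma bellman {p q : ℝ} (hpq : p.HolderConjugate q) :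
    ∃ (B : ℝ × ℝ → ℝ) (C : ℝ), Continuous B ∧ 0 < C ∧ (∀ z, 0 ≤ B z) ∧
      (∀ z, B z ≤ C * (|z.1|^p + |z.2|^q)) ∧ ConvexOn ℝ Set.univ B ∧
      (∀ a b : ℝ × ℝ, 2 * B ((1/2:ℝ) • (a + b)) + |a.1 - b.1| * |a.2 - b.2| ≤ B a + B b) := by
  rcases le_total 2 p with hp | hp
  · exact bellman_ge hpq hp
  · have hq : 2 ≤ q := by
      have h := hpq.inv_add_inv_eq_one
      have h1 : (2:ℝ)⁻¹ ≤ p⁻¹ := inv_anti₀ hpq.pos hp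
      have h2 : q⁻¹ ≤ (2:ℝ)⁻¹ := by norm_num at h1 ⊢; linarith
      exact (inv_le_inv₀ hpq.symm.pos (by norm_num)).1 h2
    obtain ⟨B, C, h1, h2, h3, h4, h5, h6⟩ := bellman_ge hpq.symm hq
    refine ⟨fun z => B z.swap, C, h1.comp continuous_swap, h2, fun z => h3 _, ?_, ?_, ?_⟩
    · intro z; have := h4 z.swap; simp at this; linarith
    · refine ⟨convex_univ, ?_⟩
      intro z _ w _ a b ha hb hab
      exact h5.2 (x := z.swap) (y := w.swap) trivial trivial ha hb hab
    · intro a b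
      have := h6 a.swap b.swap
      simp only [Prod.fst_swap, Prod.snd_swap] at this
      rw [mul_comm |a.1 - b.1|]
      exact this

open Real MeasureTheory Metric
open scoped ENNReal NNReal

section Discrete

variable {E : Type*} [NormedAddCommGroup E] [MeasurableSpace E] [BorelSpace E]
  {μ : Measure E} [μ.IsAddRightInvariant] [IsFiniteMeasureOnCompacts μ]
  {ι : Type*} [Fintype ι]

/-- continuous functions with compact support -/
def CC (f : E → ℝ) : Prop := Continuous f ∧ HasCompactSupport f

lemma CC.add {f g : E → ℝ} (hf : CC f) (hg : CC g) : CC (fun x => f x + g x) :=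
  ⟨hf.1.add hg.1, hf.2.add hg.2⟩
lemma CC.smul {f : E → ℝ} (c : ℝ) (hf : CC f) : CC (fun x => c * f x) :=
  ⟨hf.1.const_mul c, hf.2.mul_left (f := fun _ => c)⟩
lemma CC.sub {f g : E → ℝ} (hf : CC f) (hg : CC g) : CC (fun x => f x - g x) := by
  have := hf.add (hg.smul (-1))
  simpa [sub_eq_add_neg] using this
lemma CC.mul {f g : E → ℝ} (hf : CC f) (hg : CC g) : CC (fun x => f x * g x) :=
  ⟨hf.1.mul hg.1, hf.2.mul_right⟩
lemma CC.tr {f : E → ℝ} (a : E) (hf : CC f) : CC (fun x => f (x + a)) :=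
  ⟨hf.1.comp (by fun_prop), hf.2.comp_homeomorph (Homeomorph.addRight a)⟩
lemma CC.tr' {f : E → ℝ} (a : E) (hf : CC f) : CC (fun x => f (x - a)) := by
  simpa [sub_eq_add_neg] using hf.tr (-a)
lemma CC.comp2 {f g : E → ℝ} (hf : CC f) (hg : CC g) {B : ℝ × ℝ → ℝ} (hB : Continuous B)
    (hB0 : B (0, 0) = 0) : CC (fun x => B (f x, g x)) := by
  refine ⟨hB.comp (hf.1.prodMk hg.1), ?_⟩
  refine HasCompactSupport.intro (K := tsupport f ∪ tsupport g) (hf.2.isCompact.union hg.2.isCompact) ?_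
  intro x hx
  rw [Set.mem_union, not_or] at hx
  rw [image_eq_zero_of_notMem_tsupport hx.1, image_eq_zero_of_notMem_tsupport hx.2, hB0]
lemma CC.comp {f : E → ℝ} (hf : CC f) {B : ℝ → ℝ} (hB : Continuous B)
    (hB0 : B 0 = 0) : CC (fun x => B (f x)) :=
  ⟨hB.comp hf.1, hf.2.comp_left hB0⟩
lemma CC.sum {κ : Type*} (s : Finset κ) {f : κ → E → ℝ} (hf : ∀ k, CC (f k)) :
    CC (fun x => ∑ k ∈ s, f k x) := by
  classical
  induction s using Finset.induction_on with
  | empty => simp only [Finset.sum_empty]; exact ⟨continuous_const, HasCompactSupport.zero⟩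
  | insert a s ha ih =>
    simp only [Finset.sum_insert ha]
    exact (hf a).add ih

lemma CC.int {f : E → ℝ} (hf : CC f) : Integrable f μ :=
  hf.1.integrable_of_hasCompactSupport hf.2

/-- lazy averaging operator -/
noncomputable def avg (a : ι → E) (f : E → ℝ) (x : E) : ℝ :=
  (1 / (Fintype.card ι : ℝ)) * ∑ k, (1/4 : ℝ) * (2 * f x + f (x + a k) + f (x - a k))

lemma CC.avg {a : ι → E} {f : E → ℝ} (hf : CC f) : CC (avg a f) := by
  unfold _root_.avg
  exact (CC.sum _ (fun k => (((hf.smul 2).add (hf.tr (a k))).add (hf.tr' (a k))).smul _)).smul _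

lemma int_tr (f : E → ℝ) (a : E) : ∫ x, f (x + a) ∂μ = ∫ x, f x ∂μ :=
  integral_add_right_eq_self f a

lemma int_tr' (f : E → ℝ) (a : E) : ∫ x, f (x - a) ∂μ = ∫ x, f x ∂μ := by
  simpa [sub_eq_add_neg] using int_tr (μ := μ) f (-a)

lemma int_avg [Nonempty ι] {a : ι → E} {f : E → ℝ} (hf : CC f) : ∫ x, avg a f x ∂μ = ∫ x, f x ∂μ := by
  unfold avg
  rw [integral_const_mul, integral_finsetSum _ (fun k _ =>
    ((((hf.smul 2).add (hf.tr (a k))).add (hf.tr' (a k))).smul _).int)]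
  have : ∀ k, ∫ x, (1/4 : ℝ) * (2 * f x + f (x + a k) + f (x - a k)) ∂μ = ∫ x, f x ∂μ := by
    intro k
    rw [integral_const_mul, integral_add ((hf.smul 2).add (hf.tr (a k))).int (hf.tr' (a k)).int,
      integral_add (hf.smul 2).int (hf.tr (a k)).int, integral_const_mul, int_tr, int_tr']
    ring
  simp only [this]
  rw [Finset.sum_const, Finset.card_univ, nsmul_eq_mul]
  field_simp

lemma int_tr_mul (f g : E → ℝ) (a : E) :
    ∫ x, f (x + a) * g x ∂μ = ∫ x, f x * g (x - a) ∂μ := by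
  rw [← int_tr (fun x => f x * g (x - a)) a]
  simp

lemma int_tr_mul' (f g : E → ℝ) (a : E) :
    ∫ x, f (x - a) * g x ∂μ = ∫ x, f x * g (x + a) ∂μ := by
  rw [← int_tr' (fun x => f x * g (x + a)) a]
  simp

lemma avg_selfadj {a : ι → E} {f g : E → ℝ} (hf : CC f) (hg : CC g) :
    ∫ x, avg a f x * g x ∂μ = ∫ x, f x * avg a g x ∂μ := by
  unfold avg
  have e1 : ∀ x, (1 / (Fintype.card ι : ℝ)) * (∑ k, (1/4 : ℝ) * (2 * f x + f (x + a k) + f (x - a k))) * g x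
      = (1 / (Fintype.card ι : ℝ)) * ∑ k, (1/4 : ℝ) * (2 * (f x * g x) + f (x + a k) * g x + f (x - a k) * g x) := by
    intro x
    rw [mul_assoc, Finset.sum_mul]
    congr 1
    apply Finset.sum_congr rfl; intro k _; ring
  have e2 : ∀ x, f x * ((1 / (Fintype.card ι : ℝ)) * (∑ k, (1/4 : ℝ) * (2 * g x + g (x + a k) + g (x - a k))))
      = (1 / (Fintype.card ι : ℝ)) * ∑ k, (1/4 : ℝ) * (2 * (f x * g x) + f x * g (x + a k) + f x * g (x - a k)) := by
    intro x
    rw [mul_left_comm, Finset.mul_sum]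
    congr 1
    apply Finset.sum_congr rfl; intro k _; ring
  simp only [e1, e2]
  have c0 := (hf.mul hg).smul 2
  have c1 := fun k => (hf.tr (a k)).mul hg
  have c2 := fun k => (hf.tr' (a k)).mul hg
  have c3 := fun k => hf.mul (hg.tr (a k))
  have c4 := fun k => hf.mul (hg.tr' (a k))
  rw [integral_const_mul, integral_const_mul,
    integral_finsetSum _ (fun k _ => (((c0.add (c1 k)).add (c2 k)).smul _).int),
    integral_finsetSum _ (fun k _ => (((c0.add (c3 k)).add (c4 k)).smul _).int)]
  congr 1
  apply Finset.sum_congr rfl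
  intro k _
  rw [integral_const_mul, integral_const_mul, integral_add (c0.add (c1 k)).int (c2 k).int,
    integral_add c0.int (c1 k).int, integral_add (c0.add (c3 k)).int (c4 k).int,
    integral_add c0.int (c3 k).int, int_tr_mul, int_tr_mul']
  ring

/-- difference operator -/
def dif (a : E) (f : E → ℝ) (x : E) : ℝ := f (x + a) - f x

lemma CC.dif {a : E} {f : E → ℝ} (hf : CC f) : CC (dif a f) := (hf.tr a).sub hf

lemma dif_avg (a : ι → E) (b : E) (f : E → ℝ) : dif b (avg a f) = avg a (dif b f) := by
  funext x
  unfold dif avg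
  rw [← mul_sub, ← Finset.sum_sub_distrib]
  congr 1
  apply Finset.sum_congr rfl
  intro k _
  rw [show x + b + a k = x + a k + b by abel, show x + b - a k = x - a k + b by abel]
  ring

lemma bell_pointwise {ι : Type*} [Fintype ι] [Nonempty ι] {B : ℝ × ℝ → ℝ} (hconv : ConvexOn ℝ Set.univ B)
    (hmid : ∀ a b : ℝ × ℝ, 2 * B ((1/2:ℝ) • (a + b)) + |a.1 - b.1| * |a.2 - b.2| ≤ B a + B b)
    (n : ℝ) (hn : n = Fintype.card ι) (z : ℝ × ℝ) (zp zm : ι → ℝ × ℝ) (k₀ : ι) :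
    B ((1/n) • ∑ k, (1/4:ℝ) • ((2:ℝ) • z + zp k + zm k))
      + (1/(4*n)) * (|(zp k₀).1 - z.1| * |(zp k₀).2 - z.2|)
      ≤ (1/n) * ∑ k, (1/4:ℝ) * (2 * B z + B (zp k) + B (zm k)) := by
  have hn0 : 0 < n := by rw [hn]; exact_mod_cast Fintype.card_pos
  have h1 : B ((1/n) • ∑ k, (1/4:ℝ) • ((2:ℝ) • z + zp k + zm k))
      ≤ ∑ k, (1/n) * B ((1/4:ℝ) • ((2:ℝ) • z + zp k + zm k)) := by
    rw [Finset.smul_sum]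
    have := hconv.map_sum_le (t := Finset.univ) (w := fun _ : ι => 1/n)
      (p := fun k => (1/4:ℝ) • ((2:ℝ) • z + zp k + zm k)) (fun _ _ => by positivity)
      (by rw [Finset.sum_const, Finset.card_univ, nsmul_eq_mul, ← hn]; field_simp)
      (fun _ _ => trivial)
    simpa using this
  have h2 : ∀ k, B ((1/4:ℝ) • ((2:ℝ) • z + zp k + zm k))
      + (1/4:ℝ) * (|(zp k).1 - z.1| * |(zp k).2 - z.2|)
      ≤ (1/4:ℝ) * (2 * B z + B (zp k) + B (zm k)) := by
    intro k
    have e : (1/4:ℝ) • ((2:ℝ) • z + zp k + zm k)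
        = (1/2:ℝ) • ((1/2:ℝ) • (zp k + z)) + (1/2:ℝ) • ((1/2:ℝ) • (zm k + z)) := by
      ext <;> simp <;> ring
    have h3 := hconv.2 (x := (1/2:ℝ) • (zp k + z)) (y := (1/2:ℝ) • (zm k + z)) trivial trivial
      (show (0:ℝ) ≤ 1/2 by norm_num) (show (0:ℝ) ≤ 1/2 by norm_num) (by norm_num)
    rw [← e] at h3
    have h4 := hmid (zp k) z
    have h5 := hmid (zm k) z
    have h6 : 0 ≤ |(zm k).1 - z.1| * |(zm k).2 - z.2| := by positivity
    simp only [smul_eq_mul] at h3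
    linarith
  have h7 : ∑ k, B ((1/4:ℝ) • ((2:ℝ) • z + zp k + zm k))
      + (1/4:ℝ) * (|(zp k₀).1 - z.1| * |(zp k₀).2 - z.2|)
      ≤ ∑ k, (1/4:ℝ) * (2 * B z + B (zp k) + B (zm k)) := by
    calc _ ≤ ∑ k, B ((1/4:ℝ) • ((2:ℝ) • z + zp k + zm k))
          + ∑ k, (1/4:ℝ) * (|(zp k).1 - z.1| * |(zp k).2 - z.2|) := by
          gcongr
          exact Finset.single_le_sum (f := fun k => (1/4:ℝ) * (|(zp k).1 - z.1| * |(zp k).2 - z.2|))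
            (fun k _ => by positivity) (Finset.mem_univ k₀)
      _ ≤ _ := by
          rw [← Finset.sum_add_distrib]
          exact Finset.sum_le_sum (fun k _ => h2 k)
  rw [← Finset.mul_sum] at h1
  have h8 := mul_le_mul_of_nonneg_left h7 (show 0 ≤ 1/n by positivity)
  have e9 : (1/(4*n)) * (|(zp k₀).1 - z.1| * |(zp k₀).2 - z.2|)
    = (1/n) * ((1/4:ℝ) * (|(zp k₀).1 - z.1| * |(zp k₀).2 - z.2|)) := by field_simp
  rw [e9]
  linarith

lemma bell_step [Nonempty ι] {B : ℝ × ℝ → ℝ} (hB : Continuous B) (hB0 : B (0,0) = 0)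
    (hconv : ConvexOn ℝ Set.univ B)
    (hmid : ∀ a b : ℝ × ℝ, 2 * B ((1/2:ℝ) • (a + b)) + |a.1 - b.1| * |a.2 - b.2| ≤ B a + B b)
    (a : ι → E) (k : ι) {u v : E → ℝ} (hu : CC u) (hv : CC v) :
    ∫ x, B (avg a u x, avg a v x) ∂μ
      + (1/(4*(Fintype.card ι : ℝ))) * ∫ x, |dif (a k) u x| * |dif (a k) v x| ∂μ
      ≤ ∫ x, B (u x, v x) ∂μ := by
  have hb := hu.comp2 hv hB hB0
  have hd : CC (fun x => |dif (a k) u x| * |dif (a k) v x|) :=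
    (hu.dif.comp continuous_abs abs_zero).mul (hv.dif.comp continuous_abs abs_zero)
  rw [← int_avg (a := a) hb, ← integral_const_mul, ← integral_add (hu.avg.comp2 hv.avg hB hB0).int (hd.smul _).int]
  refine integral_mono ((hu.avg.comp2 hv.avg hB hB0).add (hd.smul _)).int hb.avg.int ?_
  intro x
  have := bell_pointwise hconv hmid (Fintype.card ι : ℝ) rfl (u x, v x)
    (fun k => (u (x + a k), v (x + a k))) (fun k => (u (x - a k), v (x - a k))) k
  have e : (1/(Fintype.card ι : ℝ)) • ∑ k, (1/4:ℝ) • ((2:ℝ) • (u x, v x)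
      + (u (x + a k), v (x + a k)) + (u (x - a k), v (x - a k))) = (avg a u x, avg a v x) := by
    unfold avg
    ext <;> simp [Prod.fst_sum, Prod.snd_sum]
  rw [e] at this
  exact this

/-- iterates -/
noncomputable def itr (a : ι → E) (f : E → ℝ) (n : ℕ) : E → ℝ := (avg a)^[n] f

lemma itr_succ (a : ι → E) (f : E → ℝ) (n : ℕ) : itr a f (n+1) = avg a (itr a f n) :=
  Function.iterate_succ_apply' _ _ _

lemma CC.itr {a : ι → E} {f : E → ℝ} (hf : CC f) (n : ℕ) : CC (itr a f n) := by
  induction n with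
  | zero => exact hf
  | succ n ih => rw [itr_succ]; exact ih.avg

lemma bell_sum [Nonempty ι] {B : ℝ × ℝ → ℝ} (hB : Continuous B) (hB0 : B (0,0) = 0)
    (hpos : ∀ z, 0 ≤ B z) (hconv : ConvexOn ℝ Set.univ B)
    (hmid : ∀ a b : ℝ × ℝ, 2 * B ((1/2:ℝ) • (a + b)) + |a.1 - b.1| * |a.2 - b.2| ≤ B a + B b)
    (a : ι → E) (k : ι) {u v : E → ℝ} (hu : CC u) (hv : CC v) (m : ℕ) :
    ∑ n ∈ Finset.range m, ∫ x, |dif (a k) (itr a u n) x| * |dif (a k) (itr a v n) x| ∂μ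
      ≤ 4 * (Fintype.card ι : ℝ) * ∫ x, B (u x, v x) ∂μ := by
  have hn0 : 0 < (Fintype.card ι : ℝ) := by exact_mod_cast Fintype.card_pos
  have key : ∫ x, B (itr a u m x, itr a v m x) ∂μ + (1/(4*(Fintype.card ι : ℝ))) *
      ∑ n ∈ Finset.range m, ∫ x, |dif (a k) (itr a u n) x| * |dif (a k) (itr a v n) x| ∂μ
      ≤ ∫ x, B (u x, v x) ∂μ := by
    induction m with
    | zero => simp [itr]
    | succ m ih =>
      rw [Finset.sum_range_succ, mul_add, itr_succ, itr_succ]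
      have := bell_step (μ := μ) hB hB0 hconv hmid a k (hu.itr (a := a) m) (hv.itr (a := a) m)
      linarith
  have h0 : 0 ≤ ∫ x, B (itr a u m x, itr a v m x) ∂μ := integral_nonneg (fun x => hpos _)
  have h1 : (1/(4*(Fintype.card ι : ℝ))) *
      ∑ n ∈ Finset.range m, ∫ x, |dif (a k) (itr a u n) x| * |dif (a k) (itr a v n) x| ∂μ
      ≤ ∫ x, B (u x, v x) ∂μ := by linarith
  rw [one_div, inv_mul_le_iff₀ (by positivity)] at h1
  exact h1

lemma avg_sub (a : ι → E) (f g : E → ℝ) : avg a (fun x => f x - g x) = fun x => avg a f x - avg a g x := by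
  funext x
  unfold avg
  rw [← mul_sub, ← Finset.sum_sub_distrib]
  congr 1
  apply Finset.sum_congr rfl; intro k _; ring

lemma itr_sub (a : ι → E) (f g : E → ℝ) (n : ℕ) :
    itr a (fun x => f x - g x) n = fun x => itr a f n x - itr a g n x := by
  induction n with
  | zero => rfl
  | succ n ih => rw [itr_succ, ih, avg_sub, itr_succ, itr_succ]

lemma riesz_discrete [Nonempty ι] {B : ℝ × ℝ → ℝ} (hB : Continuous B) (hB0 : B (0,0) = 0)
    (hpos : ∀ z, 0 ≤ B z) (hconv : ConvexOn ℝ Set.univ B)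
    (hmid : ∀ a b : ℝ × ℝ, 2 * B ((1/2:ℝ) • (a + b)) + |a.1 - b.1| * |a.2 - b.2| ≤ B a + B b)
    (a : ι → E) (k : ι) {w g : E → ℝ} (hw : CC w) (hg : CC g) :
    |∫ x, dif (a k) w x * dif (a k) g x ∂μ|
      ≤ 4 * (Fintype.card ι : ℝ) * ∫ x, B (w x - avg a (avg a w) x, g x) ∂μ := by
  set c : ℕ → ℝ := fun n => ∫ x, dif (a k) (itr a w n) x * dif (a k) (itr a g n) x ∂μ with hc
  set F : E → ℝ := fun x => w x - avg a (avg a w) x with hF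
  have hFc : CC F := hw.sub hw.avg.avg
  have habs : ∀ {u v : E → ℝ}, CC u → CC v → ∀ n,
      |∫ x, dif (a k) (itr a u n) x * dif (a k) (itr a v n) x ∂μ|
      ≤ ∫ x, |dif (a k) (itr a u n) x| * |dif (a k) (itr a v n) x| ∂μ := by
    intro u v hu hv n
    refine (abs_integral_le_integral_abs).trans (le_of_eq ?_)
    simp only [abs_mul]
  -- telescoping
  have htel : ∀ n, ∫ x, dif (a k) (itr a F n) x * dif (a k) (itr a g n) x ∂μ = c n - c (n+1) := by
    intro n
    have e1 : itr a F n = fun x => itr a w n x - avg a (itr a w (n+1)) x := by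
      rw [hF, itr_sub]
      have : itr a (fun x => avg a (avg a w) x) n = avg a (itr a w (n+1)) := by
        rw [← itr_succ]
        exact (Function.iterate_add_apply (avg a) n 2 w).symm
      rw [this]
    have e2 : dif (a k) (itr a F n) = fun x => dif (a k) (itr a w n) x
        - avg a (dif (a k) (itr a w (n+1))) x := by
      rw [← dif_avg, e1]; funext x; simp only [dif]; ring
    rw [e2]
    have c1 := (hw.itr (a := a) n).dif (a := a k)
    have c2 := (hw.itr (a := a) (n+1)).dif (a := a k)
    have c3 := (hg.itr (a := a) n).dif (a := a k)
    simp only [sub_mul]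
    rw [integral_sub (c1.mul c3).int (c2.avg.mul c3).int, avg_selfadj c2 c3, ← dif_avg, ← itr_succ]
  have hlim : Filter.Tendsto c Filter.atTop (nhds 0) := by
    have : Summable (fun n => |c n|) := by
      refine summable_of_sum_range_le (c := 4 * (Fintype.card ι : ℝ) * ∫ x, B (w x, g x) ∂μ)
        (fun n => abs_nonneg _) (fun m => ?_)
      refine le_trans (Finset.sum_le_sum (fun n _ => habs hw hg n)) ?_
      exact bell_sum hB hB0 hpos hconv hmid a k hw hg m
    exact (tendsto_zero_iff_abs_tendsto_zero _).2 this.tendsto_atTop_zero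
  have hbd : ∀ m, |c 0 - c m| ≤ 4 * (Fintype.card ι : ℝ) * ∫ x, B (F x, g x) ∂μ := by
    intro m
    have : c 0 - c m = ∑ n ∈ Finset.range m, (c n - c (n+1)) := by
      rw [Finset.sum_range_sub']
    rw [this]
    refine (Finset.abs_sum_le_sum_abs _ _).trans ?_
    refine le_trans (Finset.sum_le_sum (fun n _ => ?_))
      (bell_sum hB hB0 hpos hconv hmid a k hFc hg m)
    rw [← htel]
    exact habs hFc hg n
  have h1 : Filter.Tendsto (fun m => |c 0 - c m|) Filter.atTop (nhds |c 0 - 0|) :=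
    (hlim.const_sub (c 0)).abs
  rw [sub_zero] at h1
  exact le_of_tendsto' h1 hbd

/-- second difference -/
def dif2 (a : E) (f : E → ℝ) (x : E) : ℝ := f (x + a) + f (x - a) - 2 * f x

lemma CC.dif2 {a : E} {f : E → ℝ} (hf : CC f) : CC (dif2 a f) := ((hf.tr a).add (hf.tr' a)).sub (hf.smul 2)

lemma dif_dif (a : E) {w g : E → ℝ} (hw : CC w) (hg : CC g) :
    ∫ x, dif a w x * dif a g x ∂μ = - ∫ x, dif2 a w x * g x ∂μ := by
  have h1 : ∫ x, dif a w x * dif a g x ∂μ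
      = ∫ x, (dif a w x * g (x + a)) ∂μ - ∫ x, dif a w x * g x ∂μ := by
    rw [← integral_sub (hw.dif.mul (hg.tr a)).int (hw.dif.mul hg).int]
    congr 1; funext x; simp only [dif]; ring
  rw [h1, ← int_tr_mul', ← integral_sub (((hw.dif).tr' a).mul hg).int (hw.dif.mul hg).int, ← integral_neg]
  congr 1; funext x; simp only [dif, dif2, sub_add_cancel]; ring

end Discrete

open Real MeasureTheory Metric
open scoped ENNReal NNReal

lemma convexOn_abs_rpow {p : ℝ} (hp : 1 ≤ p) : ConvexOn ℝ Set.univ (fun x : ℝ => |x| ^ p) := by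
  refine ⟨convex_univ, ?_⟩
  intro x _ y _ a b ha hb hab
  have h1 : |a • x + b • y| ≤ a • |x| + b • |y| := by
    simp only [smul_eq_mul]
    refine (abs_add_le _ _).trans ?_
    rw [abs_mul, abs_mul, abs_of_nonneg ha, abs_of_nonneg hb]
  refine (Real.rpow_le_rpow (abs_nonneg _) h1 (by linarith)).trans ?_
  exact (convexOn_rpow hp).2 (abs_nonneg x) (abs_nonneg y) ha hb hab

/-- signed power -/
noncomputable def spw (r t : ℝ) : ℝ := (max t 0) ^ r - (max (-t) 0) ^ r

lemma spw_cont {r : ℝ} (hr : 0 < r) : Continuous (spw r) := by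
  unfold spw
  exact ((continuous_id.max continuous_const).rpow_const (fun _ => Or.inr hr.le)).sub
    ((continuous_id.neg.max continuous_const).rpow_const (fun _ => Or.inr hr.le))

lemma spw_zero {r : ℝ} : spw r 0 = 0 := by simp [spw]

lemma spw_abs {r : ℝ} (hr : 0 < r) (t : ℝ) : |spw r t| = |t| ^ r := by
  unfold spw
  rcases le_total 0 t with h | h
  · rw [max_eq_left h, max_eq_right (by linarith), Real.zero_rpow hr.ne', sub_zero, abs_of_nonneg h,
      abs_of_nonneg (Real.rpow_nonneg h _)]
  · rw [max_eq_right h, max_eq_left (by linarith), Real.zero_rpow hr.ne', zero_sub, abs_neg, abs_of_nonpos h,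
      abs_of_nonneg (Real.rpow_nonneg (by linarith) _)]

lemma mul_spw {r : ℝ} (hr : 0 < r) (t : ℝ) : t * spw r t = |t| ^ (r + 1) := by
  unfold spw
  rcases le_total 0 t with h | h
  · rw [max_eq_left h, max_eq_right (by linarith), Real.zero_rpow hr.ne', sub_zero, abs_of_nonneg h,
      Real.rpow_add_one' h (by linarith)]
    ring
  · rw [max_eq_right h, max_eq_left (by linarith), Real.zero_rpow hr.ne', zero_sub, abs_of_nonpos h,
      Real.rpow_add_one' (by linarith) (by linarith)]
    ring

lemma abs_add_rpow_le {p : ℝ} (hp : 1 ≤ p) (a b : ℝ) : |a + b| ^ p ≤ 2 ^ p * (|a| ^ p + |b| ^ p) := by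
  have h := (convexOn_abs_rpow hp).2 (x := 2 * a) (y := 2 * b) trivial trivial
    (show (0:ℝ) ≤ 1/2 by norm_num) (show (0:ℝ) ≤ 1/2 by norm_num) (by norm_num)
  simp only [smul_eq_mul] at h
  rw [show 1/2 * (2*a) + 1/2 * (2*b) = a + b by ring, abs_mul, abs_mul, abs_two,
    Real.mul_rpow (by norm_num) (abs_nonneg _), Real.mul_rpow (by norm_num) (abs_nonneg _)] at h
  have : 0 ≤ (2:ℝ)^p * (|a|^p + |b|^p) := by positivity
  nlinarith

section Discrete2

variable {E : Type*} [NormedAddCommGroup E] [MeasurableSpace E] [BorelSpace E]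
  {μ : Measure E} [μ.IsAddRightInvariant] [IsFiniteMeasureOnCompacts μ]
  {ι : Type*} [Fintype ι]

lemma CC.absrpow {f : E → ℝ} (hf : CC f) {p : ℝ} (hp : 0 < p) : CC (fun x => |f x| ^ p) :=
  hf.comp (B := fun t => |t| ^ p) (continuous_abs.rpow_const (fun _ => Or.inr hp.le))
    (by simp [Real.zero_rpow hp.ne'])

lemma avg_absrpow_le [Nonempty ι] {p : ℝ} (hp : 1 ≤ p) (a : ι → E) (G : E → ℝ) (x : E) :
    |avg a G x| ^ p ≤ avg a (fun y => |G y| ^ p) x := by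
  have hconv := convexOn_abs_rpow hp
  have hn0 : 0 < (Fintype.card ι : ℝ) := by exact_mod_cast Fintype.card_pos
  unfold avg
  rw [Finset.mul_sum, Finset.mul_sum]
  have := hconv.map_sum_le (t := Finset.univ) (w := fun _ : ι => 1/(Fintype.card ι : ℝ))
      (p := fun k => (1/4:ℝ) * (2 * G x + G (x + a k) + G (x - a k))) (fun _ _ => by positivity)
      (by rw [Finset.sum_const, Finset.card_univ, nsmul_eq_mul]; field_simp)
      (fun _ _ => trivial)
  simp only [smul_eq_mul] at this
  refine this.trans (Finset.sum_le_sum fun k _ => ?_)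
  gcongr
  have h1 := hconv.2 (x := G x) (y := (1/2) * G (x + a k) + (1/2) * G (x - a k)) trivial trivial
      (show (0:ℝ) ≤ 1/2 by norm_num) (show (0:ℝ) ≤ 1/2 by norm_num) (by norm_num)
  have h2 := hconv.2 (x := G (x + a k)) (y := G (x - a k)) trivial trivial
      (show (0:ℝ) ≤ 1/2 by norm_num) (show (0:ℝ) ≤ 1/2 by norm_num) (by norm_num)
  simp only [smul_eq_mul] at h1 h2
  rw [show 1/2 * G x + 1/2 * ((1/2) * G (x + a k) + (1/2) * G (x - a k))
    = (1/4:ℝ) * (2 * G x + G (x + a k) + G (x - a k)) by ring] at h1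
  linarith

lemma sub_avg_avg [Nonempty ι] (a : ι → E) (w : E → ℝ) (x : E) :
    w x - avg a (avg a w) x = -((1/(4*(Fintype.card ι : ℝ))) * (∑ k, dif2 (a k) w x)
      + avg a (fun y => (1/(4*(Fintype.card ι : ℝ))) * ∑ k, dif2 (a k) w y) x) := by
  have hn0 : (Fintype.card ι : ℝ) ≠ 0 := by exact_mod_cast Fintype.card_pos.ne'
  have e : ∀ y, (1/(4*(Fintype.card ι : ℝ))) * ∑ k, dif2 (a k) w y = avg a w y - w y := by
    intro y
    have : w y = (1/(Fintype.card ι : ℝ)) * ∑ k : ι, w y := by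
      rw [Finset.sum_const, Finset.card_univ, nsmul_eq_mul]; field_simp
    conv_rhs => rw [this]
    unfold avg dif2
    rw [← mul_sub, ← Finset.sum_sub_distrib, show 1/(4*(Fintype.card ι : ℝ)) = (1/(Fintype.card ι : ℝ)) * (1/4) by field_simp,
      mul_assoc, Finset.mul_sum]
    congr 1
    apply Finset.sum_congr rfl; intro k _; ring
  simp only [e, avg_sub]
  ring

lemma int_F_le [Nonempty ι] {p : ℝ} (hp : 1 ≤ p) (a : ι → E) {w : E → ℝ} (hw : CC w) :
    ∫ x, |w x - avg a (avg a w) x| ^ p ∂μ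
      ≤ 2 ^ (p + 1) * ∫ x, |∑ k, dif2 (a k) w x| ^ p ∂μ := by
  have hp0 : 0 < p := by linarith
  have hn1 : 1 ≤ (Fintype.card ι : ℝ) := by exact_mod_cast Fintype.card_pos
  have hL : CC (fun x => ∑ k, dif2 (a k) w x) := CC.sum _ (fun k => hw.dif2)
  set G : E → ℝ := fun y => (1/(4*(Fintype.card ι : ℝ))) * ∑ k, dif2 (a k) w y with hG
  have hGc : CC G := hL.smul _
  have h1 : ∫ x, |w x - avg a (avg a w) x| ^ p ∂μ
      ≤ ∫ x, 2 ^ p * (|G x| ^ p + avg a (fun y => |G y| ^ p) x) ∂μ := by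
    refine integral_mono ((hw.sub hw.avg.avg).absrpow hp0).int
      (((hGc.absrpow hp0).add (hGc.absrpow hp0).avg).smul _).int ?_
    intro x
    simp only
    rw [sub_avg_avg, abs_neg]
    refine (abs_add_rpow_le hp _ _).trans ?_
    gcongr
    exact avg_absrpow_le hp a G x
  refine h1.trans ?_
  rw [integral_const_mul, integral_add (hGc.absrpow hp0).int (hGc.absrpow hp0).avg.int,
    int_avg (hGc.absrpow hp0), Real.rpow_add_one (by norm_num)]
  have h2 : ∫ x, |G x| ^ p ∂μ ≤ ∫ x, |∑ k, dif2 (a k) w x| ^ p ∂μ := by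
    refine integral_mono (hGc.absrpow hp0).int (hL.absrpow hp0).int ?_
    intro x
    refine Real.rpow_le_rpow (abs_nonneg _) ?_ hp0.le
    rw [hG]
    simp only [abs_mul]
    refine mul_le_of_le_one_left (abs_nonneg _) ?_
    rw [abs_of_nonneg (by positivity), div_le_one (by positivity)]
    linarith
  have : (0:ℝ) < 2 ^ p := by positivity
  nlinarith

lemma discrete_cz [Nonempty ι] {p : ℝ} (hp : 1 < p) : ∃ K : ℝ, 0 < K ∧
    ∀ (a : ι → E) (k : ι) (w : E → ℝ), CC w →
    ∫ x, |dif2 (a k) w x| ^ p ∂μ ≤ K * ∫ x, |∑ k, dif2 (a k) w x| ^ p ∂μ := by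
  obtain ⟨B, C, hB, hC, hpos, hsize, hconv, hmid⟩ := bellman (Real.HolderConjugate.conjExponent hp)
  set q := p.conjExponent with hq
  have hpq := Real.HolderConjugate.conjExponent hp
  have hp0 : 0 < p := by linarith
  have hq0 : 0 < q := hpq.symm.pos
  have hB0 : B (0,0) = 0 := by
    refine le_antisymm ?_ (hpos _)
    have := hsize (0,0)
    simpa [Real.zero_rpow hp0.ne', Real.zero_rpow hq0.ne'] using this
  set n : ℝ := (Fintype.card ι : ℝ) with hn
  have hn0 : 0 < n := by rw [hn]; exact_mod_cast Fintype.card_pos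
  -- choose s
  set s : ℝ := (8 * n * C) ^ (1/q) with hs
  have hs0 : 0 < s := by positivity
  have hsq : s ^ q = 8 * n * C := by
    rw [hs, ← Real.rpow_mul (by positivity), one_div_mul_cancel hq0.ne', Real.rpow_one]
  refine ⟨8 * n * C * s ^ p * 2 ^ (p+1), by positivity, ?_⟩
  intro a k w hw
  set h := dif2 (a k) w with hh
  have hhc : CC h := hw.dif2
  set g : E → ℝ := fun x => spw (p-1) (h x) with hg
  have hgc : CC g := hhc.comp (spw_cont (by linarith)) spw_zero
  have key := riesz_discrete (μ := μ) hB hB0 hpos hconv hmid a k (hw.smul s) (hgc.smul s⁻¹)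
  rw [dif_dif _ (hw.smul s) (hgc.smul s⁻¹), abs_neg] at key
  have e1 : ∀ x, dif2 (a k) (fun x => s * w x) x * (s⁻¹ * g x) = |h x| ^ p := by
    intro x
    have : dif2 (a k) (fun x => s * w x) x = s * h x := by simp only [hh, dif2]; ring
    rw [this]
    have h3 := mul_spw (r := p - 1) (by linarith) (h x)
    rw [sub_add_cancel] at h3
    rw [← h3, hg]
    field_simp
  simp only [e1] at key
  rw [abs_of_nonneg (integral_nonneg fun x => by positivity)] at key
  set F : E → ℝ := fun x => w x - avg a (avg a w) x with hF
  have hFc : CC F := hw.sub hw.avg.avg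
  have e2 : ∀ x, s * w x - avg a (avg a (fun x => s * w x)) x = s * F x := by
    intro x
    have h1 : ∀ v : E → ℝ, avg a (fun x => s * v x) = fun x => s * avg a v x := by
      intro v; funext y
      unfold avg
      rw [mul_left_comm s, Finset.mul_sum _ _ s]
      congr 1
      apply Finset.sum_congr rfl; intro k _; ring
    rw [h1, h1, hF]; ring
  simp only [e2] at key
  have hb : ∫ x, B (s * F x, s⁻¹ * g x) ∂μ
      ≤ ∫ x, C * (s ^ p * |F x| ^ p + (s ^ q)⁻¹ * |h x| ^ p) ∂μ := by
    refine integral_mono ((hFc.smul s).comp2 (hgc.smul s⁻¹) hB hB0).int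
      ((((hFc.absrpow hp0).smul _).add ((hhc.absrpow hp0).smul _)).smul _).int ?_
    intro x
    refine (hsize _).trans (le_of_eq ?_)
    simp only
    rw [abs_mul, abs_mul, abs_of_pos hs0, abs_of_pos (inv_pos.2 hs0), Real.mul_rpow hs0.le (abs_nonneg _),
      Real.mul_rpow (inv_pos.2 hs0).le (abs_nonneg _), hg, spw_abs (by linarith), ← Real.rpow_mul (abs_nonneg _),
      Real.inv_rpow hs0.le, hpq.sub_one_mul_conj]
  rw [integral_const_mul, integral_add ((hFc.absrpow hp0).smul _).int ((hhc.absrpow hp0).smul _).int,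
    integral_const_mul, integral_const_mul] at hb
  have h3 := int_F_le (μ := μ) hp.le a hw
  have h4 := key.trans (mul_le_mul_of_nonneg_left hb (by positivity : 0 ≤ 4 * n))
  rw [hsq] at h4
  set X := ∫ x, |h x| ^ p ∂μ
  have e5 : 4 * n * (C * (s ^ p * ∫ x, |F x| ^ p ∂μ + (8 * n * C)⁻¹ * X))
    = 4 * n * C * s ^ p * ∫ x, |F x| ^ p ∂μ + X / 2 := by field_simp; ring
  rw [e5] at h4
  have h6 := mul_le_mul_of_nonneg_left h3 (by positivity : 0 ≤ 8 * n * C * s ^ p)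
  have : X ≤ 8 * n * C * s ^ p * ∫ x, |F x| ^ p ∂μ := by linarith
  refine this.trans (h6.trans (le_of_eq ?_))
  ring

end Discrete2

open Real MeasureTheory Metric
open scoped ENNReal NNReal

section ContCZ
variable {E : Type*} [NormedAddCommGroup E] [NormedSpace ℝ E]

lemma hasDerivAt_line {F : Type*} [NormedAddCommGroup F] [NormedSpace ℝ F] {w : E → F} (hw : ContDiff ℝ 1 w) (x b : E) (t : ℝ) :
    HasDerivAt (fun t : ℝ => w (x + t • b)) (fderiv ℝ w (x + t • b) b) t := by
  have h1 : HasFDerivAt w (fderiv ℝ w (x + t • b)) (x + t • b) :=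
    (hw.differentiable (by norm_num) _).hasFDerivAt
  have h2 : HasDerivAt (fun t : ℝ => x + t • b) b t := by
    simpa using ((hasDerivAt_id t).smul_const b).const_add x
  exact h1.comp_hasDerivAt t h2

lemma second_diff {w : E → ℝ} (hw : ContDiff ℝ 2 w) (x b : E) {h : ℝ} (hh : 0 < h) :
    ∃ η : ℝ, |η| ≤ h ∧ dif2 (h • b) w x = h ^ 2 * fderiv ℝ (fderiv ℝ w) (x + η • b) b b := by
  have hw1 : ContDiff ℝ 1 w := hw.of_le (by norm_num)
  have hw' : ContDiff ℝ 1 (fderiv ℝ w) := hw.fderiv_right (by norm_num)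
  have d1 : ∀ t : ℝ, HasDerivAt (fun t : ℝ => w (x + t • b)) (fderiv ℝ w (x + t • b) b) t :=
    hasDerivAt_line hw1 x b
  have d1n : ∀ t : ℝ, HasDerivAt (fun t : ℝ => w (x + (-t) • b)) (-(fderiv ℝ w (x + (-t) • b) b)) t := by
    intro t
    have := (d1 (-t)).scomp t (hasDerivAt_neg t)
    simpa [Function.comp_def] using this
  have d2 : ∀ t : ℝ, HasDerivAt (fun t : ℝ => fderiv ℝ w (x + t • b) b)
      (fderiv ℝ (fderiv ℝ w) (x + t • b) b b) t := by
    intro t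
    have := (hasDerivAt_line hw' x b t).clm_apply (hasDerivAt_const t b)
    simpa using this
  have dφ : ∀ t : ℝ, HasDerivAt (fun t : ℝ => w (x + t • b) + w (x + (-t) • b) - 2 * w x)
      (fderiv ℝ w (x + t • b) b - fderiv ℝ w (x + (-t) • b) b) t := by
    intro t
    simpa [sub_eq_add_neg] using ((d1 t).add (d1n t)).sub_const (2 * w x)
  have dsq : ∀ t : ℝ, HasDerivAt (fun t : ℝ => t ^ 2) (2 * t) t := by
    intro t; simpa using hasDerivAt_pow 2 t
  obtain ⟨ξ, hξ, e1⟩ := exists_ratio_hasDerivAt_eq_ratio_slope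
    (fun t : ℝ => w (x + t • b) + w (x + (-t) • b) - 2 * w x) _ hh
    (fun t _ => (dφ t).continuousAt.continuousWithinAt) (fun t _ => dφ t)
    (fun t : ℝ => t ^ 2) _ (fun t _ => (dsq t).continuousAt.continuousWithinAt) (fun t _ => dsq t)
  obtain ⟨hξ0, hξ1⟩ := hξ
  obtain ⟨η, hη, e2⟩ := exists_hasDerivAt_eq_slope (fun t : ℝ => fderiv ℝ w (x + t • b) b) _
    (show -ξ < ξ by linarith) (fun t _ => (d2 t).continuousAt.continuousWithinAt) (fun t _ => d2 t)
  refine ⟨η, abs_le.2 ⟨by linarith [hη.1], by linarith [hη.2]⟩, ?_⟩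
  rw [eq_div_iff (by linarith)] at e2
  simp only [zero_smul, add_zero, neg_zero] at e1
  rw [← e2] at e1
  unfold dif2
  rw [neg_smul, ← sub_eq_add_neg] at e1
  have h5 : ξ ≠ 0 := hξ0.ne'
  apply mul_left_cancel₀ (mul_ne_zero two_ne_zero h5)
  linarith

variable [MeasurableSpace E] [BorelSpace E] [FiniteDimensional ℝ E]
  {μ : Measure E} [μ.IsAddRightInvariant] [IsFiniteMeasureOnCompacts μ]
  {ι : Type*} [Fintype ι]

lemma CC.D2 {w : E → ℝ} (hw : ContDiff ℝ 2 w) (hc : HasCompactSupport w) (b c : E) :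
    CC (fun x => fderiv ℝ (fderiv ℝ w) x b c) := by
  have hw' : ContDiff ℝ 1 (fderiv ℝ w) := hw.fderiv_right (by norm_num)
  refine ⟨?_, ?_⟩
  · exact ((hw'.continuous_fderiv (by norm_num)).clm_apply continuous_const).clm_apply continuous_const
  · have h2 := (hc.fderiv (𝕜 := ℝ)).fderiv (𝕜 := ℝ)
    exact h2.comp_left (g := fun L : E →L[ℝ] E →L[ℝ] ℝ => L b c) (by simp)

lemma tendsto_dif2_int {p : ℝ} (hp : 1 < p) {w : E → ℝ} (hw : ContDiff ℝ 2 w) (hc : HasCompactSupport w)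
    (b : ι → E) (s : Finset ι) :
    Filter.Tendsto (fun n : ℕ => ∫ x, |∑ k ∈ s, dif2 ((1/((n:ℝ)+1)) • b k) (fun y => ((n:ℝ)+1)^2 * w y) x| ^ p ∂μ)
      Filter.atTop (nhds (∫ x, |∑ k ∈ s, fderiv ℝ (fderiv ℝ w) x (b k) (b k)| ^ p ∂μ)) := by
  have hp0 : 0 < p := by linarith
  have hwc : CC w := ⟨hw.continuous, hc⟩
  have hD : ∀ k, CC (fun x => fderiv ℝ (fderiv ℝ w) x (b k) (b k)) := fun k => CC.D2 hw hc _ _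
  have hM : ∀ k, ∃ M : ℝ, ∀ x, |fderiv ℝ (fderiv ℝ w) x (b k) (b k)| ≤ M := by
    intro k
    obtain ⟨M, hM⟩ := (hD k).1.bounded_above_of_compact_support (hD k).2
    exact ⟨M, hM⟩
  choose M hM using hM
  have key : ∀ (n : ℕ) (k : ι) (x : E), ∃ η : ℝ, |η| ≤ 1/((n:ℝ)+1) ∧
      dif2 ((1/((n:ℝ)+1)) • b k) (fun y => ((n:ℝ)+1)^2 * w y) x
        = fderiv ℝ (fderiv ℝ w) (x + η • b k) (b k) (b k) := by
    intro n k x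
    have hn : 0 < (n:ℝ) + 1 := by positivity
    obtain ⟨η, h1, h2⟩ := second_diff hw x (b k) (show 0 < 1/((n:ℝ)+1) by positivity)
    refine ⟨η, h1, ?_⟩
    have e : dif2 ((1/((n:ℝ)+1)) • b k) (fun y => ((n:ℝ)+1)^2 * w y) x
      = ((n:ℝ)+1)^2 * dif2 ((1/((n:ℝ)+1)) • b k) w x := by unfold dif2; ring
    rw [e, h2]; field_simp
  set K : Set E := cthickening (∑ k, ‖b k‖) (tsupport w) with hK
  have hKc : IsCompact K := hc.isCompact.cthickening
  refine tendsto_integral_of_dominated_convergence (K.indicator (fun _ => (∑ k ∈ s, M k) ^ p)) ?_ ?_ ?_ ?_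
  · intro n
    exact ((CC.sum s (fun k => (hwc.smul (((n:ℝ)+1)^2)).dif2)).absrpow hp0).1.aestronglyMeasurable
  · rw [integrable_indicator_iff hKc.measurableSet]
    exact integrableOn_const hKc.measure_lt_top.ne
  · intro n
    refine Filter.Eventually.of_forall fun x => ?_
    rw [Real.norm_of_nonneg (by positivity)]
    by_cases hx : x ∈ K
    · rw [Set.indicator_of_mem hx]
      refine Real.rpow_le_rpow (abs_nonneg _) ?_ hp0.le
      refine (Finset.abs_sum_le_sum_abs _ _).trans (Finset.sum_le_sum fun k _ => ?_)
      obtain ⟨η, -, h2⟩ := key n k x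
      rw [h2]; exact hM k _
    · rw [Set.indicator_of_notMem hx, Finset.sum_eq_zero, abs_zero, Real.zero_rpow hp0.ne']
      intro k _
      obtain ⟨η, h1, h2⟩ := key n k x
      rw [h2]
      have hη : |η| ≤ 1 := h1.trans (by rw [div_le_one (by positivity)]; linarith [Nat.cast_nonneg (α := ℝ) n])
      have h3 : x + η • b k ∉ tsupport w := by
        intro hy
        apply hx
        refine mem_cthickening_of_dist_le x _ _ _ hy ?_
        rw [dist_eq_norm, show x - (x + η • b k) = - (η • b k) by abel, norm_neg, norm_smul, Real.norm_eq_abs]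
        calc |η| * ‖b k‖ ≤ 1 * ‖b k‖ := by gcongr
          _ ≤ _ := by rw [one_mul]; exact Finset.single_le_sum (f := fun k => ‖b k‖) (fun k _ => norm_nonneg _) (Finset.mem_univ k)
      have h4 : x + η • b k ∉ tsupport (fderiv ℝ (fderiv ℝ w)) := fun h =>
        h3 (tsupport_fderiv_subset ℝ (tsupport_fderiv_subset ℝ h))
      rw [image_eq_zero_of_notMem_tsupport h4]; simp
  · refine Filter.Eventually.of_forall fun x => ?_
    have ct : Continuous (fun t : ℝ => |t| ^ p) := continuous_abs.rpow_const (fun _ => Or.inr hp0.le)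
    refine (ct.tendsto _).comp (tendsto_finsetSum _ fun k _ => ?_)
    choose η h1 h2 using fun n => key n k x
    simp only [h2]
    have hη : Filter.Tendsto η Filter.atTop (nhds 0) :=
      squeeze_zero_norm h1 tendsto_one_div_add_atTop_nhds_zero_nat
    have h3 : Filter.Tendsto (fun n => x + η n • b k) Filter.atTop (nhds x) := by
      simpa using (hη.smul_const (b k)).const_add x
    exact ((hD k).1.tendsto x).comp h3

lemma cont_cz [Nonempty ι] {p : ℝ} (hp : 1 < p) (b : ι → E) : ∃ K : ℝ, 0 < K ∧
    ∀ (w : E → ℝ), ContDiff ℝ 2 w → HasCompactSupport w → ∀ k,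
    ∫ x, |fderiv ℝ (fderiv ℝ w) x (b k) (b k)| ^ p ∂μ
      ≤ K * ∫ x, |∑ k, fderiv ℝ (fderiv ℝ w) x (b k) (b k)| ^ p ∂μ := by
  obtain ⟨K, hK, H⟩ := discrete_cz (E := E) (μ := μ) (ι := ι) hp
  refine ⟨K, hK, fun w hw hc k => ?_⟩
  have h1 := tendsto_dif2_int (μ := μ) hp hw hc b {k}
  have h2 := (tendsto_dif2_int (μ := μ) hp hw hc b Finset.univ).const_mul K
  simp only [Finset.sum_singleton] at h1
  refine le_of_tendsto_of_tendsto' h1 h2 (fun n => ?_)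
  exact H (fun k => (1/((n:ℝ)+1)) • b k) k _ (CC.smul _ ⟨hw.continuous, hc⟩)

end ContCZ

open Real MeasureTheory Metric
open scoped ENNReal NNReal

lemma pd_pd {N : ℕ} {u : EuclideanSpace ℝ (Fin N) → ℝ} (hu : ContDiff ℝ 2 u) (i j : Fin N)
    (x : EuclideanSpace ℝ (Fin N)) :
    pd (pd u j) i x = fderiv ℝ (fderiv ℝ u) x (EuclideanSpace.single i 1) (EuclideanSpace.single j 1) := by
  have hw' : ContDiff ℝ 1 (fderiv ℝ u) := hu.fderiv_right (by norm_num)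
  have h1 : HasFDerivAt (fderiv ℝ u) (fderiv ℝ (fderiv ℝ u) x) x :=
    (hw'.differentiable (by norm_num) _).hasFDerivAt
  have h2 := h1.clm_apply (hasFDerivAt_const (EuclideanSpace.single j (1:ℝ)) x)
  have : pd u j = fun y => fderiv ℝ u y (EuclideanSpace.single j 1) := rfl
  rw [this]
  unfold pd
  rw [h2.fderiv]
  simp

lemma pd_pd_symm {N : ℕ} {u : EuclideanSpace ℝ (Fin N) → ℝ} (hu : ContDiff ℝ 2 u) (i j : Fin N)
    (x : EuclideanSpace ℝ (Fin N)) : pd (pd u j) i x = pd (pd u i) j x := by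
  rw [pd_pd hu, pd_pd hu]
  exact (hu.contDiffAt.isSymmSndFDerivAt (by simp)).eq _ _

/-- sign -/
def sg (t : Bool) : ℝ := if t then 1 else -1

lemma czdir {N : ℕ} {u : EuclideanSpace ℝ (Fin N) → ℝ} (hu : ContDiff ℝ 2 u) (i j : Fin N) (t : Bool)
    (x : EuclideanSpace ℝ (Fin N)) :
    fderiv ℝ (fderiv ℝ u) x (EuclideanSpace.single i 1 + sg t • EuclideanSpace.single j 1)
      (EuclideanSpace.single i 1 + sg t • EuclideanSpace.single j 1)
    = pd (pd u i) i x + 2 * sg t * pd (pd u j) i x + pd (pd u j) j x := by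
  have h := pd_pd_symm hu i j x
  simp only [pd_pd hu] at h ⊢
  simp only [map_add, map_smul, ContinuousLinearMap.add_apply, ContinuousLinearMap.smul_apply, smul_eq_mul]
  rw [← h]
  have : sg t * sg t = 1 := by cases t <;> simp [sg]
  linear_combination (fderiv ℝ (fderiv ℝ u) x (EuclideanSpace.single j 1) (EuclideanSpace.single j 1)) * this

lemma CC.pdpd {N : ℕ} {w : EuclideanSpace ℝ (Fin N) → ℝ} (hw : ContDiff ℝ 2 w) (hc : HasCompactSupport w)
    (i j : Fin N) : CC (fun x => pd (pd w j) i x) := by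
  simp only [pd_pd hw]
  exact CC.D2 hw hc _ _

lemma CC.lap {N : ℕ} {w : EuclideanSpace ℝ (Fin N) → ℝ} (hw : ContDiff ℝ 2 w) (hc : HasCompactSupport w) :
    CC (fun x => lap w x) := CC.sum _ (fun i => CC.pdpd hw hc i i)

lemma CZ {N : ℕ} [NeZero N] {p : ℝ} (hp : 1 < p) : ∃ K : ℝ, 0 < K ∧
    ∀ (w : EuclideanSpace ℝ (Fin N) → ℝ), ContDiff ℝ 2 w → HasCompactSupport w → ∀ i j,
    ∫ x, |pd (pd w j) i x| ^ p ≤ K * ∫ x, |lap w x| ^ p := by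
  obtain ⟨K, hK, H⟩ := cont_cz (E := EuclideanSpace ℝ (Fin N)) (μ := volume) (ι := Fin N × Fin N × Bool) hp
    (fun k => EuclideanSpace.single k.1 1 + sg k.2.2 • EuclideanSpace.single k.2.1 1)
  have hp0 : 0 < p := by linarith
  have hNN : 0 < N := Nat.pos_of_ne_zero (NeZero.ne N)
  refine ⟨2 ^ (p+1) * K * (4 * N) ^ p, by positivity, fun w hw hc i j => ?_⟩
  have H' := H w hw hc
  simp only [czdir hw] at H'
  have e : ∀ x, ∑ k : Fin N × Fin N × Bool, (pd (pd w k.1) k.1 x + 2 * sg k.2.2 * pd (pd w k.2.1) k.1 x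
      + pd (pd w k.2.1) k.2.1 x) = 4 * N * lap w x := by
    intro x
    simp only [Fintype.sum_prod_type, Fintype.sum_bool]
    have : ∀ i j : Fin N, (pd (pd w i) i x + 2 * sg true * pd (pd w j) i x + pd (pd w j) j x
      + (pd (pd w i) i x + 2 * sg false * pd (pd w j) i x + pd (pd w j) j x))
      = 2 * pd (pd w i) i x + 2 * pd (pd w j) j x := by intro i j; simp [sg]; ring
    simp only [this, Finset.sum_add_distrib, ← Finset.mul_sum, Finset.sum_const, Finset.card_univ, Fintype.card_fin, nsmul_eq_mul]
    unfold _root_.lap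
    ring
  simp only [e] at H'
  have e2 : ∫ x, |4 * N * lap w x| ^ p = (4 * N) ^ p * ∫ x, |lap w x| ^ p := by
    rw [← integral_const_mul]
    congr 1; funext x
    rw [abs_mul, abs_of_nonneg (by positivity), Real.mul_rpow (by positivity) (abs_nonneg _)]
  rw [e2] at H'
  have h1 := H' (i, j, true)
  have h2 := H' (i, j, false)
  simp only [sg] at h1 h2
  have c1 : CC (fun x => pd (pd w i) i x + 2 * (if true = true then 1 else -1) * pd (pd w j) i x + pd (pd w j) j x) :=
    ((CC.pdpd hw hc i i).add ((CC.pdpd hw hc i j).smul _)).add (CC.pdpd hw hc j j)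
  have c2 : CC (fun x => pd (pd w i) i x + 2 * (if false = true then 1 else -1) * pd (pd w j) i x + pd (pd w j) j x) :=
    ((CC.pdpd hw hc i i).add ((CC.pdpd hw hc i j).smul _)).add (CC.pdpd hw hc j j)
  have h3 : ∫ x, |pd (pd w j) i x| ^ p ≤ ∫ x, 2 ^ p *
     (|pd (pd w i) i x + 2 * (if true = true then 1 else -1) * pd (pd w j) i x + pd (pd w j) j x| ^ p
     + |pd (pd w i) i x + 2 * (if false = true then 1 else -1) * pd (pd w j) i x + pd (pd w j) j x| ^ p) := by
    refine integral_mono ((CC.pdpd hw hc i j).absrpow hp0).int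
      (((c1.absrpow hp0).add (c2.absrpow hp0)).smul _).int ?_
    intro x
    simp only
    set A := pd (pd w i) i x + 2 * (if true = true then 1 else -1) * pd (pd w j) i x + pd (pd w j) j x with hA
    set B := pd (pd w i) i x + 2 * (if false = true then 1 else -1) * pd (pd w j) i x + pd (pd w j) j x with hB
    have := abs_add_rpow_le hp.le A (-B)
    rw [abs_neg] at this
    refine le_trans (Real.rpow_le_rpow (abs_nonneg _) ?_ hp0.le) this
    have e5 : A + -B = 4 * pd (pd w j) i x := by rw [hA, hB]; simp; ring
    rw [e5, abs_mul]
    norm_num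
    linarith [abs_nonneg (pd (pd w j) i x)]
  rw [integral_const_mul, integral_add (c1.absrpow hp0).int (c2.absrpow hp0).int] at h3
  rw [Real.rpow_add_one (by norm_num)]
  have h20 : (0:ℝ) < 2 ^ p := by positivity
  have h4 := mul_le_mul_of_nonneg_left (add_le_add h1 h2) h20.le
  refine h3.trans (h4.trans (le_of_eq ?_))
  ring

open Real MeasureTheory Metric
open scoped ENNReal NNReal

section Interp

lemma eLpNorm_oR {X : Type*} [MeasurableSpace X] {μ : Measure X} {P : ℝ} (hP : 1 < P) (f : X → ℝ) :
    eLpNorm f (ENNReal.ofReal P) μ = (∫⁻ x, ‖f x‖ₑ ^ P ∂μ) ^ (1/P) := by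
  rw [eLpNorm_eq_lintegral_rpow_enorm_toReal (by simp; linarith) (by simp),
    ENNReal.toReal_ofReal (by linarith)]

lemma eLpNorm_le_of_lint {X : Type*} [MeasurableSpace X] {μ : Measure X} {P : ℝ} (hP : 1 < P)
    (f g : X → ℝ) (c : ℝ≥0∞) (h : ∫⁻ x, ‖f x‖ₑ ^ P ∂μ ≤ c ^ P * ∫⁻ x, ‖g x‖ₑ ^ P ∂μ) :
    eLpNorm f (ENNReal.ofReal P) μ ≤ c * eLpNorm g (ENNReal.ofReal P) μ := by
  rw [eLpNorm_oR hP, eLpNorm_oR hP]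
  have hP0 : 0 < P := by linarith
  refine (ENNReal.rpow_le_rpow h (by positivity)).trans (le_of_eq ?_)
  rw [ENNReal.mul_rpow_of_nonneg _ _ (by positivity), ← ENNReal.rpow_mul, mul_one_div_cancel hP0.ne',
    ENNReal.rpow_one]

lemma holder_one {X : Type*} [MeasurableSpace X] {μ : Measure X} {P : ℝ} (hP : 1 < P)
    {f : X → ℝ≥0∞} (hf : AEMeasurable f μ) :
    (∫⁻ x, f x ∂μ) ^ P ≤ (μ Set.univ) ^ (P - 1) * ∫⁻ x, f x ^ P ∂μ := by
  have hP0 : 0 < P := by linarith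
  have hpq := Real.HolderConjugate.conjExponent hP
  have h := ENNReal.lintegral_mul_le_Lp_mul_Lq μ hpq hf (aemeasurable_const (b := (1:ℝ≥0∞)))
  simp only [Pi.mul_apply, mul_one, ENNReal.one_rpow, lintegral_one] at h
  refine (ENNReal.rpow_le_rpow h hP0.le).trans (le_of_eq ?_)
  rw [ENNReal.mul_rpow_of_nonneg _ _ hP0.le, ← ENNReal.rpow_mul, ← ENNReal.rpow_mul, one_div_mul_cancel hP0.ne',
    ENNReal.rpow_one, mul_comm]
  congr 2
  rw [Real.conjExponent]
  field_simp

variable {E : Type*} [NormedAddCommGroup E] [NormedSpace ℝ E] [MeasurableSpace E] [BorelSpace E]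
  [FiniteDimensional ℝ E] {μ : Measure E} [SFinite μ]

lemma mink_step {P : ℝ} (hP : 1 < P) {φ : ℝ → E → ℝ} (hφ : Continuous (Function.uncurry φ)) {ε : ℝ}
    (hε : 0 < ε) (Y : ℝ≥0∞) (H : ∀ s ∈ Set.Icc 0 ε, ∫⁻ x, ‖φ s x‖ₑ ^ P ∂μ ≤ Y) :
    ∫⁻ x, ‖∫ s in (0:ℝ)..ε, φ s x‖ₑ ^ P ∂μ ≤ (ENNReal.ofReal ε) ^ P * Y := by
  have hP0 : 0 < P := by linarith
  have hm : Measurable (Function.uncurry (fun (x : E) (s : ℝ) => ‖φ s x‖ₑ)) := by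
    have : Continuous (fun z : E × ℝ => ‖φ z.2 z.1‖ₑ) :=
      (hφ.comp (continuous_snd.prodMk continuous_fst)).enorm
    exact this.measurable
  calc ∫⁻ x, ‖∫ s in (0:ℝ)..ε, φ s x‖ₑ ^ P ∂μ
      ≤ ∫⁻ x, (ENNReal.ofReal ε) ^ (P-1) * (∫⁻ s in Set.Ioc 0 ε, ‖φ s x‖ₑ ^ P) ∂μ := by
        refine lintegral_mono fun x => ?_
        rw [intervalIntegral.integral_of_le hε.le]
        refine (ENNReal.rpow_le_rpow (enorm_integral_le_lintegral_enorm _) hP0.le).trans ?_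
        refine (holder_one hP ?_).trans (le_of_eq ?_)
        · exact (hm.comp (measurable_const.prodMk measurable_id)).aemeasurable
        · simp
    _ = (ENNReal.ofReal ε) ^ (P-1) * ∫⁻ x, (∫⁻ s in Set.Ioc 0 ε, ‖φ s x‖ₑ ^ P) ∂μ := by
        rw [lintegral_const_mul]
        exact Measurable.lintegral_prod_right' (f := fun z : E × ℝ => ‖φ z.2 z.1‖ₑ ^ P) (hm.pow_const P)
    _ = (ENNReal.ofReal ε) ^ (P-1) * ∫⁻ s in Set.Ioc 0 ε, ∫⁻ x, ‖φ s x‖ₑ ^ P ∂μ := by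
        rw [lintegral_lintegral_swap]
        exact (hm.pow_const P).aemeasurable
    _ ≤ (ENNReal.ofReal ε) ^ (P-1) * ∫⁻ s in Set.Ioc 0 ε, Y := by
        gcongr 1
        refine setLIntegral_mono' measurableSet_Ioc fun s hs => H s ⟨hs.1.le, hs.2⟩
    _ = _ := by
        rw [setLIntegral_const, Real.volume_Ioc, sub_zero]
        rw [mul_comm Y, ← mul_assoc]
        congr 1
        have h0 : ENNReal.ofReal ε ≠ 0 := by simp [hε]
        nth_rw 2 [← ENNReal.rpow_one (ENNReal.ofReal ε)]
        rw [← ENNReal.rpow_add _ _ h0 (by simp), sub_add_cancel]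

lemma taylor_pt {u : E → ℝ} (hu : ContDiff ℝ 2 u) (x v : E) {ε : ℝ} (hε : 0 < ε) :
    ε * |fderiv ℝ u x v| ≤ |u (x + ε • v)| + |u x|
      + ε * ∫ s in (0:ℝ)..ε, |fderiv ℝ (fderiv ℝ u) (x + s • v) v v| := by
  have hu1 : ContDiff ℝ 1 u := hu.of_le (by norm_num)
  have hu' : ContDiff ℝ 1 (fderiv ℝ u) := hu.fderiv_right (by norm_num)
  have d1 : ∀ t : ℝ, HasDerivAt (fun t : ℝ => u (x + t • v)) (fderiv ℝ u (x + t • v) v) t :=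
    hasDerivAt_line hu1 x v
  have d2 : ∀ t : ℝ, HasDerivAt (fun t : ℝ => fderiv ℝ u (x + t • v) v)
      (fderiv ℝ (fderiv ℝ u) (x + t • v) v v) t := by
    intro t
    have := (hasDerivAt_line hu' x v t).clm_apply (hasDerivAt_const t v)
    simpa using this
  have c2 : Continuous (fun t : ℝ => fderiv ℝ (fderiv ℝ u) (x + t • v) v v) := by
    have h := hu'.continuous_fderiv (by norm_num)
    have h' : Continuous (fun t : ℝ => fderiv ℝ (fderiv ℝ u) (x + t • v)) := h.comp (by fun_prop)
    exact (h'.clm_apply continuous_const).clm_apply continuous_const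
  obtain ⟨ξ, hξ, e1⟩ := exists_hasDerivAt_eq_slope (fun t : ℝ => u (x + t • v)) _ hε
    (fun t _ => (d1 t).continuousAt.continuousWithinAt) (fun t _ => d1 t)
  have e2 : fderiv ℝ u (x + ξ • v) v - fderiv ℝ u x v
      = ∫ s in (0:ℝ)..ξ, fderiv ℝ (fderiv ℝ u) (x + s • v) v v := by
    rw [intervalIntegral.integral_eq_sub_of_hasDerivAt (fun t _ => d2 t) (c2.intervalIntegrable _ _)]
    simp
  have h3 : |∫ s in (0:ℝ)..ξ, fderiv ℝ (fderiv ℝ u) (x + s • v) v v|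
      ≤ ∫ s in (0:ℝ)..ε, |fderiv ℝ (fderiv ℝ u) (x + s • v) v v| := by
    refine (intervalIntegral.abs_integral_le_integral_abs hξ.1.le).trans ?_
    exact intervalIntegral.integral_mono_interval le_rfl hξ.1.le hξ.2.le
      (Filter.Eventually.of_forall fun _ => abs_nonneg _) (c2.abs.intervalIntegrable _ _)
  rw [eq_div_iff (by linarith)] at e1
  simp only [zero_smul, add_zero, sub_zero] at e1
  set J := ∫ s in (0:ℝ)..ε, |fderiv ℝ (fderiv ℝ u) (x + s • v) v v|
  have h4 : |fderiv ℝ u x v| ≤ |fderiv ℝ u (x + ξ • v) v| + J := by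
    have : fderiv ℝ u x v = fderiv ℝ u (x + ξ • v) v - ∫ s in (0:ℝ)..ξ, fderiv ℝ (fderiv ℝ u) (x + s • v) v v := by
      rw [← e2]; ring
    rw [this]
    exact (abs_sub _ _).trans (by linarith)
  have h5 : |fderiv ℝ u (x + ξ • v) v| * ε ≤ |u (x + ε • v)| + |u x| := by
    rw [← abs_of_pos hε, ← abs_mul, abs_of_pos hε, e1]
    exact abs_sub _ _
  nlinarith [mul_le_mul_of_nonneg_left h4 hε.le]

lemma rho_le {x v : E} (hv : ‖v‖ ≤ 1 + ‖x‖) {s : ℝ} (hs0 : 0 ≤ s) (hs : s ≤ 1/2) :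
    1 + ‖x‖ ≤ 2 * (1 + ‖x + s • v‖) := by
  have h1 : ‖x‖ ≤ ‖x + s • v‖ + ‖s • v‖ := by
    have := norm_sub_le (x + s • v) (s • v)
    simpa using this
  rw [norm_smul, Real.norm_of_nonneg hs0] at h1
  have : s * ‖v‖ ≤ 1/2 * (1 + ‖x‖) := by gcongr
  linarith

lemma interp1 {P : ℝ} (hP : 1 < P) {v : E → E} (hvc : Continuous v) (hv : ∀ x, ‖v x‖ ≤ 1 + ‖x‖)
    (hT : ∀ s ∈ Set.Icc (0:ℝ) (1/2), ∀ f : E → ℝ≥0∞, Measurable f → ∫⁻ x, f (x + s • v x) ∂μ ≤ ∫⁻ x, f x ∂μ)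
    {α : ℝ} (hα : 2 ≤ α) {u : E → ℝ} (hu : ContDiff ℝ 2 u) {G : E → ℝ} (hGc : Continuous G)
    (hG0 : ∀ y, 0 ≤ G y)
    (hG : ∀ x y, |fderiv ℝ (fderiv ℝ u) y (v x) (v x)| ≤ (1 + ‖x‖)^2 * G y)
    {ε : ℝ} (hε : 0 < ε) (hε2 : ε ≤ 1/2) :
    eLpNorm (fun x => ε * ((1 + ‖x‖)^(α-2) * fderiv ℝ u x (v x))) (ENNReal.ofReal P) μ
      ≤ ENNReal.ofReal (2^α) * eLpNorm (fun x => (1 + ‖x‖)^(α-2) * u x) (ENNReal.ofReal P) μ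
        + eLpNorm (fun x => (1 + ‖x‖)^(α-2) * u x) (ENNReal.ofReal P) μ
        + ENNReal.ofReal (ε * ε * 2^α) * eLpNorm (fun x => (1 + ‖x‖)^α * G x) (ENNReal.ofReal P) μ := by
  have hP0 : 0 < P := by linarith
  have hw : ∀ γ : ℝ, Continuous (fun x : E => (1 + ‖x‖)^γ) := fun γ =>
    (continuous_const.add continuous_norm).rpow_const
      (fun x => Or.inl (show (1 + ‖x‖ : ℝ) ≠ 0 by positivity))
  have ha : ∀ (y : E) (γ : ℝ), |(1 + ‖y‖)^γ| = (1 + ‖y‖)^γ := fun y γ => abs_of_nonneg (by positivity)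
  have hu' : ContDiff ℝ 1 (fderiv ℝ u) := hu.fderiv_right (by norm_num)
  have hD2 := hu'.continuous_fderiv (by norm_num)
  have hD2c : Continuous (fun z : ℝ × E => |fderiv ℝ (fderiv ℝ u) (z.2 + z.1 • v z.2) (v z.2) (v z.2)|) := by
    have hv2 : Continuous (fun z : ℝ × E => v z.2) := hvc.comp continuous_snd
    have h' : Continuous (fun z : ℝ × E => fderiv ℝ (fderiv ℝ u) (z.2 + z.1 • v z.2)) := hD2.comp (by fun_prop)
    exact ((h'.clm_apply hv2).clm_apply hv2).abs
  have hTc : ∀ s : ℝ, Continuous (fun x => x + s • v x) := fun s => by fun_prop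
  set f1 : E → ℝ := fun x => (1 + ‖x‖)^(α-2) * |u (x + ε • v x)| with hf1
  set f2 : E → ℝ := fun x => (1 + ‖x‖)^(α-2) * |u x| with hf2
  set φ : ℝ → E → ℝ := fun s x => ε * ((1 + ‖x‖)^(α-2) * |fderiv ℝ (fderiv ℝ u) (x + s • v x) (v x) (v x)|) with hφ
  have hφc : Continuous (Function.uncurry φ) := by
    have : Function.uncurry φ = fun z : ℝ × E => ε * ((1 + ‖z.2‖)^(α-2) * |fderiv ℝ (fderiv ℝ u) (z.2 + z.1 • v z.2) (v z.2) (v z.2)|) := rfl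
    rw [this]
    exact continuous_const.mul (((hw (α-2)).comp continuous_snd).mul hD2c)
  set f3 : E → ℝ := fun x => ∫ s in (0:ℝ)..ε, φ s x with hf3
  have c1 : Continuous f1 := (hw _).mul ((hu.continuous.comp (hTc ε)).abs)
  have c2 : Continuous f2 := (hw _).mul hu.continuous.abs
  have c3 : Continuous f3 := by
    refine intervalIntegral.continuous_parametric_intervalIntegral_of_continuous' (f := fun x s => φ s x) ?_ _ _
    exact hφc.comp (continuous_snd.prodMk continuous_fst)
  have hp1 : (1:ℝ≥0∞) ≤ ENNReal.ofReal P := by simpa using hP.le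
  have step : eLpNorm (fun x => ε * ((1 + ‖x‖)^(α-2) * fderiv ℝ u x (v x))) (ENNReal.ofReal P) μ
      ≤ eLpNorm ((f1 + f2) + f3) (ENNReal.ofReal P) μ := by
    refine eLpNorm_mono_real fun x => ?_
    have hr : 0 ≤ (1 + ‖x‖)^(α-2) := by positivity
    rw [Real.norm_eq_abs, abs_mul, abs_mul, abs_of_pos hε, abs_of_nonneg hr]
    have := taylor_pt hu x (v x) hε
    have e3 : f3 x = (1 + ‖x‖)^(α-2) * (ε * ∫ s in (0:ℝ)..ε, |fderiv ℝ (fderiv ℝ u) (x + s • v x) (v x) (v x)|) := by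
      rw [hf3]; simp only [hφ]
      rw [intervalIntegral.integral_const_mul, intervalIntegral.integral_const_mul]; ring
    simp only [Pi.add_apply]
    rw [e3]
    calc ε * ((1 + ‖x‖)^(α-2) * |fderiv ℝ u x (v x)|) = (1 + ‖x‖)^(α-2) * (ε * |fderiv ℝ u x (v x)|) := by ring
      _ ≤ (1 + ‖x‖)^(α-2) * (|u (x + ε • v x)| + |u x|
          + ε * ∫ s in (0:ℝ)..ε, |fderiv ℝ (fderiv ℝ u) (x + s • v x) (v x) (v x)|) := by gcongr
      _ = _ := by rw [hf1, hf2]; ring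
  refine step.trans ((eLpNorm_add_le (c1.add c2).aestronglyMeasurable c3.aestronglyMeasurable hp1).trans ?_)
  refine add_le_add ((eLpNorm_add_le c1.aestronglyMeasurable c2.aestronglyMeasurable hp1).trans (add_le_add ?_ ?_)) ?_
  · refine eLpNorm_le_of_lint hP _ _ _ ?_
    have hm0 : Measurable (fun x => ‖(1 + ‖x‖)^(α-2) * u x‖ₑ ^ P) :=
      (((hw (α-2)).mul hu.continuous).enorm).measurable.pow_const P
    have hm : Measurable (fun x => ENNReal.ofReal (2^α) ^ P * ‖(1 + ‖x‖)^(α-2) * u x‖ₑ ^ P) :=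
      hm0.const_mul _
    have h := hT ε ⟨hε.le, hε2⟩ _ hm
    rw [lintegral_const_mul _ hm0] at h
    refine le_trans (lintegral_mono fun x => ?_) h
    simp only
    rw [← ENNReal.mul_rpow_of_nonneg _ _ hP0.le]
    refine ENNReal.rpow_le_rpow ?_ hP0.le
    rw [Real.enorm_eq_ofReal_abs, Real.enorm_eq_ofReal_abs, ← ENNReal.ofReal_mul (by positivity)]
    refine ENNReal.ofReal_le_ofReal ?_
    have hr := rho_le (hv x) hε.le hε2
    rw [hf1]
    simp only
    rw [abs_mul, abs_mul, abs_abs, ← mul_assoc, ha, ha]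
    gcongr
    calc (1 + ‖x‖)^(α-2) ≤ (2 * (1 + ‖x + ε • v x‖))^(α-2) := Real.rpow_le_rpow (by positivity) hr (by linarith)
      _ = 2^(α-2) * (1 + ‖x + ε • v x‖)^(α-2) := Real.mul_rpow (by norm_num) (by positivity)
      _ ≤ _ := by gcongr <;> linarith
  · refine eLpNorm_mono fun x => ?_
    rw [hf2]; simp
  · refine eLpNorm_le_of_lint hP _ _ _ ?_
    set Y := ENNReal.ofReal (ε * 2^α) ^ P * ∫⁻ x, ‖(1 + ‖x‖)^α * G x‖ₑ ^ P ∂μ with hY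
    have h := mink_step (μ := μ) hP hφc hε Y ?_
    · refine h.trans (le_of_eq ?_)
      rw [hY, ← mul_assoc, ← ENNReal.mul_rpow_of_nonneg _ _ hP0.le, ← ENNReal.ofReal_mul hε.le, mul_assoc]
    · intro s hs
      have hs2 : s ≤ 1/2 := hs.2.trans hε2
      have hm0 : Measurable (fun x => ‖(1 + ‖x‖)^α * G x‖ₑ ^ P) := (((hw α).mul hGc).enorm).measurable.pow_const P
      have hm : Measurable (fun x => ENNReal.ofReal (ε * 2^α) ^ P * ‖(1 + ‖x‖)^α * G x‖ₑ ^ P) :=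
        hm0.const_mul _
      have h := hT s ⟨hs.1, hs2⟩ _ hm
      rw [lintegral_const_mul _ hm0] at h
      refine le_trans (lintegral_mono fun x => ?_) h
      simp only
      rw [← ENNReal.mul_rpow_of_nonneg _ _ hP0.le]
      refine ENNReal.rpow_le_rpow ?_ hP0.le
      rw [Real.enorm_eq_ofReal_abs, Real.enorm_eq_ofReal_abs, ← ENNReal.ofReal_mul (by positivity)]
      refine ENNReal.ofReal_le_ofReal ?_
      have hr := rho_le (hv x) hs.1 hs2
      have hG' := hG x (x + s • v x)
      have hg0 := hG0 (x + s • v x)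
      rw [hφ]
      simp only
      rw [abs_mul, abs_mul, ha, abs_abs, abs_of_pos hε, abs_mul, ha, abs_of_nonneg hg0]
      have e6 : (1 + ‖x‖)^(α-2) * (1 + ‖x‖)^2 = (1 + ‖x‖)^α := by
        rw [← Real.rpow_natCast, ← Real.rpow_add (by positivity)]; congr 1; norm_num
      calc ε * ((1 + ‖x‖)^(α-2) * |fderiv ℝ (fderiv ℝ u) (x + s • v x) (v x) (v x)|)
          ≤ ε * ((1 + ‖x‖)^(α-2) * ((1 + ‖x‖)^2 * G (x + s • v x))) := by gcongr
        _ = ε * ((1 + ‖x‖)^α * G (x + s • v x)) := by rw [← e6]; ring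
        _ ≤ ε * ((2 * (1 + ‖x + s • v x‖))^α * G (x + s • v x)) := by
            gcongr
        _ = _ := by rw [Real.mul_rpow (by norm_num) (by positivity)]; ring

end Interp

open Real MeasureTheory Metric
open scoped ENNReal NNReal

section NL
variable {N : ℕ}

/-- real valued `L^P` norm -/
noncomputable def nL (P : ℝ) (f : EuclideanSpace ℝ (Fin N) → ℝ) : ℝ :=
  (eLpNorm f (ENNReal.ofReal P) volume).toReal

lemma nL_nonneg (P : ℝ) (f : EuclideanSpace ℝ (Fin N) → ℝ) : 0 ≤ nL P f := ENNReal.toReal_nonneg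

lemma CC.memLp {f : EuclideanSpace ℝ (Fin N) → ℝ} (hf : CC f) (p : ℝ≥0∞) : MemLp f p volume :=
  hf.1.memLp_of_hasCompactSupport hf.2

lemma CC.ne_top {f : EuclideanSpace ℝ (Fin N) → ℝ} (hf : CC f) (p : ℝ≥0∞) : eLpNorm f p volume ≠ ⊤ :=
  (hf.memLp p).2.ne

lemma nL_pow {P : ℝ} (hP : 1 < P) {f : EuclideanSpace ℝ (Fin N) → ℝ} (hf : CC f) :
    nL P f ^ P = ∫ x, |f x| ^ P := by
  have hP0 : 0 < P := by linarith
  unfold nL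
  rw [eLpNorm_oR hP, ← ENNReal.toReal_rpow, ← Real.rpow_mul ENNReal.toReal_nonneg, one_div_mul_cancel hP0.ne',
    Real.rpow_one]
  rw [integral_eq_lintegral_of_nonneg_ae (Filter.Eventually.of_forall fun x => by positivity)
    (hf.absrpow hP0).1.aestronglyMeasurable]
  congr 1
  refine lintegral_congr fun x => ?_
  rw [Real.enorm_eq_ofReal_abs, ENNReal.ofReal_rpow_of_nonneg (abs_nonneg _) hP0.le]

lemma nL_mono {P : ℝ} {f g : EuclideanSpace ℝ (Fin N) → ℝ} (hg : CC g) (h : ∀ x, |f x| ≤ |g x|) :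
    nL P f ≤ nL P g :=
  ENNReal.toReal_mono (hg.ne_top _) (eLpNorm_mono h)

lemma nL_abs {P : ℝ} (f : EuclideanSpace ℝ (Fin N) → ℝ) : nL P (fun x => |f x|) = nL P f := by
  unfold nL; congr 1
  exact eLpNorm_norm f

lemma nL_smul {P : ℝ} {c : ℝ} (hc : 0 ≤ c) (f : EuclideanSpace ℝ (Fin N) → ℝ) :
    nL P (fun x => c * f x) = c * nL P f := by
  unfold nL
  have := eLpNorm_const_smul c f (ENNReal.ofReal P) (volume : Measure (EuclideanSpace ℝ (Fin N)))
  have e : (c • f) = fun x => c * f x := by funext x; simp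
  rw [e] at this
  rw [this, ENNReal.toReal_mul]
  simp [abs_of_nonneg hc]

lemma nL_add {P : ℝ} (hP : 1 < P) {f g : EuclideanSpace ℝ (Fin N) → ℝ} (hf : CC f) (hg : CC g) :
    nL P (fun x => f x + g x) ≤ nL P f + nL P g := by
  unfold nL
  rw [← ENNReal.toReal_add (hf.ne_top _) (hg.ne_top _)]
  refine ENNReal.toReal_mono (ENNReal.add_ne_top.2 ⟨hf.ne_top _, hg.ne_top _⟩) ?_
  exact eLpNorm_add_le hf.1.aestronglyMeasurable hg.1.aestronglyMeasurable (by simpa using hP.le)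

lemma CC.abs' {f : EuclideanSpace ℝ (Fin N) → ℝ} (hf : CC f) : CC (fun x => |f x|) :=
  hf.comp continuous_abs abs_zero

lemma nL_sum {P : ℝ} (hP : 1 < P) {κ : Type*} (s : Finset κ) {c : κ → ℝ} (hc : ∀ k, 0 ≤ c k)
    {g : κ → EuclideanSpace ℝ (Fin N) → ℝ} (hg : ∀ k, CC (g k)) :
    nL P (fun x => ∑ k ∈ s, c k * |g k x|) ≤ ∑ k ∈ s, c k * nL P (g k) := by
  classical
  induction s using Finset.induction_on with
  | empty => simp [nL]
  | insert a s ha ih =>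
    simp only [Finset.sum_insert ha]
    refine (nL_add hP ((hg a).abs'.smul _) (CC.sum s fun k => (hg k).abs'.smul _)).trans ?_
    rw [nL_smul (hc a), nL_abs]
    linarith

lemma nL_le_sum {P : ℝ} (hP : 1 < P) {κ : Type*} (s : Finset κ) {c : κ → ℝ} (hc : ∀ k, 0 ≤ c k)
    {f : EuclideanSpace ℝ (Fin N) → ℝ}
    {g : κ → EuclideanSpace ℝ (Fin N) → ℝ} (hg : ∀ k, CC (g k)) (h : ∀ x, |f x| ≤ ∑ k ∈ s, c k * |g k x|) :
    nL P f ≤ ∑ k ∈ s, c k * nL P (g k) := by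
  refine (nL_mono (CC.sum s fun k => (hg k).abs'.smul _) fun x => ?_).trans (nL_sum hP s hc hg)
  exact (h x).trans (le_abs_self _)

lemma nL_le3 {P : ℝ} (hP : 1 < P) {a b c : ℝ} (ha : 0 ≤ a) (hb : 0 ≤ b) (hc : 0 ≤ c)
    {f g1 g2 g3 : EuclideanSpace ℝ (Fin N) → ℝ}
    (h1 : CC g1) (h2 : CC g2) (h3 : CC g3) (h : ∀ x, |f x| ≤ a * |g1 x| + b * |g2 x| + c * |g3 x|) :
    nL P f ≤ a * nL P g1 + b * nL P g2 + c * nL P g3 := by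
  have := nL_le_sum hP Finset.univ (c := ![a, b, c]) (g := ![g1, g2, g3]) (f := f)
    (by intro k; fin_cases k <;> simp [ha, hb, hc]) (by intro k; fin_cases k <;> simp [h1, h2, h3])
    (by intro x; simpa [Fin.sum_univ_three] using h x)
  simpa [Fin.sum_univ_three] using this

lemma nL_le2 {P : ℝ} (hP : 1 < P) {a b : ℝ} (ha : 0 ≤ a) (hb : 0 ≤ b)
    {f g1 g2 : EuclideanSpace ℝ (Fin N) → ℝ}
    (h1 : CC g1) (h2 : CC g2) (h : ∀ x, |f x| ≤ a * |g1 x| + b * |g2 x|) :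
    nL P f ≤ a * nL P g1 + b * nL P g2 := by
  have := nL_le3 hP ha hb le_rfl h1 h2 h2 (f := f) (by simpa using h)
  simpa using this

lemma shear_le (i j : Fin N) {s : ℝ} (hs : 0 ≤ s) (f : EuclideanSpace ℝ (Fin N) → ℝ≥0∞) (hf : Measurable f) :
    ∫⁻ x, f (x + s • (x j • EuclideanSpace.single i (1:ℝ))) ≤ ∫⁻ x, f x := by
  set L : EuclideanSpace ℝ (Fin N) →ₗ[ℝ] EuclideanSpace ℝ (Fin N) :=
    LinearMap.transvection ((EuclideanSpace.proj j : EuclideanSpace ℝ (Fin N) →L[ℝ] ℝ) : EuclideanSpace ℝ (Fin N) →ₗ[ℝ] ℝ) (s • EuclideanSpace.single i (1:ℝ)) with hL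
  have hdet : LinearMap.det L = 1 + s * (if j = i then 1 else 0) := by
    rw [hL, LinearMap.transvection.det]
    simp [Pi.single_apply]
  have hdet1 : 1 ≤ LinearMap.det L := by
    rw [hdet]; split_ifs <;> simp [hs]
  have e : ∀ x, x + s • (x j • EuclideanSpace.single i (1:ℝ)) = L x := by
    intro x
    rw [hL, LinearMap.transvection.apply]
    rw [smul_comm]; rfl
  simp only [e]
  have hLm : Measurable L := (LinearMap.continuous_of_finiteDimensional L).measurable
  rw [← lintegral_map hf hLm, Measure.map_linearMap_addHaar_eq_smul_addHaar _ (by linarith : LinearMap.det L ≠ 0),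
    lintegral_smul_measure]
  rw [smul_eq_mul]
  refine mul_le_of_le_one_left bot_le ?_
  rw [ENNReal.ofReal_le_one, abs_of_nonneg (by positivity)]
  exact inv_le_one_of_one_le₀ hdet1

lemma wcont {E : Type*} [SeminormedAddCommGroup E] (γ : ℝ) : Continuous (fun x : E => (1 + ‖x‖)^γ) :=
  (continuous_const.add continuous_norm).rpow_const
      (fun x => Or.inl (show (1 + ‖x‖ : ℝ) ≠ 0 by positivity))

lemma CC.wmul {f : EuclideanSpace ℝ (Fin N) → ℝ} (hf : CC f) {g : EuclideanSpace ℝ (Fin N) → ℝ}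
    (hg : Continuous g) : CC (fun x => g x * f x) := ⟨hg.mul hf.1, hf.2.mul_left⟩

lemma CC.pd {w : EuclideanSpace ℝ (Fin N) → ℝ} (hw : ContDiff ℝ 2 w) (hc : HasCompactSupport w)
    (i : Fin N) : CC (fun x => pd w i x) := by
  have hw' : ContDiff ℝ 1 (fderiv ℝ w) := hw.fderiv_right (by norm_num)
  refine ⟨?_, ?_⟩
  · exact hw'.continuous.clm_apply continuous_const
  · exact (hc.fderiv (𝕜 := ℝ)).comp_left (g := fun L : EuclideanSpace ℝ (Fin N) →L[ℝ] ℝ => L (EuclideanSpace.single i 1)) (by simp)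

lemma abs_coord_le (x : EuclideanSpace ℝ (Fin N)) (j : Fin N) : |x j| ≤ ‖x‖ := by
  have := EuclideanSpace.norm_eq x
  rw [this]
  apply Real.le_sqrt_of_sq_le
  have h := Finset.single_le_sum (f := fun k => ‖x k‖^2) (fun k _ => by positivity) (Finset.mem_univ j)
  simpa using h

lemma norm_le_sum (x : EuclideanSpace ℝ (Fin N)) : ‖x‖ ≤ ∑ j, |x j| := by
  have h : x = ∑ j, x j • EuclideanSpace.single j (1:ℝ) := by
    ext k
    simp [Pi.single_apply]
  conv_lhs => rw [h]
  refine (norm_sum_le _ _).trans (le_of_eq ?_)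
  refine Finset.sum_congr rfl fun j _ => ?_
  rw [norm_smul]; simp

lemma interp2 {P : ℝ} (hP : 1 < P) {α : ℝ} (hα : 2 ≤ α) {u : EuclideanSpace ℝ (Fin N) → ℝ} (hu : ContDiff ℝ 2 u)
    (hc : HasCompactSupport u) (i : Fin N) {l : EuclideanSpace ℝ (Fin N) → ℝ} (hl : Continuous l)
    (hl1 : ∀ x, |l x| ≤ 1 + ‖x‖)
    (hT : ∀ s ∈ Set.Icc (0:ℝ) (1/2), ∀ f : EuclideanSpace ℝ (Fin N) → ℝ≥0∞, Measurable f →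
      ∫⁻ x, f (x + s • (l x • EuclideanSpace.single i (1:ℝ))) ≤ ∫⁻ x, f x)
    {ε : ℝ} (hε : 0 < ε) (hε2 : ε ≤ 1/2) :
    ε * nL P (fun x => (1 + ‖x‖)^(α-2) * (l x * pd u i x))
      ≤ (2^α + 1) * nL P (fun x => (1 + ‖x‖)^(α-2) * u x)
        + ε * ε * 2^α * nL P (fun x => (1 + ‖x‖)^α * pd (pd u i) i x) := by
  have hv : ∀ x, ‖l x • EuclideanSpace.single i (1:ℝ)‖ ≤ 1 + ‖x‖ := by
    intro x; rw [norm_smul]; simpa using hl1 x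
  have hcc := CC.pdpd hu hc i i
  have huc : CC u := ⟨hu.continuous, hc⟩
  have h := interp1 (μ := (volume : Measure (EuclideanSpace ℝ (Fin N)))) hP
    (v := fun x => l x • EuclideanSpace.single i (1:ℝ)) (by fun_prop) hv hT hα hu
    (G := fun y => |pd (pd u i) i y|) hcc.1.abs (fun y => abs_nonneg _) (by
      intro x y
      simp only [map_smul, ContinuousLinearMap.smul_apply, smul_eq_mul]
      rw [pd_pd hu, abs_mul, abs_mul, ← mul_assoc, ← sq]
      gcongr
      exact hl1 x) hε hε2
  have c1 := huc.wmul (wcont (α-2))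
  have c2 := hcc.abs'.wmul (wcont α)
  have h' := ENNReal.toReal_mono (by
    refine ENNReal.add_ne_top.2 ⟨ENNReal.add_ne_top.2 ⟨ENNReal.mul_ne_top (by simp) (c1.ne_top _), c1.ne_top _⟩,
      ENNReal.mul_ne_top (by simp) (c2.ne_top _)⟩) h
  rw [ENNReal.toReal_add (ENNReal.add_ne_top.2 ⟨ENNReal.mul_ne_top (by simp) (c1.ne_top _), c1.ne_top _⟩) (ENNReal.mul_ne_top (by simp) (c2.ne_top _)),
    ENNReal.toReal_add (ENNReal.mul_ne_top (by simp) (c1.ne_top _)) (c1.ne_top _),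
    ENNReal.toReal_mul, ENNReal.toReal_mul, ENNReal.toReal_ofReal (by positivity), ENNReal.toReal_ofReal (by positivity)] at h'
  rw [← nL_smul hε.le]
  have e1 : nL P (fun x => (1 + ‖x‖)^α * pd (pd u i) i x) = nL P (fun x => (1 + ‖x‖)^α * |pd (pd u i) i x|) := by
    rw [← nL_abs]; congr 1; funext x
    rw [abs_mul, abs_of_nonneg (by positivity)]
  rw [e1]
  have e2 : (fun x => ε * ((1 + ‖x‖)^(α-2) * (l x * pd u i x)))
    = fun x => ε * ((1 + ‖x‖)^(α-2) * fderiv ℝ u x (l x • EuclideanSpace.single i (1:ℝ))) := by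
    funext x; simp [_root_.pd]
  rw [e2]
  unfold nL
  refine h'.trans (le_of_eq ?_)
  ring

lemma interp {P : ℝ} (hP : 1 < P) {α : ℝ} (hα : 2 ≤ α) : ∃ C : ℝ, 0 < C ∧
    ∀ u : EuclideanSpace ℝ (Fin N) → ℝ, ContDiff ℝ 2 u → HasCompactSupport u → ∀ i : Fin N,
    ∀ ε : ℝ, 0 < ε → ε ≤ 1/2 →
    nL P (fun x => (1 + ‖x‖)^(α-1) * pd u i x)
      ≤ C * ε * nL P (fun x => (1 + ‖x‖)^α * pd (pd u i) i x)
        + C / ε * nL P (fun x => (1 + ‖x‖)^(α-2) * u x) := by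
  refine ⟨(N + 1) * (2^α + 1), by positivity, fun u hu hc i ε hε hε2 => ?_⟩
  set A := nL P (fun x => (1 + ‖x‖)^α * pd (pd u i) i x) with hA
  set B := nL P (fun x => (1 + ‖x‖)^(α-2) * u x) with hB
  have hA0 : 0 ≤ A := nL_nonneg _ _
  have hB0 : 0 ≤ B := nL_nonneg _ _
  have hdiv : ∀ X : ℝ, ε * X ≤ (2^α + 1) * B + ε * ε * 2^α * A → X ≤ (2^α + 1) * (ε * A + B / ε) := by
    intro X h
    have h2 : ε * X ≤ ε * ((2^α + 1) * (ε * A + B / ε)) := by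
      refine h.trans ?_
      have : ε * ((2^α + 1) * (ε * A + B / ε)) = (2^α + 1) * B + ε * ε * 2^α * A + ε * ε * A := by
        field_simp; ring
      rw [this]
      have : 0 ≤ ε * ε * A := by positivity
      linarith
    exact le_of_mul_le_mul_left h2 hε
  have h1 : nL P (fun x => (1 + ‖x‖)^(α-2) * ((1:ℝ) * pd u i x)) ≤ (2^α + 1) * (ε * A + B / ε) := by
    refine hdiv _ (interp2 hP hα hu hc i (l := fun _ => 1) continuous_const (fun x => by simp) ?_ hε hε2)
    intro s _ f _
    rw [lintegral_add_right_eq_self]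
  have h2 : ∀ j, nL P (fun x => (1 + ‖x‖)^(α-2) * (x j * pd u i x)) ≤ (2^α + 1) * (ε * A + B / ε) := by
    intro j
    refine hdiv _ (interp2 hP hα hu hc i (l := fun x => x j) (by fun_prop) (fun x => ?_) ?_ hε hε2)
    · linarith [abs_coord_le x j]
    · intro s hs f hf
      exact shear_le i j hs.1 f hf
  have hpd := CC.pd hu hc i
  have key := nL_le_sum hP (Finset.univ : Finset (Option (Fin N))) (c := fun _ => 1) (fun _ => zero_le_one)
    (f := fun x => (1 + ‖x‖)^(α-1) * pd u i x)
    (g := fun k x => (1 + ‖x‖)^(α-2) * ((match k with | none => (1:ℝ) | some j => x j) * pd u i x))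
    (by
      intro k
      refine CC.wmul (CC.wmul hpd ?_) (wcont _)
      cases k with
      | none => exact continuous_const
      | some j => simp only; fun_prop)
    (by
      intro x
      rw [Fintype.sum_option]
      simp only [abs_mul, abs_of_nonneg (show 0 ≤ (1 + ‖x‖)^(α-2) by positivity), one_mul,
        abs_of_nonneg (show 0 ≤ (1 + ‖x‖)^(α-1) by positivity), abs_one]
      have e : (1 + ‖x‖)^(α-1) = (1 + ‖x‖)^(α-2) * (1 + ‖x‖) := by
        rw [← Real.rpow_add_one (by positivity)]; congr 1; ring
      rw [e, ← Finset.mul_sum, ← Finset.sum_mul]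
      have := norm_le_sum x
      calc (1 + ‖x‖)^(α-2) * (1 + ‖x‖) * |pd u i x|
          ≤ (1 + ‖x‖)^(α-2) * (1 + ∑ j, |x j|) * |pd u i x| := by gcongr
        _ = _ := by ring)
  rw [Fintype.sum_option] at key
  simp only [one_mul] at key
  simp only [one_mul] at h1
  have h3 := Finset.sum_le_sum (s := Finset.univ) fun j _ => h2 j
  rw [Finset.sum_const, Finset.card_univ, Fintype.card_fin, nsmul_eq_mul] at h3
  refine key.trans ((add_le_add h1 h3).trans (le_of_eq ?_))
  ring

end NL

open Real MeasureTheory Metric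
open scoped ENNReal NNReal

section PE
variable {N : ℕ}

lemma ibp {F G : EuclideanSpace ℝ (Fin N) → ℝ} (hF : ContDiff ℝ 1 F) (hG : ContDiff ℝ 1 G)
    (hc : HasCompactSupport G) (i : Fin N) :
    ∫ x, F x * pd G i x = - ∫ x, pd F i x * G x := by
  have c1 : Continuous (fun x => pd F i x) := (hF.continuous_fderiv (by norm_num)).clm_apply continuous_const
  have c2 : Continuous (fun x => pd G i x) := (hG.continuous_fderiv (by norm_num)).clm_apply continuous_const
  have s2 : HasCompactSupport (fun x => pd G i x) :=
    (hc.fderiv (𝕜 := ℝ)).comp_left (g := fun L : EuclideanSpace ℝ (Fin N) →L[ℝ] ℝ => L (EuclideanSpace.single i 1)) (by simp)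
  refine integral_mul_fderiv_eq_neg_fderiv_mul_of_integrable (f := F) (g := G) ?_ ?_ ?_ 
    (fun x _ => hF.differentiable (by norm_num) x) (fun x _ => hG.differentiable (by norm_num) x)
  · exact (c1.mul hG.continuous).integrable_of_hasCompactSupport hc.mul_left
  · exact (hF.continuous.mul c2).integrable_of_hasCompactSupport s2.mul_left
  · exact (hF.continuous.mul hG.continuous).integrable_of_hasCompactSupport hc.mul_left

lemma hasFDerivAt_radial {h : ℝ → ℝ} (hh : Differentiable ℝ h) (x : EuclideanSpace ℝ (Fin N)) :
    HasFDerivAt (fun x => h (‖x‖^2)) (deriv h (‖x‖^2) • ((2:ℝ) • innerSL ℝ x)) x := by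
  have h1 : HasFDerivAt (fun x : EuclideanSpace ℝ (Fin N) => ‖x‖^2) ((2:ℝ) • innerSL ℝ x) x := by
    have := (hasStrictFDerivAt_norm_sq x).hasFDerivAt
    have e : (2:ℝ) • innerSL ℝ x = (2:ℕ) • innerSL ℝ x := by rw [two_smul, two_smul]
    rw [e]; exact this
  exact (hh (‖x‖^2)).hasDerivAt.comp_hasFDerivAt x h1

lemma pd_radial {h : ℝ → ℝ} (hh : Differentiable ℝ h) (i : Fin N) (x : EuclideanSpace ℝ (Fin N)) :
    pd (fun x => h (‖x‖^2)) i x = x i * (2 * deriv h (‖x‖^2)) := by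
  unfold pd
  rw [(hasFDerivAt_radial hh x).fderiv]
  simp [EuclideanSpace.inner_single_right]
  ring

lemma pd_coord_radial {h : ℝ → ℝ} (hh : Differentiable ℝ h) (i : Fin N) (x : EuclideanSpace ℝ (Fin N)) :
    pd (fun x => x i * h (‖x‖^2)) i x = h (‖x‖^2) + 2 * (x i)^2 * deriv h (‖x‖^2) := by
  unfold pd
  have h1 : HasFDerivAt (fun x : EuclideanSpace ℝ (Fin N) => x i)
    (EuclideanSpace.proj i : EuclideanSpace ℝ (Fin N) →L[ℝ] ℝ) x :=
    (EuclideanSpace.proj i : EuclideanSpace ℝ (Fin N) →L[ℝ] ℝ).hasFDerivAt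
  have h2 : HasFDerivAt (fun x : EuclideanSpace ℝ (Fin N) => x i * h (‖x‖^2)) _ x :=
    h1.mul (hasFDerivAt_radial hh x)
  rw [h2.fderiv]
  simp [EuclideanSpace.inner_single_right]
  ring

lemma ibp_radial {h k : ℝ → ℝ} (hh : ContDiff ℝ 2 h) (hk : ContDiff ℝ 1 k)
    {g : EuclideanSpace ℝ (Fin N) → ℝ} (hg : ContDiff ℝ 2 g) (hc : HasCompactSupport g) :
    ∫ x, (h (‖x‖^2) * lap g x + k (‖x‖^2) * ∑ i, x i * pd g i x)
      = ∫ x, (- (N * (k (‖x‖^2) - 2 * deriv h (‖x‖^2))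
          + 2 * ‖x‖^2 * deriv (fun s => k s - 2 * deriv h s) (‖x‖^2))) * g x := by
  have hns : ContDiff ℝ 2 (fun x : EuclideanSpace ℝ (Fin N) => ‖x‖^2) := contDiff_norm_sq ℝ
  have hh' : ContDiff ℝ 1 (deriv h) := by
    have := (contDiff_succ_iff_deriv (n := 1) (f := h)).1 (by rw [one_add_one_eq_two]; exact hh)
    exact this.2.2
  set K : ℝ → ℝ := fun s => k s - 2 * deriv h s with hK
  have hKc : ContDiff ℝ 1 K := hk.sub (contDiff_const.mul hh')
  have hpg : ∀ i, ContDiff ℝ 1 (fun x => pd g i x) := fun i =>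
    (hg.fderiv_right (m := 1) (by norm_num)).clm_apply contDiff_const
  have cpg := fun i => CC.pd hg hc i
  have cppg := fun i => CC.pdpd hg hc i i
  have hcont : Continuous (fun x : EuclideanSpace ℝ (Fin N) => ‖x‖^2) := by fun_prop
  have hW : ContDiff ℝ 1 (fun x : EuclideanSpace ℝ (Fin N) => h (‖x‖^2)) := (hh.comp hns).of_le (by norm_num)
  have hV : ∀ i, ContDiff ℝ 1 (fun x : EuclideanSpace ℝ (Fin N) => x i * K (‖x‖^2)) := fun i =>
    ContDiff.mul (by fun_prop) (hKc.comp (hns.of_le (by norm_num)))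
  have dh : Differentiable ℝ h := hh.differentiable (by norm_num)
  have dK : Differentiable ℝ K := hKc.differentiable (by norm_num)
  have i1 : ∀ i, Integrable (fun x => h (‖x‖^2) * pd (pd g i) i x) := fun i =>
    ((cppg i).wmul hW.continuous).int
  have i2 : ∀ i, Integrable (fun x => (x i * k (‖x‖^2)) * pd g i x) := fun i =>
    ((cpg i).wmul (by have := hk.continuous; fun_prop)).int
  have i3 : ∀ i, Integrable (fun x => pd (fun x => h (‖x‖^2)) i x * pd g i x) := fun i =>
    ((cpg i).wmul ((hW.continuous_fderiv (by norm_num)).clm_apply continuous_const)).int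
  have i4 : ∀ i, Integrable (fun x => pd (fun x => x i * K (‖x‖^2)) i x * g x) := fun i =>
    (CC.wmul ⟨hg.continuous, hc⟩ (((hV i).continuous_fderiv (by norm_num)).clm_apply continuous_const)).int
  have s2 : ∀ i, HasCompactSupport (fun x => pd g i x) := fun i => (cpg i).2
  have key : ∀ i, ∫ x, (h (‖x‖^2) * pd (pd g i) i x + (x i * k (‖x‖^2)) * pd g i x)
      = - ∫ x, pd (fun x => x i * K (‖x‖^2)) i x * g x := by
    intro i
    have hb1 : ∫ x, h (‖x‖^2) * pd (pd g i) i x = - ∫ x, pd (fun x => h (‖x‖^2)) i x * pd g i x :=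
      ibp hW (hpg i) (s2 i) i
    rw [integral_add (i1 i) (i2 i), hb1, ← ibp (hV i) (hg.of_le (by norm_num)) hc i, neg_add_eq_sub,
      ← integral_sub (i2 i) (i3 i)]
    congr 1; funext x
    rw [pd_radial dh, hK]; ring
  have e1 : ∀ x, h (‖x‖^2) * lap g x + k (‖x‖^2) * ∑ i, x i * pd g i x
      = ∑ i, (h (‖x‖^2) * pd (pd g i) i x + (x i * k (‖x‖^2)) * pd g i x) := by
    intro x
    rw [lap, Finset.mul_sum, Finset.mul_sum, ← Finset.sum_add_distrib]
    refine Finset.sum_congr rfl fun i _ => by ring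
  simp only [e1]
  have i5 : ∀ i ∈ Finset.univ, Integrable (fun x : EuclideanSpace ℝ (Fin N) => h (‖x‖^2) * pd (pd g i) i x + (x i * k (‖x‖^2)) * pd g i x) :=
    fun i _ => (i1 i).add (i2 i)
  rw [integral_finsetSum _ i5]
  simp only [key]
  rw [Finset.sum_neg_distrib, ← integral_finsetSum _ fun i _ => i4 i, ← integral_neg]
  congr 1; funext x
  rw [← Finset.sum_mul]
  simp only [pd_coord_radial dK]
  rw [Finset.sum_add_distrib, ← Finset.sum_mul, ← Finset.mul_sum]
  have : ‖x‖^2 = ∑ i, x i ^2 := by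
    rw [EuclideanSpace.norm_sq_eq]; simp
  rw [← this]
  simp [hK]
  ring
end PE

open Real MeasureTheory Metric
open scoped ENNReal NNReal

section PE2

/-- smooth power vanishing near the origin -/
noncomputable def cutpow (k s : ℝ) : ℝ := Real.smoothTransition (2 * s - 1) * s ^ k

lemma cutpow_of_one_le {k s : ℝ} (hs : 1 ≤ s) : cutpow k s = s ^ k := by
  unfold cutpow
  rw [Real.smoothTransition.one_of_one_le (by linarith), one_mul]

lemma cutpow_zero {k s : ℝ} (hs : s ≤ 1/2) : cutpow k s = 0 := by
  unfold cutpow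
  rw [Real.smoothTransition.zero_of_nonpos (by linarith), zero_mul]

lemma cutpow_nonneg {k s : ℝ} (hs : 0 ≤ s) : 0 ≤ cutpow k s :=
  mul_nonneg (Real.smoothTransition.nonneg _) (by positivity)

lemma cutpow_le {k s : ℝ} (hs : 0 ≤ s) : cutpow k s ≤ s ^ k :=
  mul_le_of_le_one_left (by positivity) (Real.smoothTransition.le_one _)

lemma cutpow_add {k l s : ℝ} (hs : 0 ≤ s) : cutpow (k + l) s = cutpow k s * s ^ l := by
  rcases hs.eq_or_lt with h | h
  · rw [← h, cutpow_zero (by norm_num), cutpow_zero (by norm_num), zero_mul]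
  · unfold cutpow; rw [Real.rpow_add h]; ring

lemma cutpow_contDiff (k : ℝ) : ContDiff ℝ 2 (cutpow k) := by
  rw [contDiff_iff_contDiffAt]
  intro s
  by_cases hs : s < 1/2
  · refine (contDiffAt_const (c := (0:ℝ))).congr_of_eventuallyEq ?_
    filter_upwards [Iio_mem_nhds hs] with t ht
    exact cutpow_zero (le_of_lt ht)
  · refine ContDiffAt.mul ?_ ?_
    · exact (Real.smoothTransition.contDiff.comp (by fun_prop : ContDiff ℝ 2 (fun s : ℝ => 2 * s - 1))).contDiffAt
    · exact Real.contDiffAt_rpow_const_of_ne (by linarith)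

lemma deriv_cutpow {k s : ℝ} (hs : 1 < s) : deriv (cutpow k) s = k * s ^ (k-1) := by
  have : cutpow k =ᶠ[nhds s] fun s => s ^ k := by
    filter_upwards [Ioi_mem_nhds hs] with t ht using cutpow_of_one_le (le_of_lt ht)
  rw [this.deriv_eq, Real.deriv_rpow_const]

lemma Hbound {γ α : ℝ} (b : ℝ) (n : ℝ) (hα : 2 < α) (hγ : 0 < γ) : ∃ C : ℝ, 0 < C ∧ ∀ s : ℝ, 0 ≤ s →
    |-(n * (b * cutpow ((γ+α)/2-1) s - 2 * deriv (fun s => cutpow (γ/2) s + cutpow ((γ+α)/2) s) s)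
      + 2 * s * deriv (fun s => b * cutpow ((γ+α)/2-1) s - 2 * deriv (fun s => cutpow (γ/2) s + cutpow ((γ+α)/2) s) s) s)|
      ≤ C * (1 + s ^ ((γ+α)/2-1)) := by
  set δ := (γ+α)/2-1 with hδ
  have hδ0 : 0 < δ := by rw [hδ]; linarith
  set h : ℝ → ℝ := fun s => cutpow (γ/2) s + cutpow ((γ+α)/2) s with hh
  set K : ℝ → ℝ := fun s => b * cutpow δ s - 2 * deriv h s with hK
  have hhc : ContDiff ℝ 2 h := (cutpow_contDiff _).add (cutpow_contDiff _)
  have hh' : ContDiff ℝ 1 (deriv h) := by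
    have := (contDiff_succ_iff_deriv (n := 1) (f := h)).1 (by rw [one_add_one_eq_two]; exact hhc)
    exact this.2.2
  have hKc : ContDiff ℝ 1 K := (contDiff_const.mul ((cutpow_contDiff _).of_le (by norm_num))).sub (contDiff_const.mul hh')
  have hKd : Continuous (deriv K) := hKc.continuous_deriv (by norm_num)
  have hcont : Continuous (fun s => -(n * K s + 2 * s * deriv K s)) := by
    have := hKc.continuous
    fun_prop
  obtain ⟨M, hM⟩ := (isCompact_Icc (a := (0:ℝ)) (b := 1)).exists_bound_of_continuousOn hcont.continuousOn
  have hd : ∀ s, 1 < s → deriv h s = γ/2 * s^(γ/2-1) + (γ+α)/2 * s^δ := by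
    intro s hs
    rw [hh]
    rw [deriv_fun_add ((cutpow_contDiff _).differentiable (by norm_num) s) ((cutpow_contDiff _).differentiable (by norm_num) s),
      deriv_cutpow hs, deriv_cutpow hs]
  have hKs : ∀ s, 1 < s → K s = -γ * s^(γ/2-1) + (b - (γ+α)) * s^δ := by
    intro s hs
    rw [hK]; simp only
    rw [hd s hs, cutpow_of_one_le hs.le]; ring
  have hKd' : ∀ s, 1 < s → s * deriv K s = -γ * (γ/2-1) * s^(γ/2-1) + (b - (γ+α)) * δ * s^δ := by
    intro s hs
    have e : K =ᶠ[nhds s] fun s => -γ * s^(γ/2-1) + (b - (γ+α)) * s^δ := by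
      filter_upwards [Ioi_mem_nhds hs] with t ht using hKs t ht
    have s0 : 0 < s := by linarith
    have d : HasDerivAt (fun s => -γ * s^(γ/2-1) + (b - (γ+α)) * s^δ)
        (-γ * ((γ/2-1) * s^(γ/2-1-1)) + (b - (γ+α)) * (δ * s^(δ-1))) s :=
      ((Real.hasDerivAt_rpow_const (Or.inl s0.ne')).const_mul _).add ((Real.hasDerivAt_rpow_const (Or.inl s0.ne')).const_mul _)
    rw [e.deriv_eq, d.deriv, Real.rpow_sub_one s0.ne' (γ/2-1), Real.rpow_sub_one s0.ne' δ]
    field_simp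
  set A := -(n * (-γ) + 2 * (-γ * (γ/2-1))) with hA
  set B := -(n * (b - (γ+α)) + 2 * ((b - (γ+α)) * δ)) with hB
  refine ⟨|M| + |A| + |B| + 1, by positivity, fun s hs => ?_⟩
  have hsd : 0 ≤ s^δ := by positivity
  change |-(n * K s + 2 * s * deriv K s)| ≤ _
  rcases le_or_gt s 1 with h1 | h1
  · have := hM s ⟨hs, h1⟩
    rw [Real.norm_eq_abs] at this
    refine this.trans ((le_abs_self M).trans ?_)
    nlinarith [abs_nonneg M, abs_nonneg A, abs_nonneg B, mul_nonneg (abs_nonneg M) hsd, mul_nonneg (abs_nonneg A) hsd, mul_nonneg (abs_nonneg B) hsd]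
  · have e : -(n * K s + 2 * s * deriv K s) = A * s^(γ/2-1) + B * s^δ := by
      have := hKd' s h1
      rw [mul_assoc, this, hKs s h1, hA, hB]; ring
    rw [e]
    have hle : s^(γ/2-1) ≤ s^δ := Real.rpow_le_rpow_of_exponent_le h1.le (by rw [hδ]; linarith)
    have h0 : 0 ≤ s^(γ/2-1) := by positivity
    refine (abs_add_le _ _).trans ?_
    rw [abs_mul, abs_mul, abs_of_nonneg h0, abs_of_nonneg hsd]
    nlinarith [abs_nonneg M, abs_nonneg A, abs_nonneg B, mul_nonneg (abs_nonneg M) hsd, mul_nonneg (abs_nonneg A) hsd, mul_nonneg (abs_nonneg B) hsd, mul_le_mul_of_nonneg_left hle (abs_nonneg A)]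

/-- regularised power -/
noncomputable def phi (q κ t : ℝ) : ℝ := (t^2 + κ)^q - κ^q

lemma phi_zero (q κ : ℝ) : phi q κ 0 = 0 := by simp [phi]

lemma phi_contDiff (q : ℝ) {κ : ℝ} (hκ : 0 < κ) : ContDiff ℝ 2 (phi q κ) := by
  unfold phi
  refine ContDiff.sub (ContDiff.rpow_const_of_ne (by fun_prop) fun t => by positivity) contDiff_const

lemma phi_deriv (q : ℝ) {κ : ℝ} (hκ : 0 < κ) (t : ℝ) :
    HasDerivAt (phi q κ) (2 * q * t * (t^2 + κ)^(q-1)) t := by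
  unfold phi
  have h1 : HasDerivAt (fun t : ℝ => t^2 + κ) (2 * t) t := by
    simpa using (hasDerivAt_pow 2 t).add_const κ
  have := (h1.rpow_const (p := q) (Or.inl (by positivity))).sub_const (κ^q)
  exact this.congr_deriv (by ring)

lemma phi_deriv2 {q : ℝ} (hq : 1/2 < q) {κ : ℝ} (hκ : 0 < κ) (t : ℝ) :
    ∃ d, 0 ≤ d ∧ HasDerivAt (fun t : ℝ => 2 * q * t * (t^2 + κ)^(q-1)) d t := by
  have h1 : HasDerivAt (fun t : ℝ => t^2 + κ) (2 * t) t := by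
    simpa using (hasDerivAt_pow 2 t).add_const κ
  have h2 := h1.rpow_const (p := q-1) (Or.inl (by positivity))
  have h3 : HasDerivAt (fun t : ℝ => 2 * q * t) (2 * q) t := by
    simpa using (hasDerivAt_id t).const_mul (2*q)
  refine ⟨_, ?_, h3.mul h2⟩
  have hy : 0 < t^2 + κ := by positivity
  have e : (t^2 + κ)^(q-1) = (t^2 + κ)^(q-1-1) * (t^2 + κ) := by
    rw [← Real.rpow_add_one hy.ne']; congr 1; ring
  rw [e]
  have : 2 * q * ((t^2 + κ)^(q-1-1) * (t^2 + κ)) + 2 * q * t * (2 * t * (q-1) * (t^2 + κ)^(q-1-1))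
    = 2 * q * (t^2 + κ)^(q-1-1) * (κ + (2 * q - 1) * t^2) := by ring
  rw [this]
  have : 0 ≤ 2 * q - 1 := by linarith
  have : 0 ≤ q := by linarith
  positivity

lemma phi_nonneg {q : ℝ} (hq : 0 ≤ q) {κ : ℝ} (hκ : 0 ≤ κ) (t : ℝ) : 0 ≤ phi q κ t := by
  unfold phi
  have : κ^q ≤ (t^2+κ)^q := Real.rpow_le_rpow hκ (by nlinarith [sq_nonneg t]) hq
  linarith

lemma phi_le {q : ℝ} (hq : 1/2 < q) {κ : ℝ} (hκ : 0 < κ) (t : ℝ) :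
    phi q κ t ≤ (2 * q * t * (t^2 + κ)^(q-1)) * t := by
  unfold phi
  have hy : 0 < t^2 + κ := by positivity
  have hy1 : 0 < (t^2+κ)^(q-1) := by positivity
  have ey : (t^2+κ)^q = (t^2+κ)^(q-1) * (t^2+κ) := by
    rw [← Real.rpow_add_one hy.ne']; congr 1; ring
  rcases le_or_gt q 1 with h | h
  · have h1 : (t^2+κ)^(q-1) ≤ κ^(q-1) :=
      Real.rpow_le_rpow_of_nonpos hκ (by nlinarith [sq_nonneg t]) (by linarith)
    have ek : κ^q = κ^(q-1) * κ := by
      rw [← Real.rpow_add_one hκ.ne']; congr 1; ring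
    rw [ey, ek]
    have h2 := mul_le_mul_of_nonneg_right h1 hκ.le
    have h3 : 0 ≤ (2 * q - 1) * ((t^2+κ)^(q-1) * t^2) := by
      have : 0 ≤ 2 * q - 1 := by linarith
      positivity
    nlinarith
  · have hb := one_add_mul_self_le_rpow_one_add (s := (κ - (t^2+κ))/(t^2+κ)) (by
      rw [le_div_iff₀ hy]; linarith) h.le
    have e1 : 1 + (κ - (t^2+κ))/(t^2+κ) = κ / (t^2+κ) := by field_simp; ring
    rw [e1, Real.div_rpow hκ.le hy.le, le_div_iff₀ (by positivity)] at hb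
    have e2 : (1 + q * ((κ - (t^2+κ))/(t^2+κ))) * (t^2+κ)^q = (t^2+κ)^q - q * t^2 * (t^2+κ)^(q-1) := by
      rw [ey]; field_simp; ring
    rw [e2] at hb
    have h3 : 0 ≤ q * ((t^2+κ)^(q-1) * t^2) := by positivity
    nlinarith

lemma phi_deriv_le {q : ℝ} (hq : 1/2 < q) {κ : ℝ} (hκ : 0 < κ) (t : ℝ) :
    |2 * q * t * (t^2 + κ)^(q-1)| ≤ 2 * q * (t^2 + κ)^(q-1/2) := by
  have hy : 0 < t^2 + κ := by positivity
  have e : (t^2 + κ)^(q-1/2) = (t^2+κ)^(1/2:ℝ) * (t^2+κ)^(q-1) := by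
    rw [← Real.rpow_add hy]; congr 1; ring
  have h1 : |t| ≤ (t^2+κ)^(1/2:ℝ) := by
    rw [← Real.sqrt_eq_rpow]; apply Real.le_sqrt_of_sq_le; rw [sq_abs]; linarith
  have hq0 : 0 < q := by linarith
  rw [e, abs_mul, abs_mul, abs_of_nonneg (by positivity : 0 ≤ 2 * q), abs_of_nonneg (by positivity : 0 ≤ (t^2+κ)^(q-1)), mul_assoc]
  gcongr
end PE2

open Real MeasureTheory Metric
open scoped ENNReal NNReal

section PE3
variable {N : ℕ}

lemma ncont {E : Type*} [SeminormedAddCommGroup E] {γ : ℝ} (hγ : 0 < γ) : Continuous (fun x : E => ‖x‖^γ) :=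
  continuous_norm.rpow_const (fun _ => Or.inr hγ.le)

lemma CC.opA {u : EuclideanSpace ℝ (Fin N) → ℝ} (hu : ContDiff ℝ 2 u) (hc : HasCompactSupport u)
    {α β : ℝ} (b c : ℝ) (hα : 2 < α) (hβ : 0 < β) : CC (fun x => opA α β b c u x) := by
  have huc : CC u := ⟨hu.continuous, hc⟩
  have h1 : CC (fun x => (1 + ‖x‖^α) * _root_.lap u x) :=
    (CC.lap hu hc).wmul (continuous_const.add (ncont (by linarith)))
  have h2 : CC (fun x : EuclideanSpace ℝ (Fin N) => (b * ‖x‖^(α-2)) * ∑ i, x i * _root_.pd u i x) :=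
    CC.wmul (CC.sum Finset.univ fun i => (CC.pd hu hc i).wmul (g := fun x => x i) (by fun_prop)) (continuous_const.mul (ncont (by linarith)))
  have h3 : CC (fun x => (c * ‖x‖^β) * u x) := huc.wmul (continuous_const.mul (ncont hβ))
  exact (h1.add h2).sub h3

lemma pd_comp {Φ Φ' : ℝ → ℝ} (hΦ : ∀ t, HasDerivAt Φ (Φ' t) t) {u : EuclideanSpace ℝ (Fin N) → ℝ}
    (hu : Differentiable ℝ u) (i : Fin N) (x : EuclideanSpace ℝ (Fin N)) :
    pd (fun x => Φ (u x)) i x = Φ' (u x) * pd u i x := by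
  unfold pd
  have h : HasFDerivAt (fun x => Φ (u x)) _ x := (hΦ (u x)).comp_hasFDerivAt x (hu x).hasFDerivAt
  rw [h.fderiv]; simp

lemma pd_mul {f g : EuclideanSpace ℝ (Fin N) → ℝ}
    (hf : Differentiable ℝ f) (hg : Differentiable ℝ g) (i : Fin N) (x : EuclideanSpace ℝ (Fin N)) :
    pd (fun x => f x * g x) i x = f x * pd g i x + g x * pd f i x := by
  unfold pd
  have h : HasFDerivAt (fun x => f x * g x) _ x := (hf x).hasFDerivAt.mul (hg x).hasFDerivAt
  rw [h.fderiv]; simp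

lemma lap_comp_ge {Φ Φ' : ℝ → ℝ} (hΦ : ∀ t, HasDerivAt Φ (Φ' t) t)
    (hΦ' : ∀ t, ∃ d, 0 ≤ d ∧ HasDerivAt Φ' d t) {u : EuclideanSpace ℝ (Fin N) → ℝ}
    (hu : ContDiff ℝ 2 u) (x : EuclideanSpace ℝ (Fin N)) :
    Φ' (u x) * lap u x ≤ lap (fun x => Φ (u x)) x := by
  unfold lap
  rw [Finset.mul_sum]
  refine Finset.sum_le_sum fun i _ => ?_
  choose d hd0 hd using hΦ'
  have du : Differentiable ℝ u := hu.differentiable (by norm_num)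
  have e : pd (fun x => Φ (u x)) i = fun x => Φ' (u x) * pd u i x := by
    funext y; exact pd_comp hΦ du i y
  have hpu : ContDiff ℝ 1 (fun x => pd u i x) :=
    (hu.fderiv_right (m := 1) (by norm_num)).clm_apply contDiff_const
  have dΦ' : Differentiable ℝ Φ' := fun t => (hd t).differentiableAt
  rw [e, pd_mul (f := fun x => Φ' (u x)) (dΦ'.comp du) (hpu.differentiable (by norm_num)), pd_comp hd du]
  have : 0 ≤ pd u i x * (d (u x) * pd u i x) := by
    have := mul_nonneg (hd0 (u x)) (mul_self_nonneg (pd u i x))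
    linarith
  change Φ' (u x) * pd (fun x => pd u i x) i x ≤ _
  linarith

lemma kappa_ineq {α β : ℝ} (b c : ℝ) (hα : 2 < α) (hβ : 0 < β) (hc0 : 0 < c) {P : ℝ} (hP : 1 < P) :
    ∃ C : ℝ, 0 < C ∧ ∀ u : EuclideanSpace ℝ (Fin N) → ℝ, ContDiff ℝ 2 u → HasCompactSupport u →
    ∀ κ : ℝ, 0 < κ →
      c * ∫ x, cutpow (β*(P-1)/2) (‖x‖^2) * ‖x‖^β * phi (P/2) κ (u x)
       ≤ (∫ x, cutpow (β*(P-1)/2) (‖x‖^2) * (P * ((u x)^2 + κ)^(P/2-1/2)) * |opA α β b c u x|)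
        + C * ∫ x, (1 + (‖x‖^2)^((β*(P-1)+α)/2-1)) * phi (P/2) κ (u x) := by
  set γ := β*(P-1) with hγ
  have hγ0 : 0 < γ := mul_pos hβ (by linarith)
  obtain ⟨C, hC0, hC⟩ := Hbound b (N:ℝ) hα hγ0
  refine ⟨C, hC0, fun u hu hc κ hκ => ?_⟩
  set q := P/2 with hq
  have hq2 : 1/2 < q := by rw [hq]; linarith
  set g : EuclideanSpace ℝ (Fin N) → ℝ := fun x => phi q κ (u x) with hg
  have hgC : ContDiff ℝ 2 g := (phi_contDiff q hκ).comp hu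
  have hgc : HasCompactSupport g := hc.comp_left (g := phi q κ) (phi_zero q κ)
  have hgg : CC g := ⟨hgC.continuous, hgc⟩
  have hop := CC.opA hu hc b c hα hβ
  have hw : Continuous (fun x : EuclideanSpace ℝ (Fin N) => cutpow (γ/2) (‖x‖^2)) :=
    (cutpow_contDiff _).continuous.comp (by fun_prop)
  have huq : Continuous (fun x => (P * ((u x)^2 + κ)^(q-1/2))) := by
    refine continuous_const.mul (Continuous.rpow_const ?_ fun x => Or.inr (by linarith))
    have := hu.continuous
    fun_prop
  have hδ0 : 0 < (γ+α)/2-1 := by linarith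
  have hsd : Continuous (fun x : EuclideanSpace ℝ (Fin N) => 1 + (‖x‖^2)^((γ+α)/2-1)) :=
    continuous_const.add (Continuous.rpow_const (by fun_prop) fun x => Or.inr hδ0.le)
  have I1 : Integrable (fun x => cutpow (γ/2) (‖x‖^2) * ‖x‖^β * phi q κ (u x)) :=
    (hgg.wmul (hw.mul (ncont hβ))).int
  have I2 : Integrable (fun x => cutpow (γ/2) (‖x‖^2) * (P * ((u x)^2 + κ)^(q-1/2)) * |opA α β b c u x|) :=
    (hop.abs'.wmul (hw.mul huq)).int
  have I3 : Integrable (fun x => (1 + (‖x‖^2)^((γ+α)/2-1)) * phi q κ (u x)) := (hgg.wmul hsd).int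
  have hh : ContDiff ℝ 2 (fun s => cutpow (γ/2) s + cutpow ((γ+α)/2) s) := (cutpow_contDiff _).add (cutpow_contDiff _)
  have hk : ContDiff ℝ 1 (fun s => b * cutpow ((γ+α)/2-1) s) :=
    contDiff_const.mul ((cutpow_contDiff _).of_le (by norm_num))
  have key := ibp_radial hh hk hgC hgc
  have hpg := fun i => CC.pd hgC hgc i
  have I4 : Integrable (fun x : EuclideanSpace ℝ (Fin N) => (cutpow (γ/2) (‖x‖^2) + cutpow ((γ+α)/2) (‖x‖^2)) * lap g x
      + (b * cutpow ((γ+α)/2-1) (‖x‖^2)) * ∑ i, x i * pd g i x) := by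
    refine Integrable.add ?_ ?_
    · exact ((CC.lap hgC hgc).wmul (hh.continuous.comp (by fun_prop : Continuous fun x : EuclideanSpace ℝ (Fin N) => ‖x‖^2))).int
    · exact (CC.wmul (CC.sum Finset.univ fun i => (CC.pd hgC hgc i).wmul (g := fun x => x i) (by fun_prop))
        (hk.continuous.comp (by fun_prop : Continuous fun x : EuclideanSpace ℝ (Fin N) => ‖x‖^2))).int
  -- lower bound
  have low : (∫ x, (c * (cutpow (γ/2) (‖x‖^2) * ‖x‖^β * phi q κ (u x))
      - cutpow (γ/2) (‖x‖^2) * (P * ((u x)^2 + κ)^(q-1/2)) * |opA α β b c u x|))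
      ≤ ∫ x : EuclideanSpace ℝ (Fin N), ((cutpow (γ/2) (‖x‖^2) + cutpow ((γ+α)/2) (‖x‖^2)) * lap g x
      + (b * cutpow ((γ+α)/2-1) (‖x‖^2)) * ∑ i, x i * pd g i x) := by
    refine integral_mono ((I1.const_mul c).sub I2) I4 fun x => ?_
    simp only
    have hs : 0 ≤ ‖x‖^2 := by positivity
    have hx2 : ∀ k : ℝ, (‖x‖^2)^k = ‖x‖^(2*k) := by
      intro k; rw [Real.rpow_mul (norm_nonneg _)]; norm_num
    have e1 : cutpow ((γ+α)/2) (‖x‖^2) = cutpow (γ/2) (‖x‖^2) * ‖x‖^α := by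
      rw [show (γ+α)/2 = γ/2 + α/2 by ring, cutpow_add hs, hx2]; congr 2; ring
    have e2 : cutpow ((γ+α)/2-1) (‖x‖^2) = cutpow (γ/2) (‖x‖^2) * ‖x‖^(α-2) := by
      rw [show (γ+α)/2-1 = γ/2 + (α/2-1) by ring, cutpow_add hs, hx2]; congr 2; ring
    set W := cutpow (γ/2) (‖x‖^2) with hW
    have hW0 : 0 ≤ W := cutpow_nonneg hs
    rw [e1, e2]
    have du : Differentiable ℝ u := hu.differentiable (by norm_num)
    have l1 := lap_comp_ge (phi_deriv q hκ) (phi_deriv2 hq2 hκ) hu x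
    have l2 : ∀ i, pd g i x = (2 * q * u x * ((u x)^2 + κ)^(q-1)) * pd u i x := fun i => pd_comp (phi_deriv q hκ) du i x
    have l3 := phi_le hq2 hκ (u x)
    have l4 := phi_deriv_le hq2 hκ (u x)
    set D := 2 * q * u x * ((u x)^2 + κ)^(q-1) with hD
    have e3 : ∑ i, x i * pd g i x = D * ∑ i, x i * pd u i x := by
      rw [Finset.mul_sum]; refine Finset.sum_congr rfl fun i _ => ?_
      rw [l2 i]; ring
    rw [e3]
    have hP2 : 2 * q = P := by rw [hq]; ring
    rw [hP2] at l4
    have hopx : opA α β b c u x = (1 + ‖x‖^α) * lap u x + b * ‖x‖^(α-2) * (∑ i, x i * pd u i x) - c * ‖x‖^β * u x := rfl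
    set f := opA α β b c u x with hf
    have m1 : W * (1 + ‖x‖^α) * (D * lap u x) ≤ W * (1 + ‖x‖^α) * lap g x :=
      mul_le_mul_of_nonneg_left l1 (by positivity)
    have m2 : -(P * ((u x)^2 + κ)^(q-1/2) * |f|) ≤ D * f := by
      have : |D * f| ≤ P * ((u x)^2 + κ)^(q-1/2) * |f| := by
        rw [abs_mul]; gcongr
      linarith [neg_abs_le (D * f)]
    have m3 := mul_le_mul_of_nonneg_left m2 hW0
    have m4 : c * (W * ‖x‖^β * phi q κ (u x)) ≤ c * (W * ‖x‖^β * (D * u x)) := by gcongr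
    have m5 : (W * (1 + ‖x‖^α)) * (D * lap u x) + b * (W * ‖x‖^(α-2)) * (D * ∑ i, x i * pd u i x)
      = W * (D * f) + c * (W * ‖x‖^β * (D * u x)) := by
      rw [hopx]; ring
    nlinarith
  have up : ∫ x : EuclideanSpace ℝ (Fin N), ((cutpow (γ/2) (‖x‖^2) + cutpow ((γ+α)/2) (‖x‖^2)) * lap g x
      + (b * cutpow ((γ+α)/2-1) (‖x‖^2)) * ∑ i, x i * pd g i x) ≤ C * ∫ x, (1 + (‖x‖^2)^((γ+α)/2-1)) * phi q κ (u x) := by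
    rw [key, ← integral_const_mul]
    refine (le_abs_self _).trans ?_
    rw [← Real.norm_eq_abs]
    refine norm_integral_le_of_norm_le (I3.const_mul C) (Filter.Eventually.of_forall fun x => ?_)
    have h := hC (‖x‖^2) (by positivity)
    have h0 : 0 ≤ phi q κ (u x) := phi_nonneg (by linarith) hκ.le _
    rw [Real.norm_eq_abs, abs_mul, abs_of_nonneg h0, ← mul_assoc]
    exact mul_le_mul_of_nonneg_right h h0
  rw [integral_sub (I1.const_mul c) I2, integral_const_mul] at low
  linarith

end PE3

open Real MeasureTheory Metric
open scoped ENNReal NNReal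

section PE4
variable {N : ℕ}

lemma param_cont {u : EuclideanSpace ℝ (Fin N) → ℝ} (hc : HasCompactSupport u)
    (F : ℝ → EuclideanSpace ℝ (Fin N) → ℝ) (hF : Continuous (Function.uncurry F))
    (h0 : ∀ κ x, x ∉ tsupport u → F κ x = 0) : Continuous (fun κ => ∫ x, F κ x) := by
  have e : ∀ κ, ∫ x, F κ x = ∫ x in tsupport u, F κ x := fun κ =>
    (setIntegral_eq_integral_of_forall_compl_eq_zero (h0 κ)).symm
  simp only [e]
  exact continuous_parametric_integral_of_continuous hF hc

lemma zero_ineq {α β : ℝ} (b c : ℝ) (hα : 2 < α) (hβ : 0 < β) (hc0 : 0 < c) {P : ℝ} (hP : 1 < P) :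
    ∃ C : ℝ, 0 < C ∧ ∀ u : EuclideanSpace ℝ (Fin N) → ℝ, ContDiff ℝ 2 u → HasCompactSupport u →
      c * ∫ x, cutpow (β*(P-1)/2) (‖x‖^2) * ‖x‖^β * |u x|^P
       ≤ (∫ x, cutpow (β*(P-1)/2) (‖x‖^2) * (P * |u x|^(P-1)) * |opA α β b c u x|)
        + C * ∫ x, (1 + (‖x‖^2)^((β*(P-1)+α)/2-1)) * |u x|^P := by
  obtain ⟨C, hC0, hC⟩ := kappa_ineq (N := N) b c hα hβ hc0 hP
  refine ⟨C, hC0, fun u hu hc => ?_⟩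
  have hop := CC.opA hu hc b c hα hβ
  have hw : Continuous (fun x : EuclideanSpace ℝ (Fin N) => cutpow (β*(P-1)/2) (‖x‖^2)) :=
    (cutpow_contDiff _).continuous.comp (by fun_prop)
  have hδ0 : 0 < (β*(P-1)+α)/2-1 := by
    have : 0 < β*(P-1) := mul_pos hβ (by linarith)
    linarith
  have hsd : Continuous (fun x : EuclideanSpace ℝ (Fin N) => 1 + (‖x‖^2)^((β*(P-1)+α)/2-1)) :=
    continuous_const.add (Continuous.rpow_const (by fun_prop) fun x => Or.inr hδ0.le)
  have huc := hu.continuous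
  have hpw : ∀ r : ℝ, 0 ≤ r → Continuous (fun z : ℝ × EuclideanSpace ℝ (Fin N) => ((u z.2)^2 + z.1)^r) :=
    fun r hr => Continuous.rpow_const (by fun_prop) fun x => Or.inr hr
  have hphi : Continuous (fun z : ℝ × EuclideanSpace ℝ (Fin N) => phi (P/2) z.1 (u z.2)) :=
    (hpw (P/2) (by linarith)).sub (Continuous.rpow_const (by fun_prop) fun x => Or.inr (by linarith))
  have hu0 : ∀ x, x ∉ tsupport u → u x = 0 := fun x hx => image_eq_zero_of_notMem_tsupport hx
  have hpd0 : ∀ x, x ∉ tsupport u → ∀ i, pd u i x = 0 := by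
    intro x hx i
    have : fderiv ℝ u x = 0 := by
      by_contra h
      exact hx (support_fderiv_subset ℝ h)
    simp [pd, this]
  have hppd0 : ∀ x, x ∉ tsupport u → ∀ i, pd (pd u i) i x = 0 := by
    intro x hx i
    have : fderiv ℝ (pd u i) x = 0 := by
      by_contra h
      have h1 := support_fderiv_subset ℝ h
      refine hx (closure_minimal ?_ (isClosed_tsupport u) h1)
      intro y hy
      by_contra h2
      exact hy (hpd0 y h2 i)
    rw [pd, this]; simp
  have hop0 : ∀ x, x ∉ tsupport u → opA α β b c u x = 0 := by
    intro x hx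
    simp [opA, lap, hu0 x hx, hpd0 x hx, hppd0 x hx]
  have c1 := param_cont hc (fun κ x => cutpow (β*(P-1)/2) (‖x‖^2) * ‖x‖^β * phi (P/2) κ (u x))
    ((hw.mul (ncont hβ)).snd'.mul hphi) (fun κ x hx => by simp [hu0 x hx, phi_zero])
  have c2 := param_cont hc (fun κ x => cutpow (β*(P-1)/2) (‖x‖^2) * (P * ((u x)^2 + κ)^(P/2-1/2)) * |opA α β b c u x|)
    (by
      have h1 := hpw (P/2-1/2) (by linarith)
      have h2 : Continuous fun z : ℝ × EuclideanSpace ℝ (Fin N) => cutpow (β*(P-1)/2) (‖z.2‖^2) := hw.snd'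
      have h3 : Continuous fun z : ℝ × EuclideanSpace ℝ (Fin N) => |opA α β b c u z.2| := hop.1.abs.snd'
      change Continuous fun z : ℝ × EuclideanSpace ℝ (Fin N) => cutpow (β*(P-1)/2) (‖z.2‖^2) * (P * ((u z.2)^2 + z.1)^(P/2-1/2)) * |opA α β b c u z.2|
      exact (h2.mul (continuous_const.mul h1)).mul h3)
    (fun κ x hx => by simp [hop0 x hx])
  have c3 := param_cont hc (fun κ x => (1 + (‖x‖^2)^((β*(P-1)+α)/2-1)) * phi (P/2) κ (u x))
    (by
      have h2 : Continuous fun z : ℝ × EuclideanSpace ℝ (Fin N) => (1 + (‖z.2‖^2)^((β*(P-1)+α)/2-1)) := hsd.snd'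
      change Continuous fun z : ℝ × EuclideanSpace ℝ (Fin N) => (1 + (‖z.2‖^2)^((β*(P-1)+α)/2-1)) * phi (P/2) z.1 (u z.2)
      exact h2.mul hphi) (fun κ x hx => by simp [hu0 x hx, phi_zero])
  have lim := le_of_tendsto_of_tendsto
    ((continuous_const (y := c)).mul c1).continuousWithinAt.tendsto
    (c2.add ((continuous_const (y := C)).mul c3)).continuousWithinAt.tendsto
    (b := nhdsWithin (0:ℝ) (Set.Ioi 0))
    (by filter_upwards [self_mem_nhdsWithin] with κ hκ using hC u hu hc κ hκ)
  have e1 : ∀ x, phi (P/2) 0 (u x) = |u x|^P := by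
    intro x
    unfold phi
    rw [add_zero, Real.zero_rpow (by linarith), sub_zero, ← sq_abs, ← Real.rpow_natCast, ← Real.rpow_mul (abs_nonneg _)]
    congr 1; push_cast; ring
  have e2 : ∀ x, ((u x)^2 + 0)^(P/2-1/2) = |u x|^(P-1) := by
    intro x
    rw [add_zero, ← sq_abs, ← Real.rpow_natCast, ← Real.rpow_mul (abs_nonneg _)]
    congr 1; push_cast; ring
  simpa only [e1, e2, Pi.mul_apply, Pi.add_apply] using lim

lemma young_simple {P : ℝ} (hP : 1 < P) {ε A B : ℝ} (hε : 0 < ε) (hA : 0 ≤ A) (hB : 0 ≤ B) :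
    A^(P-1) * B ≤ ε * A^P + ε^(1-P) * B^P := by
  have hmul : ∀ X : ℝ, 0 ≤ X → X^(P-1) * X = X^P := by
    intro X hX
    rw [← Real.rpow_add_one' hX (by linarith)]; congr 1; ring
  rcases le_or_gt B (ε * A) with h | h
  · have h1 : A^(P-1) * B ≤ A^(P-1) * (ε * A) := by gcongr
    have h2 : A^(P-1) * (ε * A) = ε * A^P := by rw [← hmul A hA]; ring
    have : 0 ≤ ε^(1-P) * B^P := by positivity
    linarith
  · have h1 : A ≤ B / ε := by rw [le_div_iff₀ hε]; linarith
    have h2 : A^(P-1) * B ≤ (B/ε)^(P-1) * B := by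
      gcongr
    have h3 : (B/ε)^(P-1) * B = ε^(1-P) * B^P := by
      rw [Real.div_rpow hB hε.le, ← hmul B hB, show 1 - P = -(P-1) by ring, Real.rpow_neg hε.le]
      field_simp
    have : 0 ≤ ε * A^P := by positivity
    linarith

lemma small_pow {d e : ℝ} (hd : 0 < d) (hde : d < e) {ε : ℝ} (hε : 0 < ε) :
    ∃ C : ℝ, 0 ≤ C ∧ ∀ s : ℝ, 0 ≤ s → s^d ≤ ε * s^e + C := by
  set R : ℝ := ε^(-(1/(e-d))) with hR
  have hR0 : 0 < R := by positivity
  refine ⟨R^d, by positivity, fun s hs => ?_⟩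
  rcases le_or_gt s R with h | h
  · have : s^d ≤ R^d := Real.rpow_le_rpow hs h hd.le
    have : 0 ≤ ε * s^e := by positivity
    linarith
  · have hs0 : 0 < s := hR0.trans h
    have h1 : R^(e-d) = ε⁻¹ := by
      rw [hR, ← Real.rpow_mul hε.le, ← Real.rpow_neg_one]
      congr 1
      have : e - d ≠ 0 := by linarith
      field_simp
    have h2 : R^(e-d) ≤ s^(e-d) := Real.rpow_le_rpow hR0.le h.le (by linarith)
    rw [h1] at h2
    have h3 : 1 ≤ ε * s^(e-d) := by
      have := mul_le_mul_of_nonneg_left h2 hε.le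
      rwa [mul_inv_cancel₀ hε.ne'] at this
    have h4 : s^e = s^(e-d) * s^d := by rw [← Real.rpow_add hs0]; congr 1; ring
    have h5 : 0 ≤ s^d := by positivity
    have : 0 ≤ R^d := by positivity
    rw [h4]; nlinarith

set_option maxHeartbeats 1000000 in
lemma potential {α β : ℝ} (b c : ℝ) (hα : 2 < α) (hβ : α - 2 < β) (hc0 : 0 < c) {P : ℝ} (hP : 1 < P) :
    ∃ C : ℝ, 0 < C ∧ ∀ u : EuclideanSpace ℝ (Fin N) → ℝ, ContDiff ℝ 2 u → HasCompactSupport u →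
      nL P (fun x => ‖x‖^β * u x) ≤ C * (nL P (fun x => opA α β b c u x) + nL P u) := by
  have hβ0 : 0 < β := by linarith
  have hP0 : 0 < P := by linarith
  obtain ⟨C, hC0, hC⟩ := zero_ineq (N := N) b c hα hβ0 hc0 hP
  have hγ0 : 0 < β*(P-1) := mul_pos hβ0 (by linarith)
  obtain ⟨C', hC'0, hC'⟩ := small_pow (d := (β*(P-1)+α)/2-1) (e := β*P/2) (by linarith) (by linarith)
    (ε := c/(4*C)) (by positivity)
  set ε : ℝ := c/(4*P) with hε
  have hε0 : 0 < ε := by positivity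
  set C1 : ℝ := P * ε^(1-P) with hC1
  have hC10 : 0 < C1 := by positivity
  set C2 : ℝ := c + C * (1 + C') with hC2
  have hC20 : 0 < C2 := by positivity
  set C3 : ℝ := 2/c * (C1 + C2) with hC3
  have hC30 : 0 < C3 := by positivity
  refine ⟨(2 * C3)^(1/P), by positivity, fun u hu hc => ?_⟩
  have huc : CC u := ⟨hu.continuous, hc⟩
  have hop := CC.opA hu hc b c hα hβ0
  have hv := huc.wmul (ncont (E := EuclideanSpace ℝ (Fin N)) hβ0)
  have hw : Continuous (fun x : EuclideanSpace ℝ (Fin N) => cutpow (β*(P-1)/2) (‖x‖^2)) :=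
    (cutpow_contDiff _).continuous.comp (by fun_prop)
  have hsd : Continuous (fun x : EuclideanSpace ℝ (Fin N) => 1 + (‖x‖^2)^((β*(P-1)+α)/2-1)) :=
    continuous_const.add (Continuous.rpow_const (by fun_prop) fun x => Or.inr (by linarith))
  have hup := huc.absrpow hP0
  have hvp := hv.absrpow hP0
  have hfp := hop.absrpow hP0
  have h := hC u hu hc
  set U := ∫ x, |u x|^P with hU
  set M := ∫ x, |‖x‖^β * u x|^P with hM
  set F := ∫ x, |opA α β b c u x|^P with hF
  have hx2 : ∀ (x : EuclideanSpace ℝ (Fin N)) (k : ℝ), (‖x‖^2)^k = ‖x‖^(2*k) := by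
    intro x k; rw [Real.rpow_mul (norm_nonneg _)]; norm_num
  have hMx : ∀ x, |‖x‖^β * u x|^P = ‖x‖^(β*P) * |u x|^P := by
    intro x
    rw [abs_mul, abs_of_nonneg (by positivity : 0 ≤ ‖x‖^β), Real.mul_rpow (by positivity) (abs_nonneg _),
      ← Real.rpow_mul (norm_nonneg _)]
  have s1 : M - U ≤ ∫ x, cutpow (β*(P-1)/2) (‖x‖^2) * ‖x‖^β * |u x|^P := by
    rw [hM, hU, ← integral_sub hvp.int hup.int]
    refine integral_mono (hvp.sub hup).int (hup.wmul (hw.mul (ncont hβ0))).int fun x => ?_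
    simp only
    rw [hMx]
    have h0 : 0 ≤ |u x|^P := by positivity
    have hs : 0 ≤ ‖x‖^2 := by positivity
    have : ‖x‖^(β*P) - 1 ≤ cutpow (β*(P-1)/2) (‖x‖^2) * ‖x‖^β := by
      rcases le_or_gt 1 ‖x‖ with hx | hx
      · rw [cutpow_of_one_le (by nlinarith), hx2, ← Real.rpow_add (by linarith)]
        rw [show 2 * (β*(P-1)/2) + β = β*P by ring]; linarith
      · have a1 : ‖x‖^(β*P) ≤ 1 := Real.rpow_le_one (norm_nonneg _) hx.le (by positivity)
        have a2 : 0 ≤ cutpow (β*(P-1)/2) (‖x‖^2) * ‖x‖^β := mul_nonneg (cutpow_nonneg hs) (by positivity)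
        linarith
    nlinarith
  have s2 : ∫ x, cutpow (β*(P-1)/2) (‖x‖^2) * (P * |u x|^(P-1)) * |opA α β b c u x| ≤ P * ε * M + C1 * F := by
    rw [hM, hF, ← integral_const_mul, ← integral_const_mul, ← integral_add (hvp.int.const_mul _) (hfp.int.const_mul _)]
    have hcu : Continuous (fun x => P * |u x|^(P-1)) :=
      continuous_const.mul (huc.1.abs.rpow_const fun x => Or.inr (by linarith))
    refine integral_mono (hop.abs'.wmul (hw.mul hcu)).int ((hvp.int.const_mul _).add (hfp.int.const_mul _)) fun x => ?_
    simp only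
    have hy := young_simple hP hε0 (abs_nonneg (‖x‖^β * u x)) (abs_nonneg (opA α β b c u x))
    have a1 : cutpow (β*(P-1)/2) (‖x‖^2) ≤ (‖x‖^β)^(P-1) := by
      refine (cutpow_le (by positivity)).trans (le_of_eq ?_)
      rw [hx2, ← Real.rpow_mul (norm_nonneg _)]; congr 1; ring
    have a2 : |‖x‖^β * u x|^(P-1) = (‖x‖^β)^(P-1) * |u x|^(P-1) := by
      rw [abs_mul, abs_of_nonneg (by positivity : 0 ≤ ‖x‖^β), Real.mul_rpow (by positivity) (abs_nonneg _)]
    calc cutpow (β*(P-1)/2) (‖x‖^2) * (P * |u x|^(P-1)) * |opA α β b c u x|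
        ≤ (‖x‖^β)^(P-1) * (P * |u x|^(P-1)) * |opA α β b c u x| := by gcongr
      _ = P * (|‖x‖^β * u x|^(P-1) * |opA α β b c u x|) := by rw [a2]; ring
      _ ≤ P * (ε * |‖x‖^β * u x|^P + ε^(1-P) * |opA α β b c u x|^P) := by gcongr
      _ = _ := by rw [hC1]; ring
  have s3 : ∫ x, (1 + (‖x‖^2)^((β*(P-1)+α)/2-1)) * |u x|^P ≤ (1 + C') * U + c/(4*C) * M := by
    rw [hM, hU, ← integral_const_mul, ← integral_const_mul, ← integral_add (hup.int.const_mul _) (hvp.int.const_mul _)]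
    refine integral_mono (hup.wmul hsd).int ((hup.int.const_mul _).add (hvp.int.const_mul _)) fun x => ?_
    simp only
    rw [hMx]
    have h0 : 0 ≤ |u x|^P := by positivity
    have a := hC' (‖x‖^2) (by positivity)
    rw [hx2 x (β*P/2), show 2 * (β*P/2) = β*P by ring] at a
    nlinarith
  have hM0 : 0 ≤ M := integral_nonneg fun x => by positivity
  have hU0 : 0 ≤ U := integral_nonneg fun x => by positivity
  have hF0 : 0 ≤ F := integral_nonneg fun x => by positivity
  have hfin : M ≤ C3 * (F + U) := by
    have t1 : c * (M - U) ≤ c * ∫ x, cutpow (β*(P-1)/2) (‖x‖^2) * ‖x‖^β * |u x|^P := by gcongr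
    have t2 : C * ∫ x, (1 + (‖x‖^2)^((β*(P-1)+α)/2-1)) * |u x|^P ≤ C * ((1 + C') * U + c/(4*C) * M) := by gcongr
    have t3 : C * ((1 + C') * U + c/(4*C) * M) = C * (1 + C') * U + c/4 * M := by field_simp
    have t4 : P * ε = c/4 := by rw [hε]; field_simp
    rw [t4] at s2
    have t5 : c/2 * M ≤ C1 * F + C2 * U := by rw [hC2]; linarith
    have t6 : M ≤ 2/c * (C1 * F + C2 * U) := by
      have := mul_le_mul_of_nonneg_left t5 (by positivity : 0 ≤ 2/c)
      have e : 2/c * (c/2 * M) = M := by field_simp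
      linarith
    refine t6.trans ?_
    rw [hC3, show 2/c*(C1+C2)*(F+U) = 2/c*((C1+C2)*(F+U)) by ring]
    have t7 : C1 * F + C2 * U ≤ (C1 + C2) * (F + U) := by
      have := mul_nonneg hC10.le hU0
      have := mul_nonneg hC20.le hF0
      linarith
    exact mul_le_mul_of_nonneg_left t7 (by positivity : 0 ≤ 2/c)
  clear_value M F U C1 C2 C3
  rw [hM, hF, hU, ← nL_pow hP hv, ← nL_pow hP hop, ← nL_pow hP huc] at hfin
  have n1 := nL_nonneg P (fun x => ‖x‖^β * u x)
  have n2 := nL_nonneg P (fun x => opA α β b c u x)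
  have n3 := nL_nonneg P u
  set a1 := nL P (fun x => ‖x‖^β * u x)
  set a2 := nL P (fun x => opA α β b c u x)
  set a3 := nL P u
  rw [← Real.rpow_le_rpow_iff n1 (by positivity) hP0, Real.mul_rpow (by positivity) (by positivity),
    ← Real.rpow_mul (by positivity), one_div_mul_cancel hP0.ne', Real.rpow_one]
  have m1 : a2^P ≤ (a2+a3)^P := Real.rpow_le_rpow n2 (by linarith) hP0.le
  have m2 : a3^P ≤ (a2+a3)^P := Real.rpow_le_rpow n3 (by linarith) hP0.le
  nlinarith

end PE4

open Real MeasureTheory Metric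
open scoped ENNReal NNReal

section PF
variable {N : ℕ}

/-- smooth weight comparable to `(1+|x|)^α` -/
noncomputable def wA (α : ℝ) (x : EuclideanSpace ℝ (Fin N)) : ℝ := ((‖x‖^2)^2 + 1)^(α/4)

lemma wA_contDiff (α : ℝ) : ContDiff ℝ 2 (wA (N := N) α) := by
  unfold wA
  refine ContDiff.rpow_const_of_ne ?_ fun x => by positivity
  have hns : ContDiff ℝ 2 (fun x : EuclideanSpace ℝ (Fin N) => ‖x‖^2) := contDiff_norm_sq ℝ
  exact (hns.pow 2).add contDiff_const

lemma pd_coord (i j : Fin N) (x : EuclideanSpace ℝ (Fin N)) :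
    pd (fun x : EuclideanSpace ℝ (Fin N) => x j) i x = if j = i then 1 else 0 := by
  unfold pd
  have h1 : HasFDerivAt (fun x : EuclideanSpace ℝ (Fin N) => x j)
    (EuclideanSpace.proj j : EuclideanSpace ℝ (Fin N) →L[ℝ] ℝ) x :=
    (EuclideanSpace.proj j : EuclideanSpace ℝ (Fin N) →L[ℝ] ℝ).hasFDerivAt
  rw [h1.fderiv]
  simp [Pi.single_apply]

lemma pd_add {f g : EuclideanSpace ℝ (Fin N) → ℝ}
    (hf : Differentiable ℝ f) (hg : Differentiable ℝ g) (i : Fin N) (x : EuclideanSpace ℝ (Fin N)) :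
    pd (fun x => f x + g x) i x = pd f i x + pd g i x := by
  unfold pd
  have h : HasFDerivAt (fun x => f x + g x) _ x := (hf x).hasFDerivAt.add (hg x).hasFDerivAt
  rw [h.fderiv]; simp

lemma rho4 (x : EuclideanSpace ℝ (Fin N)) : (‖x‖^2)^2 + 1 ≤ (1 + ‖x‖)^(4:ℕ) := by
  have := norm_nonneg x
  nlinarith [pow_nonneg this 2, pow_nonneg this 3, pow_nonneg this 4]

lemma rho_pow {γ : ℝ} (hγ : 0 ≤ γ) (x : EuclideanSpace ℝ (Fin N)) :
    ((‖x‖^2)^2 + 1)^γ ≤ (1 + ‖x‖)^(4*γ) := by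
  have h := Real.rpow_le_rpow (by positivity) (rho4 x) hγ
  have e : ((1 + ‖x‖)^(4:ℕ))^γ = (1 + ‖x‖)^(4*γ) := by
    rw [Real.rpow_mul (by positivity)]; norm_num
  rwa [e] at h

lemma wA_le {α : ℝ} (hα : 0 ≤ α) (x : EuclideanSpace ℝ (Fin N)) : wA α x ≤ (1 + ‖x‖)^α := by
  have := rho_pow (γ := α/4) (by positivity) x
  rwa [show 4 * (α/4) = α by ring] at this

lemma le_wA {α : ℝ} (hα : 0 ≤ α) (x : EuclideanSpace ℝ (Fin N)) : (1 + ‖x‖)^α ≤ 8^(α/4) * wA α x := by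
  unfold wA
  rw [← Real.mul_rpow (by norm_num) (by positivity)]
  have h4 : (1 + ‖x‖)^(4:ℕ) ≤ 8 * ((‖x‖^2)^2 + 1) := by
    have h2 : (1 + ‖x‖)^2 ≤ 2 * (‖x‖^2 + 1) := by nlinarith [sq_nonneg (‖x‖ - 1)]
    have h3 : ((1 + ‖x‖)^2)^2 ≤ (2 * (‖x‖^2 + 1))^2 := by gcongr
    nlinarith [sq_nonneg (‖x‖^2 - 1)]
  have h := Real.rpow_le_rpow (by positivity) h4 (by positivity : 0 ≤ α/4)
  have e : ((1 + ‖x‖)^(4:ℕ))^(α/4) = (1 + ‖x‖)^α := by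
    rw [show α = 4 * (α/4) by ring, Real.rpow_mul (by positivity), show 4 * (α/4) / 4 = α/4 by ring]; norm_num
  rwa [e] at h

lemma pd_wA (α : ℝ) (j : Fin N) :
    pd (wA (N := N) α) j = fun x => x j * (2 * (2 * (α/4) * ‖x‖^2 * ((‖x‖^2)^2 + 1)^(α/4-1))) := by
  funext x
  have hd : ∀ s, HasDerivAt (fun s : ℝ => (s^2 + 1)^(α/4)) (2 * (α/4) * s * (s^2 + 1)^(α/4-1)) s := by
    intro s
    have := (phi_deriv (α/4) one_pos s).add_const ((1:ℝ)^(α/4))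
    simpa [phi] using this
  have := pd_radial (h := fun s : ℝ => (s^2 + 1)^(α/4)) (fun s => (hd s).differentiableAt) j x
  rw [(hd _).deriv] at this
  exact this

lemma pd_wA_le {α : ℝ} (hα : 2 < α) (j : Fin N) (x : EuclideanSpace ℝ (Fin N)) :
    |pd (wA (N := N) α) j x| ≤ α * (1 + ‖x‖)^(α-1) := by
  rw [pd_wA]
  simp only
  have h := phi_deriv_le (q := α/4) (by linarith) one_pos (‖x‖^2)
  have h2 := rho_pow (γ := α/4-1/2) (by linarith) x
  rw [show 4 * (α/4-1/2) = α - 2 by ring] at h2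
  have e : (1 + ‖x‖)^(α-1) = (1 + ‖x‖) * (1 + ‖x‖)^(α-2) := by
    rw [mul_comm, ← Real.rpow_add_one (by positivity)]; congr 1; ring
  rw [abs_mul, abs_mul, e]
  have hx : |x j| ≤ 1 + ‖x‖ := (abs_coord_le x j).trans (by linarith [norm_nonneg x])
  have h3 : |2 * (α/4) * ‖x‖^2 * ((‖x‖^2)^2 + 1)^(α/4-1)| ≤ 2 * (α/4) * (1 + ‖x‖)^(α-2) := by
    refine h.trans ?_
    gcongr
  have h4 : |x j| * (|(2:ℝ)| * |2 * (α/4) * ‖x‖^2 * ((‖x‖^2)^2 + 1)^(α/4-1)|)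
      ≤ (1 + ‖x‖) * (2 * (2 * (α/4) * (1 + ‖x‖)^(α-2))) := by
    rw [abs_two]; gcongr
  refine h4.trans (le_of_eq ?_)
  ring

lemma pdpd_wA_le {α : ℝ} (hα : 2 < α) : ∃ C : ℝ, 0 < C ∧ ∀ (i j : Fin N) (x : EuclideanSpace ℝ (Fin N)),
    |pd (pd (wA (N := N) α) j) i x| ≤ C * (1 + ‖x‖)^(α-2) := by
  set q := α/4 with hq
  have hq2 : 1/2 < q := by rw [hq]; linarith
  refine ⟨4 * q + 8 * q * (1 + 2 * |q-1|), by positivity, fun i j x => ?_⟩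
  have hd : ∀ s : ℝ, HasDerivAt (fun s : ℝ => 2 * (2 * q * s * (s^2 + 1)^(q-1)))
      (4 * q * (s^2 + 1)^(q-1) + 8 * q * (q-1) * s^2 * (s^2 + 1)^(q-1-1)) s := by
    intro s
    have h1 : HasDerivAt (fun t : ℝ => t^2 + 1) (2 * s) s := by
      simpa using (hasDerivAt_pow 2 s).add_const 1
    have h2 := h1.rpow_const (p := q-1) (Or.inl (by positivity))
    have h3 : HasDerivAt (fun t : ℝ => 2 * q * t) (2 * q) s := by
      simpa using (hasDerivAt_id s).const_mul (2*q)
    exact ((h3.mul h2).const_mul 2).congr_deriv (by ring)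
  set k : ℝ → ℝ := fun s : ℝ => 2 * (2 * q * s * (s^2 + 1)^(q-1)) with hk
  have dk : Differentiable ℝ k := fun s => (hd s).differentiableAt
  have e : pd (wA (N := N) α) j = fun x => x j * k (‖x‖^2) := pd_wA α j
  rw [e, pd_mul (f := fun x : EuclideanSpace ℝ (Fin N) => x j) (g := fun x => k (‖x‖^2)) (by fun_prop)
    (fun x => (hasFDerivAt_radial dk x).differentiableAt), pd_coord, pd_radial dk, (hd _).deriv]
  have h := phi_deriv_le (q := q) hq2 one_pos (‖x‖^2)
  have h2 := rho_pow (γ := q-1/2) (by linarith) x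
  rw [show 4 * (q-1/2) = α - 2 by rw [hq]; ring] at h2
  set s := ‖x‖^2 with hs
  have hs0 : 0 ≤ s := by positivity
  set R := (1 + ‖x‖)^(α-2) with hR
  have hR0 : 0 ≤ R := by positivity
  have hy : 0 < s^2 + 1 := by positivity
  have hkk : |k s| ≤ 4 * q * R := by
    rw [hk]; simp only
    rw [abs_mul, abs_two]
    have : 2 * q * (s^2+1)^(q-1/2) ≤ 2 * q * R := by gcongr
    linarith
  have hs1 : s ≤ (s^2+1)^(1/2:ℝ) := by
    rw [← Real.sqrt_eq_rpow]; apply Real.le_sqrt_of_sq_le; linarith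
  have hsy : s * (s^2+1)^(q-1) ≤ R := by
    have e1 : (s^2 + 1)^(q-1/2) = (s^2+1)^(1/2:ℝ) * (s^2+1)^(q-1) := by
      rw [← Real.rpow_add hy]; congr 1; ring
    rw [e1] at h2
    refine le_trans ?_ h2
    gcongr
  have hx2 : |x j| * |x i| ≤ s := by
    rw [hs, sq]
    exact mul_le_mul (abs_coord_le x j) (abs_coord_le x i) (abs_nonneg _) (norm_nonneg _)
  have e2 : (s^2+1)^(q-1) = (s^2+1)^(q-1-1) * (s^2+1) := by
    rw [← Real.rpow_add_one hy.ne']; congr 1; ring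
  have hkd : |4 * q * (s^2 + 1)^(q-1) + 8 * q * (q-1) * s^2 * (s^2 + 1)^(q-1-1)| ≤ 4 * q * (1 + 2 * |q-1|) * (s^2+1)^(q-1) := by
    refine (abs_add_le _ _).trans ?_
    have a1 : s^2 * (s^2+1)^(q-1-1) ≤ (s^2+1)^(q-1) := by
      rw [e2]
      have : 0 ≤ (s^2+1)^(q-1-1) := by positivity
      nlinarith
    have a2 : |8 * q * (q-1) * s^2 * (s^2 + 1)^(q-1-1)| = 8 * q * |q-1| * (s^2 * (s^2 + 1)^(q-1-1)) := by
      rw [abs_mul, abs_mul, abs_mul, abs_of_nonneg (by positivity : 0 ≤ 8 * q), abs_of_nonneg (sq_nonneg s),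
        abs_of_nonneg (by positivity : 0 ≤ (s^2 + 1)^(q-1-1))]; ring
    rw [a2, abs_of_nonneg (by positivity : 0 ≤ 4 * q * (s^2 + 1)^(q-1))]
    have a3 : 8 * q * |q-1| * (s^2 * (s^2 + 1)^(q-1-1)) ≤ 8 * q * |q-1| * (s^2+1)^(q-1) := by gcongr
    linarith
  refine (abs_add_le _ _).trans ?_
  have p1 : |k s * (if j = i then (1:ℝ) else 0)| ≤ 4 * q * R := by
    split_ifs
    · simpa using hkk
    · simp; positivity
  have p2 : |x j * (x i * (2 * (4 * q * (s^2 + 1)^(q-1) + 8 * q * (q-1) * s^2 * (s^2 + 1)^(q-1-1))))|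
      ≤ 8 * q * (1 + 2 * |q-1|) * R := by
    rw [abs_mul, abs_mul, abs_mul, abs_two]
    calc |x j| * (|x i| * (2 * |4 * q * (s^2 + 1)^(q-1) + 8 * q * (q-1) * s^2 * (s^2 + 1)^(q-1-1)|))
        = 2 * (|x j| * |x i|) * |4 * q * (s^2 + 1)^(q-1) + 8 * q * (q-1) * s^2 * (s^2 + 1)^(q-1-1)| := by ring
      _ ≤ 2 * s * (4 * q * (1 + 2 * |q-1|) * (s^2+1)^(q-1)) := by gcongr
      _ = 8 * q * (1 + 2 * |q-1|) * (s * (s^2+1)^(q-1)) := by ring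
      _ ≤ _ := by gcongr
  linarith

lemma step1 {α : ℝ} (hα : 2 < α) : ∃ C : ℝ, 0 < C ∧
    ∀ u : EuclideanSpace ℝ (Fin N) → ℝ, ContDiff ℝ 2 u → ∀ (i j : Fin N) (x : EuclideanSpace ℝ (Fin N)),
    |pd (pd (fun x => wA α x * u x) j) i x - wA α x * pd (pd u j) i x|
      ≤ C * (∑ k, (1:ℝ) * |(1 + ‖x‖)^(α-1) * pd u k x|) + C * |(1 + ‖x‖)^(α-2) * u x| := by
  obtain ⟨C, hC0, hC⟩ := pdpd_wA_le (N := N) hα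
  refine ⟨C + 2 * α, by positivity, fun u hu i j x => ?_⟩
  have dA := (wA_contDiff (N := N) α).differentiable (by norm_num)
  have du := hu.differentiable (by norm_num)
  have dpA : ∀ j, Differentiable ℝ (pd (wA (N := N) α) j) := fun j =>
    (((wA_contDiff (N := N) α).fderiv_right (m := 1) (by norm_num)).clm_apply contDiff_const).differentiable (by norm_num)
  have dpu : ∀ j, Differentiable ℝ (pd u j) := fun j =>
    ((hu.fderiv_right (m := 1) (by norm_num)).clm_apply contDiff_const).differentiable (by norm_num)
  have e : pd (fun x => wA α x * u x) j = fun x => wA α x * pd u j x + u x * pd (wA α) j x := by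
    funext y; exact pd_mul dA du j y
  rw [e, pd_add (f := fun x => wA α x * pd u j x) (g := fun x => u x * pd (wA α) j x) (dA.mul (dpu j)) (du.mul (dpA j)),
    pd_mul dA (dpu j), pd_mul du (dpA j)]
  have e2 : wA α x * pd (pd u j) i x + pd u j x * pd (wA α) i x + (u x * pd (pd (wA α) j) i x + pd (wA α) j x * pd u i x) - wA α x * pd (pd u j) i x
    = pd (wA α) i x * pd u j x + pd (wA α) j x * pd u i x + pd (pd (wA α) j) i x * u x := by ring
  rw [e2]
  have b1 := pd_wA_le hα i x
  have b2 := pd_wA_le hα j x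
  have b3 := hC i j x
  have hsum : ∀ l, |(1 + ‖x‖)^(α-1) * pd u l x| ≤ ∑ k, (1:ℝ) * |(1 + ‖x‖)^(α-1) * pd u k x| := by
    intro l
    have := Finset.single_le_sum (f := fun k => (1:ℝ) * |(1 + ‖x‖)^(α-1) * pd u k x|) (fun k _ => by positivity) (Finset.mem_univ l)
    simpa using this
  set S := ∑ k, (1:ℝ) * |(1 + ‖x‖)^(α-1) * pd u k x|
  have hS0 : 0 ≤ S := (abs_nonneg _).trans (hsum i)
  have t1 : |pd (wA α) i x * pd u j x| ≤ α * S := by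
    rw [abs_mul]
    have := hsum j
    rw [abs_mul, abs_of_nonneg (by positivity : 0 ≤ (1 + ‖x‖)^(α-1))] at this
    calc _ ≤ α * (1 + ‖x‖)^(α-1) * |pd u j x| := by gcongr
      _ = α * ((1 + ‖x‖)^(α-1) * |pd u j x|) := by ring
      _ ≤ _ := by gcongr
  have t2 : |pd (wA α) j x * pd u i x| ≤ α * S := by
    rw [abs_mul]
    have := hsum i
    rw [abs_mul, abs_of_nonneg (by positivity : 0 ≤ (1 + ‖x‖)^(α-1))] at this
    calc _ ≤ α * (1 + ‖x‖)^(α-1) * |pd u i x| := by gcongr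
      _ = α * ((1 + ‖x‖)^(α-1) * |pd u i x|) := by ring
      _ ≤ _ := by gcongr
  have t3 : |pd (pd (wA α) j) i x * u x| ≤ C * |(1 + ‖x‖)^(α-2) * u x| := by
    rw [abs_mul, abs_mul, abs_of_nonneg (by positivity : 0 ≤ (1 + ‖x‖)^(α-2)), ← mul_assoc]
    gcongr
  have t4 := abs_add_three (pd (wA α) i x * pd u j x) (pd (wA α) j x * pd u i x) (pd (pd (wA α) j) i x * u x)
  have t5 : 0 ≤ α * |(1 + ‖x‖)^(α-2) * u x| := by positivity
  have t6 : 0 ≤ C * S := by positivity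
  linarith

end PF

open Real MeasureTheory Metric
open scoped ENNReal NNReal

section PF2
variable {N : ℕ}

lemma rho_two {γ : ℝ} (hγ : 0 ≤ γ) {β : ℝ} (hβ : γ ≤ β) (x : EuclideanSpace ℝ (Fin N)) :
    (1 + ‖x‖)^γ ≤ 2^γ * (1 + ‖x‖^β) := by
  have hb : 0 ≤ ‖x‖^β := by positivity
  rcases le_or_gt ‖x‖ 1 with h | h
  · have h1 : (1 + ‖x‖)^γ ≤ 2^γ := Real.rpow_le_rpow (by positivity) (by linarith) hγ
    have : 0 ≤ (2:ℝ)^γ * ‖x‖^β := by positivity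
    linarith
  · have h1 : (1 + ‖x‖)^γ ≤ (2 * ‖x‖)^γ := Real.rpow_le_rpow (by positivity) (by linarith) hγ
    rw [Real.mul_rpow (by norm_num) (norm_nonneg _)] at h1
    have h2 : ‖x‖^γ ≤ ‖x‖^β := Real.rpow_le_rpow_of_exponent_le h.le hβ
    have h3 : (2:ℝ)^γ * ‖x‖^γ ≤ 2^γ * (1 + ‖x‖^β) := by gcongr; linarith
    linarith

lemma lap_bound {α β : ℝ} (b c : ℝ) (hα : 2 < α) (hc0 : 0 < c) (u : EuclideanSpace ℝ (Fin N) → ℝ)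
    (x : EuclideanSpace ℝ (Fin N)) :
    |wA α x * lap u x| ≤ 2^α * |opA α β b c u x|
      + 2^α * |b| * |(∑ k, (1:ℝ) * |(1 + ‖x‖)^(α-1) * pd u k x|)| + 2^α * c * |‖x‖^β * u x| := by
  have hA0 : 0 ≤ wA α x := by unfold wA; positivity
  have hA : wA α x ≤ 2^α * (1 + ‖x‖^α) := (wA_le (by linarith) x).trans (rho_two (by linarith) le_rfl x)
  have e : (1 + ‖x‖^α) * lap u x = opA α β b c u x - b * (‖x‖^(α-2) * ∑ i, x i * pd u i x) + c * (‖x‖^β * u x) := by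
    unfold opA; ring
  have h1 : |(1 + ‖x‖^α) * lap u x| ≤ |opA α β b c u x| + |b| * |‖x‖^(α-2) * ∑ i, x i * pd u i x| + c * |‖x‖^β * u x| := by
    rw [e]
    refine (abs_add_le _ _).trans ?_
    have := abs_sub (opA α β b c u x) (b * (‖x‖^(α-2) * ∑ i, x i * pd u i x))
    rw [abs_mul b] at this
    rw [abs_mul c, abs_of_pos hc0]
    linarith
  have h2 : |‖x‖^(α-2) * ∑ i, x i * pd u i x| ≤ |(∑ k, (1:ℝ) * |(1 + ‖x‖)^(α-1) * pd u k x|)| := by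
    refine le_trans ?_ (le_abs_self _)
    rw [Finset.mul_sum]
    refine (Finset.abs_sum_le_sum_abs _ _).trans (Finset.sum_le_sum fun k _ => ?_)
    rw [one_mul, abs_mul, abs_mul, abs_mul, abs_of_nonneg (by positivity : 0 ≤ ‖x‖^(α-2)), ← mul_assoc,
      abs_of_nonneg (by positivity : 0 ≤ (1+‖x‖)^(α-1))]
    have e1 : (1 + ‖x‖)^(α-1) = (1 + ‖x‖)^(α-2) * (1 + ‖x‖) := by
      rw [← Real.rpow_add_one (by positivity)]; congr 1; ring
    rw [e1]
    have hx : |x k| ≤ 1 + ‖x‖ := (abs_coord_le x k).trans (by linarith [norm_nonneg x])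
    have hx2 : ‖x‖^(α-2) ≤ (1 + ‖x‖)^(α-2) := Real.rpow_le_rpow (norm_nonneg _) (by linarith) (by linarith)
    gcongr
  have h3 : |wA α x * lap u x| ≤ 2^α * |(1 + ‖x‖^α) * lap u x| := by
    rw [abs_mul, abs_mul, abs_of_nonneg hA0, abs_of_nonneg (by positivity : 0 ≤ 1 + ‖x‖^α), ← mul_assoc]
    gcongr
  have h4 : |b| * |‖x‖^(α-2) * ∑ i, x i * pd u i x| ≤ |b| * |(∑ k, (1:ℝ) * |(1 + ‖x‖)^(α-1) * pd u k x|)| := by gcongr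
  have h5 := mul_le_mul_of_nonneg_left (h1.trans (add_le_add_left (add_le_add_right h4 _) _)) (by positivity : 0 ≤ (2:ℝ)^α)
  refine (h3.trans h5).trans (le_of_eq ?_)
  ring

set_option maxHeartbeats 1000000 in
lemma main_nL [NeZero N] {α β : ℝ} (b c : ℝ) (hα : 2 < α) (hβ : α - 2 < β) (hc0 : 0 < c) {P : ℝ} (hP : 1 < P) :
    ∃ C : ℝ, 0 < C ∧ ∀ u : EuclideanSpace ℝ (Fin N) → ℝ, ContDiff ℝ 2 u → HasCompactSupport u →
      ∑ i, ∑ j, nL P (fun x => (1 + ‖x‖)^α * pd (pd u j) i x)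
        ≤ C * (nL P (fun x => opA α β b c u x) + nL P u) := by
  have hβ0 : 0 < β := by linarith
  have hP0 : 0 < P := by linarith
  have hα0 : 0 < α := by linarith
  obtain ⟨K, hK0, hK⟩ := CZ (N := N) hP
  obtain ⟨C1, hC10, hC1⟩ := step1 (N := N) hα
  obtain ⟨C2, hC20, hC2⟩ := interp (N := N) hP hα.le
  obtain ⟨C3, hC30, hC3⟩ := potential (N := N) b c hα hβ hc0 hP
  set K1 : ℝ := K^(1/P) with hK1
  have hK10 : 0 < K1 := by positivity
  set a8 : ℝ := 8^(α/4) with ha8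
  have ha80 : 0 < a8 := by positivity
  set t2 : ℝ := 2^α with ht2
  have ht20 : 0 < t2 := by positivity
  set B1 : ℝ := (N:ℝ)^2 * a8 * (K1 * t2) with hB1
  set B2 : ℝ := (N:ℝ)^2 * a8 * (K1 * (t2 * |b| + N * C1) + C1) with hB2
  set B3 : ℝ := (N:ℝ)^2 * a8 * (K1 * (t2 * c)) with hB3
  set B4 : ℝ := (N:ℝ)^2 * a8 * (K1 * (N * C1) + C1) with hB4
  have hB10 : 0 ≤ B1 := by positivity
  have hB20 : 0 ≤ B2 := by positivity
  have hB30 : 0 ≤ B3 := by positivity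
  have hB40 : 0 ≤ B4 := by positivity
  set ε : ℝ := min (1/2) (1/(2*(B2*C2+1))) with hε
  have hε0 : 0 < ε := by
    have : 0 ≤ B2 * C2 := by positivity
    rw [hε]; exact lt_min (by norm_num) (by positivity)
  have hε1 : ε ≤ 1/2 := min_le_left _ _
  have hε2 : B2 * C2 * ε ≤ 1/2 := by
    have h0 : 0 ≤ B2 * C2 := by positivity
    have h1 : ε ≤ 1/(2*(B2*C2+1)) := min_le_right _ _
    have h2 : B2 * C2 * ε ≤ B2 * C2 * (1/(2*(B2*C2+1))) := by gcongr
    refine h2.trans ?_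
    rw [mul_one_div, div_le_div_iff₀ (by positivity) (by norm_num)]
    linarith
  set B5 : ℝ := B2 * (N * (C2/ε)) + B4 with hB5
  have hB50 : 0 ≤ B5 := by positivity
  set z : ℝ := 2^(α-2) with hz
  have hz0 : 0 < z := by positivity
  refine ⟨2 * (B1 + B3 * C3 + B5 * (z + z * C3)) + 1, by positivity, fun u hu hc => ?_⟩
  have huc : CC u := ⟨hu.continuous, hc⟩
  have hop := CC.opA hu hc b c hα hβ0
  have hv := huc.wmul (ncont (E := EuclideanSpace ℝ (Fin N)) hβ0)
  have hAc : Continuous (wA (N := N) α) := (wA_contDiff α).continuous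
  have hAu : ContDiff ℝ 2 (fun x => wA α x * u x) := (wA_contDiff α).mul hu
  have hAuc : HasCompactSupport (fun x => wA α x * u x) := (huc.wmul hAc).2
  have hG : ∀ k, CC (fun x => (1 + ‖x‖)^(α-1) * pd u k x) := fun k => (CC.pd hu hc k).wmul (wcont _)
  have hZ : CC (fun x => (1 + ‖x‖)^(α-2) * u x) := huc.wmul (wcont _)
  have hD : ∀ i j, CC (fun x => (1 + ‖x‖)^α * pd (pd u j) i x) := fun i j => (CC.pdpd hu hc i j).wmul (wcont _)
  have hAD : ∀ i j, CC (fun x => wA α x * pd (pd u j) i x) := fun i j => (CC.pdpd hu hc i j).wmul hAc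
  have hS : CC (fun x => ∑ k, (1:ℝ) * |(1 + ‖x‖)^(α-1) * pd u k x|) :=
    CC.sum Finset.univ fun k => (hG k).abs'.smul _
  have hDA : ∀ i j, CC (fun x => pd (pd (fun x => wA α x * u x) j) i x) := fun i j => CC.pdpd hAu hAuc i j
  have hLA : CC (fun x => lap (fun x => wA α x * u x) x) := CC.lap hAu hAuc
  have hAL : CC (fun x => wA α x * lap u x) := (CC.lap hu hc).wmul hAc
  set Y := ∑ i, ∑ j, nL P (fun x => (1 + ‖x‖)^α * pd (pd u j) i x) with hY
  set S := nL P (fun x => ∑ k, (1:ℝ) * |(1 + ‖x‖)^(α-1) * pd u k x|) with hSd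
  set Z := nL P (fun x => (1 + ‖x‖)^(α-2) * u x) with hZd
  set F := nL P (fun x => opA α β b c u x) with hF
  set U := nL P u with hU
  set V := nL P (fun x => ‖x‖^β * u x) with hV
  have nS : 0 ≤ S := nL_nonneg _ _
  have nZ : 0 ≤ Z := nL_nonneg _ _
  have nF : 0 ≤ F := nL_nonneg _ _
  have nU : 0 ≤ U := nL_nonneg _ _
  have nV : 0 ≤ V := nL_nonneg _ _
  have hV1 : V ≤ C3 * (F + U) := hC3 u hu hc
  have hZ1 : Z ≤ z * U + z * V := by
    refine nL_le2 hP hz0.le hz0.le huc hv fun x => ?_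
    have := rho_two (γ := α-2) (by linarith) hβ.le x
    rw [abs_mul, abs_mul, abs_of_nonneg (by positivity : 0 ≤ (1+‖x‖)^(α-2)), abs_of_nonneg (by positivity : 0 ≤ ‖x‖^β)]
    have h2 := mul_le_mul_of_nonneg_right this (abs_nonneg (u x))
    rw [← hz] at h2
    linarith
  have hY0 : ∀ i j, 0 ≤ nL P (fun x => (1 + ‖x‖)^α * pd (pd u j) i x) := fun i j => nL_nonneg _ _
  have hS1 : S ≤ C2 * ε * Y + N * (C2 / ε) * Z := by
    have h1 : S ≤ ∑ k, (1:ℝ) * nL P (fun x => (1 + ‖x‖)^(α-1) * pd u k x) :=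
      nL_sum hP Finset.univ (c := fun _ => (1:ℝ)) (fun _ => zero_le_one) hG
    have h2 : ∑ k, (1:ℝ) * nL P (fun x => (1 + ‖x‖)^(α-1) * pd u k x)
        ≤ ∑ k, (C2 * ε * (∑ j, nL P (fun x => (1 + ‖x‖)^α * pd (pd u j) k x)) + C2/ε * Z) := by
      refine Finset.sum_le_sum fun k _ => ?_
      rw [one_mul]
      refine (hC2 u hu hc k ε hε0 hε1).trans ?_
      have := Finset.single_le_sum (f := fun j => nL P (fun x => (1 + ‖x‖)^α * pd (pd u j) k x)) (fun j _ => hY0 k j) (Finset.mem_univ k)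
      gcongr
    have h3 : ∑ k, (C2 * ε * (∑ j, nL P (fun x => (1 + ‖x‖)^α * pd (pd u j) k x)) + C2/ε * Z) = C2 * ε * Y + N * (C2/ε) * Z := by
      rw [Finset.sum_add_distrib, ← Finset.mul_sum, Finset.sum_const, Finset.card_univ, Fintype.card_fin, nsmul_eq_mul, mul_assoc (N:ℝ)]
    exact h1.trans (h2.trans h3.le)
  have hLA1 : nL P (fun x => lap (fun x => wA α x * u x) x) ≤ t2 * F + (t2 * |b| + N * C1) * S + t2 * c * V + N * C1 * Z := by
    have h1 : nL P (fun x => wA α x * lap u x) ≤ t2 * F + t2 * |b| * S + t2 * c * V :=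
      nL_le3 hP ht20.le (by positivity) (by positivity) hop hS hv fun x => lap_bound b c hα hc0 u x
    have h2 : nL P (fun x => lap (fun x => wA α x * u x) x) ≤ 1 * nL P (fun x => wA α x * lap u x) + N * C1 * S + N * C1 * Z := by
      refine nL_le3 hP zero_le_one (by positivity) (by positivity) hAL hS hZ fun x => ?_
      have h3 : |lap (fun x => wA α x * u x) x - wA α x * lap u x|
          ≤ ∑ i : Fin N, (C1 * (∑ k, (1:ℝ) * |(1 + ‖x‖)^(α-1) * pd u k x|) + C1 * |(1 + ‖x‖)^(α-2) * u x|) := by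
        unfold lap
        rw [Finset.mul_sum, ← Finset.sum_sub_distrib]
        refine (Finset.abs_sum_le_sum_abs _ _).trans (Finset.sum_le_sum fun i _ => hC1 u hu i i x)
      rw [Finset.sum_const, Finset.card_univ, Fintype.card_fin, nsmul_eq_mul] at h3
      have h4 := abs_sub_abs_le_abs_sub (lap (fun x => wA α x * u x) x) (wA α x * lap u x)
      have h5 := mul_le_mul_of_nonneg_left (le_abs_self (∑ k, (1:ℝ) * |(1 + ‖x‖)^(α-1) * pd u k x|)) (by positivity : 0 ≤ N * C1)
      linarith
    linarith
  have hcz : ∀ i j, nL P (fun x => pd (pd (fun x => wA α x * u x) j) i x) ≤ K1 * nL P (fun x => lap (fun x => wA α x * u x) x) := by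
    intro i j
    have h := hK _ hAu hAuc i j
    rw [← nL_pow hP (hDA i j), ← nL_pow hP hLA] at h
    have n1 := nL_nonneg P (fun x => lap (fun x => wA α x * u x) x)
    rw [← Real.rpow_le_rpow_iff (nL_nonneg _ _) (by positivity) hP0, Real.mul_rpow hK10.le n1, hK1,
      ← Real.rpow_mul hK0.le, one_div_mul_cancel hP0.ne', Real.rpow_one]
    exact h
  set Q := nL P (fun x => lap (fun x => wA α x * u x) x) with hQ
  have hij : ∀ i j, nL P (fun x => (1 + ‖x‖)^α * pd (pd u j) i x) ≤ a8 * (K1 * Q + C1 * S + C1 * Z) := by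
    intro i j
    have h1 : nL P (fun x => wA α x * pd (pd u j) i x) ≤ 1 * nL P (fun x => pd (pd (fun x => wA α x * u x) j) i x) + C1 * S + C1 * Z := by
      refine nL_le3 hP zero_le_one hC10.le hC10.le (hDA i j) hS hZ fun x => ?_
      have h3 := hC1 u hu i j x
      have h4 := abs_sub_abs_le_abs_sub (wA α x * pd (pd u j) i x) (pd (pd (fun x => wA α x * u x) j) i x)
      rw [abs_sub_comm] at h4
      have h5 := mul_le_mul_of_nonneg_left (le_abs_self (∑ k, (1:ℝ) * |(1 + ‖x‖)^(α-1) * pd u k x|)) hC10.le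
      linarith
    have h2 : nL P (fun x => (1 + ‖x‖)^α * pd (pd u j) i x) ≤ a8 * nL P (fun x => wA α x * pd (pd u j) i x) := by
      rw [← nL_smul ha80.le]
      refine nL_mono ((hAD i j).smul _) fun x => ?_
      have h6 := le_wA hα0.le x
      have hA0 : 0 ≤ wA α x := by unfold wA; positivity
      rw [abs_mul, abs_mul, abs_mul, abs_of_nonneg hA0, abs_of_nonneg ha80.le, abs_of_nonneg (by positivity : 0 ≤ (1+‖x‖)^α), ← mul_assoc]
      gcongr
    have h7 := hcz i j
    refine h2.trans (mul_le_mul_of_nonneg_left ?_ ha80.le)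
    linarith
  have hYY : Y ≤ (N:ℝ)^2 * (a8 * (K1 * Q + C1 * S + C1 * Z)) := by
    have := Finset.sum_le_sum (s := (Finset.univ : Finset (Fin N))) fun i _ =>
      Finset.sum_le_sum (s := (Finset.univ : Finset (Fin N))) fun j _ => hij i j
    simp only [Finset.sum_const, Finset.card_univ, Fintype.card_fin, nsmul_eq_mul] at this
    refine this.trans (le_of_eq ?_)
    ring
  have hYn : 0 ≤ Y := Finset.sum_nonneg fun i _ => Finset.sum_nonneg fun j _ => hY0 i j
  clear hij hcz hC1 hC2 hC3 hK hY0
  clear_value Y S Z F U V Q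
  clear_value a8 K1 t2 z
  have hY2 : Y ≤ B1 * F + B2 * S + B3 * V + B4 * Z := by
    have h1 : (N:ℝ)^2 * (a8 * (K1 * Q + C1 * S + C1 * Z)) ≤ (N:ℝ)^2 * (a8 * (K1 * (t2 * F + (t2 * |b| + N * C1) * S + t2 * c * V + N * C1 * Z) + C1 * S + C1 * Z)) := by
      gcongr
    refine (hYY.trans h1).trans (le_of_eq ?_)
    rw [hB1, hB2, hB3, hB4]; ring
  clear_value B5 ε
  clear_value B1 B2 B3 B4
  have hY3 : Y ≤ 1/2 * Y + (B1 * F + B3 * V + B5 * Z) := by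
    have h1 : B2 * S ≤ B2 * (C2 * ε * Y + N * (C2 / ε) * Z) := by gcongr
    have h2 : B2 * C2 * ε * Y ≤ 1/2 * Y := by gcongr
    have h3 : B5 * Z = B2 * (N * (C2/ε)) * Z + B4 * Z := by rw [hB5]; ring
    rw [h3]
    linarith
  have hY4 : Y ≤ 2 * (B1 * F + B3 * V + B5 * Z) := by linarith
  have h1 : B3 * V ≤ B3 * (C3 * (F + U)) := by gcongr
  have h2 : B5 * Z ≤ B5 * (z * U + z * (C3 * (F + U))) := by
    refine mul_le_mul_of_nonneg_left (hZ1.trans ?_) hB50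
    have := mul_le_mul_of_nonneg_left hV1 hz0.le
    linarith
  have h3 : B1 * F ≤ B1 * (F + U) := by gcongr; linarith
  have h4 : B5 * (z * U) ≤ B5 * (z * (F + U)) := by gcongr; linarith
  have h5 : 0 ≤ F + U := by linarith
  linarith

theorem stmt8_aux (N : ℕ) (hN : 2 < N) (α β b c : ℝ) (hα : 2 < α) (hβ : α - 2 < β) (hc : 0 < c)
    (p : ℝ≥0∞) (hp1 : 1 < p) (hp2 : p ≠ ⊤) :
    ∃ C : ℝ≥0, 0 < C ∧ ∀ u : EuclideanSpace ℝ (Fin N) → ℝ, ContDiff ℝ (⊤ : ℕ∞) u → HasCompactSupport u →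
      eLpNorm (fun x => (1 + ‖x‖ ^ α) * Real.sqrt (∑ i, ∑ j, (pd (pd u j) i x) ^ 2)) p volume
        ≤ C * (eLpNorm (fun x => opA α β b c u x) p volume + eLpNorm u p volume) := by
  have : NeZero N := ⟨by omega⟩
  set P := p.toReal with hPd
  have hpP : p = ENNReal.ofReal P := (ENNReal.ofReal_toReal hp2).symm
  have hP : 1 < P := by
    rw [hPd, ← ENNReal.toReal_one]
    exact (ENNReal.toReal_lt_toReal (by simp) hp2).2 hp1
  have hβ0 : 0 < β := by linarith
  obtain ⟨C, hC0, hC⟩ := main_nL (N := N) b c hα hβ hc hP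
  refine ⟨Real.toNNReal (2 * C), by simpa using hC0, fun u hu' hs => ?_⟩
  have hu : ContDiff ℝ 2 u := hu'.of_le (WithTop.coe_le_coe.2 (le_top : (2:ℕ∞) ≤ ⊤))
  have huc : CC u := ⟨hu.continuous, hs⟩
  have hop := CC.opA hu hs b c hα hβ0
  have hD : ∀ i j, CC (fun x => (1 + ‖x‖)^α * pd (pd u j) i x) := fun i j => (CC.pdpd hu hs i j).wmul (wcont _)
  set T : EuclideanSpace ℝ (Fin N) → ℝ := fun x => ∑ k : Fin N × Fin N, (2:ℝ) * |(1 + ‖x‖)^α * pd (pd u k.2) k.1 x| with hT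
  have hTc : CC T := CC.sum Finset.univ fun k => (hD k.1 k.2).abs'.smul _
  have h1 : nL P T ≤ ∑ k : Fin N × Fin N, (2:ℝ) * nL P (fun x => (1 + ‖x‖)^α * pd (pd u k.2) k.1 x) :=
    nL_sum hP Finset.univ (c := fun _ => (2:ℝ)) (fun _ => by norm_num) fun k : Fin N × Fin N => hD k.1 k.2
  have h2 : nL P T ≤ 2 * C * (nL P (fun x => opA α β b c u x) + nL P u) := by
    refine h1.trans ?_
    rw [← Finset.mul_sum, Fintype.sum_prod_type, mul_assoc]
    have := hC u hu hs
    gcongr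
  have h3 : eLpNorm (fun x => (1 + ‖x‖ ^ α) * Real.sqrt (∑ i, ∑ j, (pd (pd u j) i x) ^ 2)) p volume ≤ eLpNorm T p volume := by
    refine eLpNorm_mono_real fun x => ?_
    rw [hT, Real.norm_eq_abs, abs_of_nonneg (by positivity)]
    simp only
    have a1 : Real.sqrt (∑ i, ∑ j, (pd (pd u j) i x) ^ 2) ≤ ∑ k : Fin N × Fin N, |pd (pd u k.2) k.1 x| := by
      rw [← Fintype.sum_prod_type (f := fun k : Fin N × Fin N => (pd (pd u k.2) k.1 x) ^ 2)]
      apply Real.sqrt_le_iff.2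
      refine ⟨Finset.sum_nonneg fun k _ => abs_nonneg _, ?_⟩
      have := Finset.sum_sq_le_sq_sum_of_nonneg (s := Finset.univ) (f := fun k : Fin N × Fin N => |pd (pd u k.2) k.1 x|) (fun k _ => abs_nonneg _)
      simpa only [sq_abs] using this
    have a2 : 1 + ‖x‖^α ≤ 2 * (1 + ‖x‖)^α := by
      have b1 : ‖x‖^α ≤ (1 + ‖x‖)^α := Real.rpow_le_rpow (norm_nonneg _) (by linarith) (by linarith)
      have b2 : 1 ≤ (1 + ‖x‖)^α := Real.one_le_rpow (by linarith [norm_nonneg x]) (by linarith)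
      linarith
    calc _ ≤ (2 * (1 + ‖x‖)^α) * ∑ k : Fin N × Fin N, |pd (pd u k.2) k.1 x| := by gcongr
      _ = _ := by
        rw [Finset.mul_sum]
        refine Finset.sum_congr rfl fun k _ => ?_
        rw [abs_mul, abs_of_nonneg (by positivity : 0 ≤ (1 + ‖x‖)^α)]; ring
  refine h3.trans ?_
  rw [hpP, ← ENNReal.ofReal_toReal (hTc.ne_top (ENNReal.ofReal P)),
    ← ENNReal.ofReal_toReal (hop.ne_top (ENNReal.ofReal P)), ← ENNReal.ofReal_toReal (huc.ne_top (ENNReal.ofReal P)),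
    ← ENNReal.ofReal_add ENNReal.toReal_nonneg ENNReal.toReal_nonneg]
  change _ ≤ ENNReal.ofReal (2 * C) * _
  rw [← ENNReal.ofReal_mul (by positivity)]
  exact ENNReal.ofReal_le_ofReal h2

end PF2

/-- weighted second-derivative estimate. For every `1 < p < ∞` there is
`C > 0` such that `‖(1+|x|^α) D²u‖_p ≤ C (‖Au‖_p + ‖u‖_p)` for all `u ∈ C_c^∞(ℝ^N)`,
where `|D²u(x)|` is the Hilbert–Schmidt norm of the Hessian. -/
theorem stmt8 (N : ℕ) (hN : 2 < N) (α β b c : ℝ) (hα : 2 < α) (hβ : α - 2 < β) (hc : 0 < c)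
    (p : ℝ≥0∞) (hp1 : 1 < p) (hp2 : p ≠ ⊤) :
    ∃ C : ℝ≥0, 0 < C ∧
      ∀ u : EuclideanSpace ℝ (Fin N) → ℝ, ContDiff ℝ (⊤ : ℕ∞) u → HasCompactSupport u →
        eLpNorm (fun x => (1 + ‖x‖ ^ α) * Real.sqrt (∑ i, ∑ j, (pd (pd u j) i x) ^ 2))
            p volume ≤
          (C : ℝ≥0∞) * (eLpNorm (fun x => opA α β b c u x) p volume
            + eLpNorm u p volume) := by
  exact stmt8_aux N hN α β b c hα hβ hc p hp1 hp2
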